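/- arXiv:1111.4796 — 2 statements merged into one kernel-verified Lean document; each statement's English description precedes it below -/
import Mathlib

section
/- (Voronoï-type formula, (5.9)) Fix an integer l ≥ 1 and an irrational θ > 0 of finite approximation type γ ≥ 1. For every ε > 0 there exist C > 0 and T₀ ≥ 3 such that for all T ≥ T₀, setting H = T² and J = ⌊(log T − log log T)/(2 log 2)⌋, one has for every x ∈ [T, 2T]: |R₁(x,H) − R₁₁(x,H)| ≤ C·T^{l − 1/2 + γ/(4γ+2) + ε}. -/
open Finset

/-- An irrational real `α` is of finite approximation type `γ` if `γ ≥ 1` and for every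
`ε > 0` there is `c(ε) > 0` with `|α − p/q| ≥ c(ε)·q^{−γ−1−ε}` for all integers `p` and all
positive integers `q`. -/
def IsApproxType (α γ : ℝ) : Prop :=
  1 ≤ γ ∧ ∀ ε : ℝ, 0 < ε → ∃ c : ℝ, 0 < c ∧
    ∀ p : ℤ, ∀ q : ℕ, 0 < q → |α - (p : ℝ) / q| ≥ c * (q : ℝ) ^ (-γ - 1 - ε)

/-- `R₁(x,H) = (2^{2−l}/((l−1)!·π)) · Σ_{1≤h≤H} ((−1)^{lh}/h) ·
Σ_{1≤m≤√(x/θ)} m·(x − θm²)^{l−1}·sin(2πh(x/(2m) − θm/2))`. -/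
noncomputable def R1 (l : ℕ) (θ : ℝ) (x H : ℝ) : ℝ :=
  ((2 : ℝ) ^ ((2 : ℤ) - l) / ((l - 1).factorial * Real.pi)) *
    ∑ h ∈ Finset.Icc 1 ⌊H⌋₊, ((-1 : ℝ) ^ (l * h) / h) *
      ∑ m ∈ Finset.Icc 1 ⌊Real.sqrt (x / θ)⌋₊,
        (m : ℝ) * (x - θ * m ^ 2) ^ (l - 1) *
          Real.sin (2 * Real.pi * h * (x / (2 * m) - θ * m / 2))

/-- `u(h,r) = (−1)^{lh}·h^{−1/4}·(2r − θh)^{−5/4}·(1 − θh/(2r − θh))^{l−1}`. -/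
noncomputable def uCoef (l : ℕ) (θ : ℝ) (h r : ℕ) : ℝ :=
  (-1 : ℝ) ^ (l * h) * (h : ℝ) ^ (-(1 : ℝ) / 4) *
    (2 * (r : ℝ) - θ * h) ^ (-(5 : ℝ) / 4) *
    (1 - θ * h / (2 * (r : ℝ) - θ * h)) ^ (l - 1)

/-- `J = ⌊(log T − log log T)/(2 log 2)⌋`. -/
noncomputable def Jdef (T : ℝ) : ℕ :=
  ⌊(Real.log T - Real.log (Real.log T)) / (2 * Real.log 2)⌋₊

/-- `R₁₁(x,H) = (2^{2−l}/((l−1)!·π))·x^{l−1/4}·Σ_{1≤h≤H}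
Σ_{θh < r ≤ θh(2^{2J+1}+1/2)} u(h,r)·cos(2π√(x·h(2r − θh)) − π/4)`, with `J = Jdef T`. -/
noncomputable def R11 (l : ℕ) (θ : ℝ) (T x H : ℝ) : ℝ :=
  ((2 : ℝ) ^ ((2 : ℤ) - l) / ((l - 1).factorial * Real.pi)) * x ^ ((l : ℝ) - 1 / 4) *
    ∑ h ∈ Finset.Icc 1 ⌊H⌋₊,
      ∑ r ∈ Finset.Ioc ⌊θ * h⌋₊ ⌊θ * h * (2 ^ (2 * Jdef T + 1) + 1 / 2)⌋₊,
        uCoef l θ h r *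
          Real.cos (2 * Real.pi * Real.sqrt (x * h * (2 * (r : ℝ) - θ * h)) - Real.pi / 4)

open Classical in
/-- `C_{l,θ} = Σ_{h=1}^∞ Σ_{r > θh} (1 − θh/(2r − θh))^{2l−2}·h^{−1/2}·(2r − θh)^{−5/2}`. -/
noncomputable def Cconst (l : ℕ) (θ : ℝ) : ℝ :=
  ∑' p : ℕ × ℕ,
    if 1 ≤ p.1 ∧ 1 ≤ p.2 ∧ θ * p.1 < (p.2 : ℝ) then
      (1 - θ * p.1 / (2 * (p.2 : ℝ) - θ * p.1)) ^ (2 * l - 2) *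
        (p.1 : ℝ) ^ (-(1 : ℝ) / 2) * (2 * (p.2 : ℝ) - θ * p.1) ^ (-(5 : ℝ) / 2)
    else 0

namespace Voronoi

/-- The additive character `e(y) = exp(2πiy)`. -/
noncomputable def eR (y : ℝ) : ℂ := Complex.exp (((2 * Real.pi * y : ℝ) : ℂ) * Complex.I)

lemma norm_eR (y : ℝ) : ‖eR y‖ = 1 := by
  simpa [eR] using Complex.norm_exp_ofReal_mul_I (2 * Real.pi * y)

lemma eR_add (x y : ℝ) : eR (x + y) = eR x * eR y := by
  simp only [eR, ← Complex.exp_add]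
  push_cast
  ring_nf

lemma eR_im (y : ℝ) : (eR y).im = Real.sin (2 * Real.pi * y) := by
  rw [eR, Complex.exp_ofReal_mul_I_im]

lemma continuous_eR : Continuous eR := by
  unfold eR
  fun_prop

lemma hasDerivAt_eR_comp {f : ℝ → ℝ} {f' t : ℝ} (hf : HasDerivAt f f' t) :
    HasDerivAt (fun s => eR (f s)) (2 * Real.pi * Complex.I * f' * eR (f t)) t := by
  have h1 : HasDerivAt (fun s => (((2 * Real.pi * f s : ℝ) : ℂ) * Complex.I))
      (((2 * Real.pi * f' : ℝ) : ℂ) * Complex.I) t :=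
    ((hf.const_mul (2 * Real.pi)).ofReal_comp).mul_const _
  refine h1.cexp.congr_deriv ?_
  change Complex.exp (((2 * Real.pi * f t : ℝ) : ℂ) * Complex.I) * _ =
    _ * Complex.exp (((2 * Real.pi * f t : ℝ) : ℂ) * Complex.I)
  push_cast
  ring

/-- First derivative test with a weight `P * Q`, both factors being monotone. -/
lemma norm_integral_mul_eR_le {a b p q : ℝ} (hab : a ≤ b) {P P' Q Q' Φ Φ' : ℝ → ℝ}
    (hP : ∀ t ∈ Set.Icc a b, HasDerivAt P (P' t) t)
    (hQ : ∀ t ∈ Set.Icc a b, HasDerivAt Q (Q' t) t)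
    (hΦ : ∀ t ∈ Set.Icc a b, HasDerivAt Φ (Φ' t) t)
    (hPc : ContinuousOn P' (Set.Icc a b)) (hQc : ContinuousOn Q' (Set.Icc a b))
    (hΦc : ContinuousOn Φ' (Set.Icc a b))
    (hP0 : ∀ t ∈ Set.Icc a b, 0 ≤ P' t)
    (hQ0 : (∀ t ∈ Set.Icc a b, 0 ≤ Q' t) ∨ (∀ t ∈ Set.Icc a b, Q' t ≤ 0))
    (hPp : ∀ t ∈ Set.Icc a b, |P t| ≤ p) (hQq : ∀ t ∈ Set.Icc a b, |Q t| ≤ q) :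
    ‖∫ t in a..b, ((P t * Q t * Φ' t : ℝ) : ℂ) * eR (Φ t)‖ ≤ p * q := by
  have hu : Set.uIcc a b = Set.Icc a b := Set.uIcc_of_le hab
  have ha : a ∈ Set.Icc a b := ⟨le_rfl, hab⟩
  have hb : b ∈ Set.Icc a b := ⟨hab, le_rfl⟩
  have hp : 0 ≤ p := (abs_nonneg _).trans (hPp a ha)
  have hq : 0 ≤ q := (abs_nonneg _).trans (hQq a ha)
  have hPC : ContinuousOn P (Set.Icc a b) := fun t ht => (hP t ht).continuousAt.continuousWithinAt
  have hQC : ContinuousOn Q (Set.Icc a b) := fun t ht => (hQ t ht).continuousAt.continuousWithinAt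
  have hΦC : ContinuousOn Φ (Set.Icc a b) := fun t ht => (hΦ t ht).continuousAt.continuousWithinAt
  have hEC : ContinuousOn (fun t => eR (Φ t)) (Set.Icc a b) := continuous_eR.comp_continuousOn hΦC
  have hW : ∀ t ∈ Set.uIcc a b, HasDerivAt (fun t => ((P t * Q t : ℝ) : ℂ))
      ((P' t * Q t + P t * Q' t : ℝ) : ℂ) t := by
    intro t ht
    rw [hu] at ht
    exact ((hP t ht).mul (hQ t ht)).ofReal_comp
  have hE : ∀ t ∈ Set.uIcc a b, HasDerivAt (fun s => eR (Φ s))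
      (2 * Real.pi * Complex.I * Φ' t * eR (Φ t)) t := by
    intro t ht
    rw [hu] at ht
    exact hasDerivAt_eR_comp (hΦ t ht)
  have hW'c : ContinuousOn (fun t => ((P' t * Q t + P t * Q' t : ℝ) : ℂ)) (Set.Icc a b) :=
    Complex.continuous_ofReal.comp_continuousOn ((hPc.mul hQC).add (hPC.mul hQc))
  have hE'c : ContinuousOn (fun t => 2 * Real.pi * Complex.I * Φ' t * eR (Φ t))
      (Set.Icc a b) :=
    ((continuousOn_const).mul (Complex.continuous_ofReal.comp_continuousOn hΦc)).mul hEC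
  have hparts := intervalIntegral.integral_mul_deriv_eq_deriv_mul hW hE
    (hW'c.intervalIntegrable_of_Icc hab) (hE'c.intervalIntegrable_of_Icc hab)
  have hI : (2 * Real.pi * Complex.I) * ∫ t in a..b, ((P t * Q t * Φ' t : ℝ) : ℂ) * eR (Φ t) =
      ∫ t in a..b, ((P t * Q t : ℝ) : ℂ) * (2 * Real.pi * Complex.I * Φ' t * eR (Φ t)) := by
    rw [← intervalIntegral.integral_const_mul]
    congr 1
    ext t
    push_cast
    ring
  have hbd : ∀ t ∈ Set.Icc a b, ‖((P t * Q t : ℝ) : ℂ) * eR (Φ t)‖ ≤ p * q := by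
    intro t ht
    rw [norm_mul, norm_eR, mul_one, Complex.norm_real, Real.norm_eq_abs, abs_mul]
    exact mul_le_mul (hPp t ht) (hQq t ht) (abs_nonneg _) hp
  have hP'i : IntervalIntegrable P' MeasureTheory.volume a b := hPc.intervalIntegrable_of_Icc hab
  have hQ'i : IntervalIntegrable Q' MeasureTheory.volume a b := hQc.intervalIntegrable_of_Icc hab
  have hPint : ∫ t in a..b, P' t = P b - P a :=
    intervalIntegral.integral_eq_sub_of_hasDerivAt (by rwa [hu]) hP'i
  have hQint : ∫ t in a..b, Q' t = Q b - Q a :=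
    intervalIntegral.integral_eq_sub_of_hasDerivAt (by rwa [hu]) hQ'i
  obtain ⟨s, hs, hsQ⟩ : ∃ s : ℝ, |s| = 1 ∧ ∀ t ∈ Set.Icc a b, |Q' t| = s * Q' t := by
    rcases hQ0 with h | h
    · exact ⟨1, by simp, fun t ht => by rw [abs_of_nonneg (h t ht), one_mul]⟩
    · exact ⟨-1, by simp, fun t ht => by rw [abs_of_nonpos (h t ht), neg_one_mul]⟩
  have hvar : ‖∫ t in a..b, ((P' t * Q t + P t * Q' t : ℝ) : ℂ) * eR (Φ t)‖ ≤ 4 * (p * q) := by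
    have h1 : ‖∫ t in a..b, ((P' t * Q t + P t * Q' t : ℝ) : ℂ) * eR (Φ t)‖ ≤
        ∫ t in a..b, (q * P' t + p * s * Q' t) := by
      refine intervalIntegral.norm_integral_le_of_norm_le hab ?_
        ((hP'i.const_mul q).add (hQ'i.const_mul (p * s)))
      refine Filter.Eventually.of_forall fun t ht => ?_
      have ht' : t ∈ Set.Icc a b := Set.Ioc_subset_Icc_self ht
      rw [norm_mul, norm_eR, mul_one, Complex.norm_real, Real.norm_eq_abs]
      refine (abs_add_le _ _).trans ?_
      rw [abs_mul, abs_mul, hsQ t ht', abs_of_nonneg (hP0 t ht')]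
      have h2 := mul_le_mul_of_nonneg_left (hQq t ht') (hP0 t ht')
      have h3 := mul_le_mul_of_nonneg_right (hPp t ht') (abs_nonneg (Q' t))
      rw [hsQ t ht'] at h3
      linarith
    rw [intervalIntegral.integral_add (hP'i.const_mul q) (hQ'i.const_mul (p * s)),
      intervalIntegral.integral_const_mul, intervalIntegral.integral_const_mul, hPint, hQint] at h1
    have h4 : q * (P b - P a) ≤ q * (2 * p) := by
      gcongr
      linarith [(abs_le.mp (hPp a ha)).1, (abs_le.mp (hPp b hb)).2]
    have h5 : p * s * (Q b - Q a) ≤ p * (2 * q) := by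
      rw [mul_assoc]
      refine mul_le_mul_of_nonneg_left ((le_abs_self _).trans ?_) hp
      rw [abs_mul, hs, one_mul]
      refine (abs_sub _ _).trans ?_
      linarith [hQq a ha, hQq b hb]
    linarith
  have htot : ‖(2 * Real.pi * Complex.I) *
      ∫ t in a..b, ((P t * Q t * Φ' t : ℝ) : ℂ) * eR (Φ t)‖ ≤ 6 * (p * q) := by
    rw [hI, hparts]
    refine (norm_sub_le _ _).trans ?_
    have := (norm_sub_le (((P b * Q b : ℝ) : ℂ) * eR (Φ b)) (((P a * Q a : ℝ) : ℂ) * eR (Φ a)))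
    linarith [hbd a ha, hbd b hb]
  rw [norm_mul] at htot
  have hpi : ‖(2 * Real.pi * Complex.I : ℂ)‖ = 2 * Real.pi := by
    simp [abs_of_pos Real.pi_pos]
  rw [hpi] at htot
  have h3 := Real.pi_gt_three
  have h0 := norm_nonneg (∫ t in a..b, ((P t * Q t * Φ' t : ℝ) : ℂ) * eR (Φ t))
  nlinarith

lemma norm_integral_gaussian_tail_le {W X δ : ℝ} (hW : 0 < W) (hX : W ≤ X) (hδ : 0 ≤ δ) :
    ‖∫ u in W..X, ((Real.exp (-δ * u ^ 2) : ℝ) : ℂ) * eR (u ^ 2)‖ ≤ 1 / (2 * W) := by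
  have hpos : ∀ t ∈ Set.Icc W X, 0 < t := fun t ht => hW.trans_le ht.1
  have key := norm_integral_mul_eR_le (p := 1) (q := 1 / (2 * W)) hX
    (P := fun _ => 1) (P' := fun _ => 0)
    (Q := fun u => Real.exp (-δ * u ^ 2) / (2 * u))
    (Q' := fun u => (Real.exp (-δ * u ^ 2) * (-δ * (2 * u)) * (2 * u)
      - Real.exp (-δ * u ^ 2) * 2) / (2 * u) ^ 2)
    (Φ := fun u => u ^ 2) (Φ' := fun u => 2 * u)
    (fun t _ => hasDerivAt_const t 1)
    (fun t ht => by
      have h0 := (hpos t ht).ne'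
      have h1 : HasDerivAt (fun u : ℝ => u ^ 2) (2 * t) t := by simpa using hasDerivAt_pow 2 t
      have h2 := (h1.const_mul (-δ)).exp
      have h3 : HasDerivAt (fun u : ℝ => 2 * u) 2 t := by
        simpa using (hasDerivAt_id t).const_mul 2
      exact h2.div h3 (by positivity))
    (fun t _ => by simpa using hasDerivAt_pow 2 t)
    continuousOn_const
    (ContinuousOn.div (by fun_prop) (by fun_prop) fun t ht => by
      have := hpos t ht
      positivity)
    (by fun_prop) (fun _ _ => le_rfl)
    (Or.inr fun t ht => by
      have h0 := hpos t ht
      have h1 := Real.exp_pos (-δ * t ^ 2)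
      refine div_nonpos_of_nonpos_of_nonneg ?_ (by positivity)
      have : 0 ≤ Real.exp (-δ * t ^ 2) * (δ * (2 * t)) * (2 * t) := by positivity
      nlinarith)
    (fun t _ => by simp)
    (fun t ht => by
      have h0 := hpos t ht
      rw [abs_of_nonneg (by positivity)]
      have h1 : Real.exp (-δ * t ^ 2) ≤ 1 := Real.exp_le_one_iff.mpr (by nlinarith [sq_nonneg t])
      have h2 := ht.1
      gcongr)
  rw [one_mul] at key
  refine le_of_eq_of_le ?_ key
  congr 1
  refine intervalIntegral.integral_congr fun t ht => ?_
  rw [Set.uIcc_of_le hX] at ht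
  have h0 := (hpos t ht).ne'
  have : (1 : ℝ) * (Real.exp (-δ * t ^ 2) / (2 * t)) * (2 * t) = Real.exp (-δ * t ^ 2) := by
    field_simp
  simp only [this]

lemma norm_integral_eR_sq_le_inv {W X : ℝ} (hW : 0 < W) (hX : W ≤ X) :
    ‖∫ u in W..X, eR (u ^ 2)‖ ≤ 1 / (2 * W) := by
  simpa using norm_integral_gaussian_tail_le hW hX le_rfl

lemma norm_integral_eR_sq_le {W X : ℝ} (hW : 0 < W) (hX : W ≤ X) :
    ‖∫ u in W..X, eR (u ^ 2)‖ ≤ min 2 (1 / W) := by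
  have hfin : ∀ a b : ℝ, IntervalIntegrable (fun u : ℝ => eR (u ^ 2)) MeasureTheory.volume a b :=
    fun a b => (continuous_eR.comp (by fun_prop)).intervalIntegrable a b
  have htriv : ∀ a b : ℝ, a ≤ b → ‖∫ u in a..b, eR (u ^ 2)‖ ≤ b - a := fun a b hab => by
    have := intervalIntegral.norm_integral_le_of_norm_le_const (a := a) (b := b) (C := 1)
      (f := fun u : ℝ => eR (u ^ 2)) (fun x _ => (norm_eR _).le)
    rwa [one_mul, abs_of_nonneg (by linarith)] at this
  refine le_min ?_ ((norm_integral_eR_sq_le_inv hW hX).trans ?_)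
  · rcases le_total 1 W with h | h
    · refine (norm_integral_eR_sq_le_inv hW hX).trans ?_
      rw [div_le_iff₀ (by positivity)]
      linarith
    · rcases le_total X 1 with h' | h'
      · linarith [htriv W X hX]
      · rw [← intervalIntegral.integral_add_adjacent_intervals (hfin W 1) (hfin 1 X)]
        refine (norm_add_le _ _).trans ?_
        have := norm_integral_eR_sq_le_inv one_pos h'
        linarith [htriv W 1 h]
  · gcongr
    linarith

lemma integral_neg_even {E : Type*} [NormedAddCommGroup E] [NormedSpace ℝ E] (f : ℝ → E)
    (hf : ∀ u, f (-u) = f u) (a b : ℝ) : ∫ u in (-b)..(-a), f u = ∫ u in a..b, f u := by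
  rw [← intervalIntegral.integral_comp_neg]
  simp only [hf]

lemma norm_integral_gaussian_sub_le {X δ : ℝ} (hX : 0 < X) (hδ : 0 < δ) :
    ‖(∫ u in (-X)..X, ((Real.exp (-δ * u ^ 2) : ℝ) : ℂ) * eR (u ^ 2)) -
      (Real.pi / (δ - 2 * Real.pi * Complex.I)) ^ (1 / 2 : ℂ)‖ ≤ 1 / X := by
  set f : ℝ → ℂ := fun u => ((Real.exp (-δ * u ^ 2) : ℝ) : ℂ) * eR (u ^ 2) with hf
  set b : ℂ := δ - 2 * Real.pi * Complex.I with hb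
  have hbre : 0 < b.re := by simp [hb, hδ]
  have hfb : ∀ u : ℝ, f u = Complex.exp (-b * (u : ℂ) ^ 2) := by
    intro u
    simp only [hf, eR, hb, Complex.ofReal_exp, ← Complex.exp_add]
    congr 1
    push_cast
    ring
  have hcont : Continuous f := by
    have := continuous_eR
    fun_prop
  have hfin : ∀ a b : ℝ, IntervalIntegrable f MeasureTheory.volume a b :=
    fun a b => hcont.intervalIntegrable a b
  have hfi : MeasureTheory.Integrable f := by
    simpa only [← hfb] using integrable_cexp_neg_mul_sq hbre
  have hlim := MeasureTheory.intervalIntegral_tendsto_integral hfi Filter.tendsto_neg_atTop_atBot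
    Filter.tendsto_id
  have hval : ∫ u, f u = (Real.pi / b) ^ (1 / 2 : ℂ) := by
    simp only [hfb]
    exact integral_gaussian_complex hbre
  rw [hval] at hlim
  have hlim2 := (hlim.const_sub (∫ u in (-X)..X, f u)).norm
  refine le_of_tendsto hlim2 ?_
  filter_upwards [Filter.eventually_ge_atTop X] with Y hY
  have hsplit : ∫ u in (-Y)..(id Y), f u =
      (∫ u in (-Y)..(-X), f u) + (∫ u in (-X)..X, f u) + ∫ u in X..Y, f u := by
    rw [intervalIntegral.integral_add_adjacent_intervals (hfin _ _) (hfin _ _),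
      intervalIntegral.integral_add_adjacent_intervals (hfin _ _) (hfin _ _), id]
  have heven := integral_neg_even f (fun u => by simp [hf]) X Y
  have htail := norm_integral_gaussian_tail_le hX hY hδ.le
  rw [hsplit, heven]
  have : (∫ u in (-X)..X, f u) - ((∫ u in X..Y, f u) + (∫ u in (-X)..X, f u) + ∫ u in X..Y, f u)
      = -((∫ u in X..Y, f u) + ∫ u in X..Y, f u) := by ring
  rw [this, norm_neg]
  refine (norm_add_le _ _).trans ?_
  have h2 : 1 / X = 1 / (2 * X) + 1 / (2 * X) := by
    field_simp
    norm_num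
  rw [h2]
  exact add_le_add htail htail

lemma eR_eighth_sq : (eR (1 / 8) / (Real.sqrt 2 : ℝ)) ^ 2 = Complex.I / 2 := by
  have h : eR (1 / 8) ^ 2 = Complex.I := by
    rw [sq, ← eR_add, eR]
    have : (((2 * Real.pi * (1 / 8 + 1 / 8) : ℝ) : ℂ) * Complex.I) =
        Real.pi / 2 * Complex.I := by
      push_cast
      ring
    rw [this, Complex.exp_pi_div_two_mul_I]
  rw [div_pow, h, ← Complex.ofReal_pow, Real.sq_sqrt (by norm_num)]
  norm_num

lemma I_div_two_cpow : (Complex.I / 2) ^ (1 / 2 : ℂ) = eR (1 / 8) / (Real.sqrt 2 : ℝ) := by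
  rw [← eR_eighth_sq, one_div (2 : ℂ)]
  refine Complex.sq_cpow_two_inv ?_
  rw [Complex.div_ofReal_re]
  refine div_pos ?_ (by positivity)
  rw [eR, Complex.exp_ofReal_mul_I_re]
  refine Real.cos_pos_of_mem_Ioo ⟨?_, ?_⟩ <;> linarith [Real.pi_pos]

lemma norm_integral_eR_sq_symm_sub_le {X : ℝ} (hX : 0 < X) :
    ‖(∫ u in (-X)..X, eR (u ^ 2)) - eR (1 / 8) / (Real.sqrt 2 : ℝ)‖ ≤ 1 / X := by
  have h1 : Filter.Tendsto (fun δ : ℝ =>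
      ∫ u in (-X)..X, ((Real.exp (-δ * u ^ 2) : ℝ) : ℂ) * eR (u ^ 2))
      (nhdsWithin 0 (Set.Ioi 0)) (nhds (∫ u in (-X)..X, eR (u ^ 2))) := by
    have hc : Continuous (fun δ : ℝ =>
        ∫ u in (-X)..X, ((Real.exp (-δ * u ^ 2) : ℝ) : ℂ) * eR (u ^ 2)) := by
      apply intervalIntegral.continuous_parametric_intervalIntegral_of_continuous'
      have := continuous_eR
      simp only [Function.uncurry_def]
      fun_prop
    have := (hc.tendsto 0).mono_left (nhdsWithin_le_nhds (s := Set.Ioi 0))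
    simpa using this
  have h2 : Filter.Tendsto (fun δ : ℝ =>
      ((Real.pi : ℂ) / (δ - 2 * Real.pi * Complex.I)) ^ (1 / 2 : ℂ))
      (nhdsWithin 0 (Set.Ioi 0)) (nhds (eR (1 / 8) / (Real.sqrt 2 : ℝ))) := by
    have hpi : (Real.pi : ℂ) ≠ 0 := by exact_mod_cast Real.pi_ne_zero
    have h0 : (Real.pi : ℂ) / (((0 : ℝ) : ℂ) - 2 * Real.pi * Complex.I) = Complex.I / 2 := by
      have hI := Complex.I_ne_zero
      rw [Complex.ofReal_zero, zero_sub, div_eq_div_iff (by simp [hpi]) two_ne_zero]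
      have := Complex.I_mul_I
      linear_combination (2 * (Real.pi : ℂ)) * this
    have hc : ContinuousAt (fun δ : ℝ =>
        ((Real.pi : ℂ) / (δ - 2 * Real.pi * Complex.I)) ^ (1 / 2 : ℂ)) 0 := by
      refine ContinuousAt.cpow ?_ continuousAt_const ?_
      · refine ContinuousAt.div continuousAt_const (by fun_prop) ?_
        simp [hpi]
      · rw [h0, Complex.mem_slitPlane_iff]
        right
        simp
    have := hc.tendsto.mono_left (nhdsWithin_le_nhds (s := Set.Ioi 0))
    rwa [h0, I_div_two_cpow] at this
  refine le_of_tendsto (h1.sub h2).norm ?_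
  filter_upwards [self_mem_nhdsWithin] with δ hδ
  exact norm_integral_gaussian_sub_le hX hδ

/-- The Fresnel integral, with explicit truncation errors. -/
lemma norm_integral_eR_sq_sub_le {V W : ℝ} (hV : 0 < V) (hW : 0 < W) :
    ‖(∫ u in (-V)..W, eR (u ^ 2)) - eR (1 / 8) / (Real.sqrt 2 : ℝ)‖ ≤
      min 2 (1 / W) + min 2 (1 / V) := by
  have hfin : ∀ a b : ℝ, IntervalIntegrable (fun u : ℝ => eR (u ^ 2)) MeasureTheory.volume a b :=
    fun a b => (continuous_eR.comp (by fun_prop)).intervalIntegrable a b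
  refine le_of_forall_pos_le_add fun ε hε => ?_
  obtain ⟨X, hXV, hXW, hXε⟩ : ∃ X, V ≤ X ∧ W ≤ X ∧ 1 / ε ≤ X :=
    ⟨max V (max W (1 / ε)), le_max_left _ _, (le_max_left _ _).trans (le_max_right _ _),
      (le_max_right _ _).trans (le_max_right _ _)⟩
  have hX : 0 < X := hV.trans_le hXV
  have h1 := norm_integral_eR_sq_symm_sub_le hX
  have h2 := norm_integral_eR_sq_le hW hXW
  have h3 := norm_integral_eR_sq_le hV hXV
  rw [← integral_neg_even (fun u => eR (u ^ 2)) (fun u => by simp) V X] at h3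
  have hsplit : ∫ u in (-X)..X, eR (u ^ 2) =
      (∫ u in (-X)..(-V), eR (u ^ 2)) + (∫ u in (-V)..W, eR (u ^ 2)) + ∫ u in W..X, eR (u ^ 2) := by
    rw [intervalIntegral.integral_add_adjacent_intervals (hfin _ _) (hfin _ _),
      intervalIntegral.integral_add_adjacent_intervals (hfin _ _) (hfin _ _)]
  have h4 : 1 / X ≤ ε := by
    rw [div_le_iff₀ hX]
    rw [div_le_iff₀ hε] at hXε
    linarith
  have : (∫ u in (-V)..W, eR (u ^ 2)) - eR (1 / 8) / (Real.sqrt 2 : ℝ) =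
      ((∫ u in (-X)..X, eR (u ^ 2)) - eR (1 / 8) / (Real.sqrt 2 : ℝ)) -
      (∫ u in (-X)..(-V), eR (u ^ 2)) - ∫ u in W..X, eR (u ^ 2) := by
    rw [hsplit]
    ring
  rw [this]
  refine (norm_sub_le _ _).trans ?_
  have := norm_sub_le ((∫ u in (-X)..X, eR (u ^ 2)) - eR (1 / 8) / (Real.sqrt 2 : ℝ))
    (∫ u in (-X)..(-V), eR (u ^ 2))
  linarith

lemma hasDerivAt_sq_add_inv_sq {c t : ℝ} (ht : t ≠ 0) :
    HasDerivAt (fun s : ℝ => c * (s ^ 2 + 1 / s ^ 2)) (2 * c * (t - 1 / t ^ 3)) t := by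
  have h1 : HasDerivAt (fun u : ℝ => u ^ 2) (2 * t) t := by simpa using hasDerivAt_pow 2 t
  have h2 := (h1.fun_add ((hasDerivAt_const t (1 : ℝ)).fun_div h1 (by positivity))).const_mul c
  refine h2.congr_deriv ?_
  field_simp
  ring

/-- The part of the amplitude that vanishes at the stationary point contributes little. -/
lemma norm_integral_remainder_le {c p q : ℝ} (hc : 0 < c) (hp : 0 < p) (hp1 : p < 1) (hq1 : 1 < q) :
    ‖∫ s in p..q, ((2 * s ^ 3 - (1 + 1 / s ^ 2) : ℝ) : ℂ) * eR (c * (s ^ 2 + 1 / s ^ 2))‖ ≤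
      q ^ 2 / c := by
  have hpq : p ≤ q := by linarith
  have hpos : ∀ t ∈ Set.Icc p q, 0 < t := fun t ht => hp.trans_le ht.1
  set N : ℝ → ℝ := fun s => 2 * s ^ 5 + 2 * s ^ 4 + 2 * s ^ 3 + s ^ 2 + s with hN
  set D : ℝ → ℝ := fun s => 2 * c * (s ^ 3 + s ^ 2 + s + 1) with hD
  set N' : ℝ → ℝ := fun s => 10 * s ^ 4 + 8 * s ^ 3 + 6 * s ^ 2 + 2 * s + 1 with hN'
  set D' : ℝ → ℝ := fun s => 2 * c * (3 * s ^ 2 + 2 * s + 1) with hD'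
  have hNd : ∀ t, HasDerivAt N (N' t) t := fun t => by
    have h := ((((((hasDerivAt_pow 5 t).const_mul 2).fun_add
      ((hasDerivAt_pow 4 t).const_mul 2)).fun_add
      ((hasDerivAt_pow 3 t).const_mul 2)).fun_add (hasDerivAt_pow 2 t)).fun_add (hasDerivAt_id t))
    refine h.congr_deriv ?_
    simp only [hN']
    push_cast
    ring
  have hDd : ∀ t, HasDerivAt D (D' t) t := fun t => by
    have h := (((((hasDerivAt_pow 3 t).fun_add (hasDerivAt_pow 2 t)).fun_add
      (hasDerivAt_id t)).add_const (1 : ℝ)).const_mul (2 * c))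
    refine h.congr_deriv ?_
    simp only [hD']
    push_cast
    ring
  have hDpos : ∀ t ∈ Set.Icc p q, 0 < D t := fun t ht => by
    have := hpos t ht
    simp only [hD]
    positivity
  have hderiv : ∀ t ∈ Set.Icc p q, HasDerivAt (fun s => N s / D s)
      ((N' t * D t - N t * D' t) / D t ^ 2) t := fun t ht =>
    (hNd t).fun_div (hDd t) (hDpos t ht).ne'
  have hnonneg : ∀ t ∈ Set.Icc p q, 0 ≤ (N' t * D t - N t * D' t) / D t ^ 2 := fun t ht => by
    have := hpos t ht
    refine div_nonneg ?_ (sq_nonneg _)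
    have : N' t * D t - N t * D' t = 2 * c * (4 * t ^ 7 + 8 * t ^ 6 + 12 * t ^ 5 + 17 * t ^ 4 +
        10 * t ^ 3 + 6 * t ^ 2 + 2 * t + 1) := by
      simp only [hN, hD, hN', hD']
      ring
    rw [this]
    positivity
  have hmono : MonotoneOn (fun s => N s / D s) (Set.Icc p q) := by
    refine monotoneOn_of_deriv_nonneg (convex_Icc p q)
      (fun t ht => (hderiv t ht).continuousAt.continuousWithinAt)
      (fun t ht => (hderiv t (interior_subset ht)).differentiableAt.differentiableWithinAt)
      fun t ht => ?_
    rw [(hderiv t (interior_subset ht)).deriv]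
    exact hnonneg t (interior_subset ht)
  have hqval : N q / D q ≤ q ^ 2 / c := by
    have hDq := hDpos q ⟨hpq, le_rfl⟩
    rw [div_le_div_iff₀ hDq hc]
    simp only [hN, hD]
    have : q ^ 2 * (2 * c * (q ^ 3 + q ^ 2 + q + 1)) -
        (2 * q ^ 5 + 2 * q ^ 4 + 2 * q ^ 3 + q ^ 2 + q) * c = c * q * (q - 1) := by ring
    have h2 : 0 ≤ c * q * (q - 1) := by
      have : 0 ≤ q - 1 := by linarith
      have : 0 < q := by linarith
      positivity
    linarith
  have key := norm_integral_mul_eR_le (p := q ^ 2 / c) (q := 1) hpq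
    (P := fun s => N s / D s) (P' := fun t => (N' t * D t - N t * D' t) / D t ^ 2)
    (Q := fun _ => 1) (Q' := fun _ => 0)
    (Φ := fun s => c * (s ^ 2 + 1 / s ^ 2)) (Φ' := fun t => 2 * c * (t - 1 / t ^ 3))
    hderiv (fun t _ => hasDerivAt_const t 1)
    (fun t ht => hasDerivAt_sq_add_inv_sq (hpos t ht).ne')
    (ContinuousOn.div (by fun_prop) (by fun_prop) fun t ht => (pow_pos (hDpos t ht) 2).ne')
    continuousOn_const
    (continuousOn_const.mul (continuousOn_id.sub (continuousOn_const.div (by fun_prop)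
      fun t ht => (pow_pos (hpos t ht) 3).ne')))
    hnonneg (Or.inl fun _ _ => le_rfl)
    (fun t ht => by
      have h0 := hpos t ht
      have h1 := hDpos t ht
      have h2 : 0 ≤ N t := by
        simp only [hN]
        positivity
      rw [abs_of_nonneg (by positivity)]
      exact (hmono ht ⟨hpq, le_rfl⟩ ht.2).trans hqval)
    (fun t _ => by simp)
  rw [mul_one] at key
  refine le_of_eq_of_le ?_ key
  congr 1
  refine intervalIntegral.integral_congr fun t ht => ?_
  rw [Set.uIcc_of_le hpq] at ht
  have h0 := hpos t ht
  have : N t / D t * 1 * (2 * c * (t - 1 / t ^ 3)) = 2 * t ^ 3 - (1 + 1 / t ^ 2) := by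
    simp only [hN, hD]
    field_simp
    ring
  simp only [this]

lemma integral_main_eq {c p q : ℝ} (hc : 0 < c) (hp : 0 < p) (hpq : p ≤ q) :
    ∫ s in p..q, ((1 + 1 / s ^ 2 : ℝ) : ℂ) * eR (c * (s ^ 2 + 1 / s ^ 2)) =
      eR (2 * c) / (Real.sqrt c : ℝ) *
        ∫ u in (-(Real.sqrt c * (1 / p - p)))..(Real.sqrt c * (q - 1 / q)), eR (u ^ 2) := by
  have hpos : ∀ t ∈ Set.uIcc p q, 0 < t := fun t ht => by
    rw [Set.uIcc_of_le hpq] at ht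
    exact hp.trans_le ht.1
  have hsc : 0 < Real.sqrt c := Real.sqrt_pos.mpr hc
  have hsub := intervalIntegral.integral_deriv_smul_comp (a := p) (b := q)
    (f := fun s => Real.sqrt c * (s - 1 / s)) (f' := fun s => Real.sqrt c * (1 + 1 / s ^ 2))
    (g := fun u : ℝ => eR (u ^ 2))
    (fun t ht => by
      have h0 := (hpos t ht).ne'
      have h := ((hasDerivAt_id t).fun_sub ((hasDerivAt_const t (1 : ℝ)).fun_div
        (hasDerivAt_id t) h0)).const_mul (Real.sqrt c)
      refine h.congr_deriv ?_
      simp only [id]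
      ring)
    (continuousOn_const.mul (continuousOn_const.add (continuousOn_const.div (by fun_prop)
      fun t ht => (pow_pos (hpos t ht) 2).ne')))
    (continuous_eR.comp (by fun_prop))
  have hend : -(Real.sqrt c * (1 / p - p)) = Real.sqrt c * (p - 1 / p) := by ring
  rw [hend, ← hsub, ← intervalIntegral.integral_const_mul]
  refine intervalIntegral.integral_congr fun t ht => ?_
  have h0 := hpos t ht
  have hph : c * (t ^ 2 + 1 / t ^ 2) = 2 * c + (Real.sqrt c * (t - 1 / t)) ^ 2 := by
    rw [mul_pow, Real.sq_sqrt hc.le]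
    field_simp
    ring
  have hsc' : ((Real.sqrt c : ℝ) : ℂ) ≠ 0 := by exact_mod_cast hsc.ne'
  simp only [Function.comp, hph, eR_add, Complex.real_smul]
  push_cast
  field_simp

/-- Stationary phase for `∫ 2s³ e(c(s² + s⁻²)) ds`. -/
lemma norm_integral_cube_sub_le {c p q : ℝ} (hc : 0 < c) (hp : 0 < p) (hp1 : p < 1) (hq1 : 1 < q) :
    ‖(∫ s in p..q, ((2 * s ^ 3 : ℝ) : ℂ) * eR (c * (s ^ 2 + 1 / s ^ 2))) -
      eR (2 * c + 1 / 8) / (Real.sqrt (2 * c) : ℝ)‖ ≤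
      q ^ 2 / c + 1 / Real.sqrt c * (min 2 (1 / (Real.sqrt c * (q - 1 / q))) +
        min 2 (1 / (Real.sqrt c * (1 / p - p)))) := by
  have hpq : p ≤ q := by linarith
  have hpos : ∀ t ∈ Set.Icc p q, 0 < t := fun t ht => hp.trans_le ht.1
  have hsc : 0 < Real.sqrt c := Real.sqrt_pos.mpr hc
  have hV : 0 < Real.sqrt c * (1 / p - p) := by
    have : 1 < 1 / p := by rw [lt_div_iff₀ hp]; linarith
    have : 0 < 1 / p - p := by linarith
    positivity
  have hW : 0 < Real.sqrt c * (q - 1 / q) := by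
    have : 1 / q < 1 := by rw [div_lt_iff₀ (by linarith)]; linarith
    have : 0 < q - 1 / q := by linarith
    positivity
  have hphc : ContinuousOn (fun s : ℝ => eR (c * (s ^ 2 + 1 / s ^ 2))) (Set.Icc p q) :=
    continuous_eR.comp_continuousOn (continuousOn_const.mul ((by fun_prop : ContinuousOn
      (fun s : ℝ => s ^ 2) _).add (continuousOn_const.div (by fun_prop)
      fun t ht => (pow_pos (hpos t ht) 2).ne')))
  have hm : ContinuousOn (fun s : ℝ => ((1 + 1 / s ^ 2 : ℝ) : ℂ)) (Set.Icc p q) :=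
    Complex.continuous_ofReal.comp_continuousOn (continuousOn_const.add
      (continuousOn_const.div (by fun_prop) fun t ht => (pow_pos (hpos t ht) 2).ne'))
  have hk : ContinuousOn (fun s : ℝ => ((2 * s ^ 3 - (1 + 1 / s ^ 2) : ℝ) : ℂ)) (Set.Icc p q) :=
    Complex.continuous_ofReal.comp_continuousOn ((by fun_prop : ContinuousOn
      (fun s : ℝ => 2 * s ^ 3) _).sub (continuousOn_const.add
      (continuousOn_const.div (by fun_prop) fun t ht => (pow_pos (hpos t ht) 2).ne')))
  have hsplit : ∫ s in p..q, ((2 * s ^ 3 : ℝ) : ℂ) * eR (c * (s ^ 2 + 1 / s ^ 2)) =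
      (∫ s in p..q, ((2 * s ^ 3 - (1 + 1 / s ^ 2) : ℝ) : ℂ) * eR (c * (s ^ 2 + 1 / s ^ 2))) +
      ∫ s in p..q, ((1 + 1 / s ^ 2 : ℝ) : ℂ) * eR (c * (s ^ 2 + 1 / s ^ 2)) := by
    refine Eq.trans ?_ (intervalIntegral.integral_add ((hk.mul hphc).intervalIntegrable_of_Icc hpq)
      ((hm.mul hphc).intervalIntegrable_of_Icc hpq))
    refine intervalIntegral.integral_congr fun s _ => ?_
    push_cast
    ring
  have h1 := norm_integral_remainder_le hc hp hp1 hq1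
  have h2 := norm_integral_eR_sq_sub_le hV hW
  have hmain : eR (2 * c + 1 / 8) / (Real.sqrt (2 * c) : ℝ) =
      eR (2 * c) / (Real.sqrt c : ℝ) * (eR (1 / 8) / (Real.sqrt 2 : ℝ)) := by
    rw [eR_add, Real.sqrt_mul (by norm_num)]
    push_cast
    rw [div_mul_div_comm, mul_comm ((Real.sqrt 2 : ℝ) : ℂ)]
  rw [hsplit, integral_main_eq hc hp hpq, hmain, add_sub_assoc, ← mul_sub]
  refine (norm_add_le _ _).trans (add_le_add h1 ?_)
  rw [norm_mul, norm_div, norm_eR, Complex.norm_real, Real.norm_of_nonneg hsc.le]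
  gcongr

/-- Stationary phase for `∫ t e(B t₀² / t + B t) dt`. -/
lemma norm_integral_id_sub_le {B t₀ a b : ℝ} (hB : 0 < B) (ha : 0 < a) (hat : a < t₀)
    (htb : t₀ < b) :
    ‖(∫ t in a..b, (t : ℂ) * eR (B * t₀ ^ 2 / t + B * t)) -
      t₀ ^ 2 * (eR (2 * (B * t₀) + 1 / 8) / (Real.sqrt (2 * (B * t₀)) : ℝ))‖ ≤
      t₀ ^ 2 * ((b / t₀) / (B * t₀) + 1 / Real.sqrt (B * t₀) *
        (min 2 (1 / (Real.sqrt (B * t₀) * (Real.sqrt (b / t₀) - 1 / Real.sqrt (b / t₀)))) +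
        min 2 (1 / (Real.sqrt (B * t₀) * (1 / Real.sqrt (a / t₀) - Real.sqrt (a / t₀)))))) := by
  have ht : 0 < t₀ := ha.trans hat
  have hb : 0 < b := ht.trans htb
  set p := Real.sqrt (a / t₀) with hp
  set q := Real.sqrt (b / t₀) with hq
  have hp2 : p ^ 2 = a / t₀ := Real.sq_sqrt (by positivity)
  have hq2 : q ^ 2 = b / t₀ := Real.sq_sqrt (by positivity)
  have hp0 : 0 < p := Real.sqrt_pos.mpr (by positivity)
  have hp1 : p < 1 := by
    rw [hp, Real.sqrt_lt' one_pos, one_pow, div_lt_one ht]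
    exact hat
  have hq1 : 1 < q := by
    rw [hq, Real.lt_sqrt (by norm_num), one_pow, one_lt_div ht]
    exact htb
  have hpos : ∀ s ∈ Set.uIcc p q, 0 < s := fun t ht => by
    rw [Set.uIcc_of_le (by linarith)] at ht
    exact hp0.trans_le ht.1
  have key := norm_integral_cube_sub_le (c := B * t₀) (by positivity) hp0 hp1 hq1
  have hend : t₀ * p ^ 2 = a ∧ t₀ * q ^ 2 = b := by
    rw [hp2, hq2]
    constructor <;> field_simp
  have hsub : ∫ s in p..q, (t₀ * (2 * s)) •
      (((t₀ * s ^ 2 : ℝ) : ℂ) * eR (B * t₀ ^ 2 / (t₀ * s ^ 2) + B * (t₀ * s ^ 2))) =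
      ∫ t in a..b, (t : ℂ) * eR (B * t₀ ^ 2 / t + B * t) := by
    have h := intervalIntegral.integral_deriv_smul_comp' (a := p) (b := q)
      (f := fun s => t₀ * s ^ 2) (f' := fun s => t₀ * (2 * s))
      (g := fun t : ℝ => (t : ℂ) * eR (B * t₀ ^ 2 / t + B * t))
      (fun s _ => by simpa using (hasDerivAt_pow 2 s).const_mul t₀)
      (by fun_prop)
      (by
        refine (Complex.continuous_ofReal.continuousOn).mul
          (continuous_eR.comp_continuousOn ((continuousOn_const.div continuousOn_id ?_).add
          (by fun_prop)))
        rintro _ ⟨s, hs, rfl⟩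
        have := hpos s hs
        change t₀ * s ^ 2 ≠ 0
        positivity)
    rw [hend.1, hend.2] at h
    exact h
  have hI : ∫ t in a..b, (t : ℂ) * eR (B * t₀ ^ 2 / t + B * t) =
      (t₀ : ℂ) ^ 2 * ∫ s in p..q, ((2 * s ^ 3 : ℝ) : ℂ) * eR (B * t₀ * (s ^ 2 + 1 / s ^ 2)) := by
    rw [← hsub, ← intervalIntegral.integral_const_mul]
    refine intervalIntegral.integral_congr fun s hs => ?_
    have h0 := hpos s hs
    have : B * t₀ ^ 2 / (t₀ * s ^ 2) + B * (t₀ * s ^ 2) = B * t₀ * (s ^ 2 + 1 / s ^ 2) := by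
      field_simp
      ring
    simp only [this, Complex.real_smul]
    push_cast
    ring
  rw [hI, ← mul_sub, norm_mul, norm_pow, Complex.norm_real, Real.norm_of_nonneg ht.le]
  rw [hq2] at key
  gcongr

lemma hasDerivAt_inv_add_linear {A B t : ℝ} (ht : t ≠ 0) :
    HasDerivAt (fun s : ℝ => A / s + B * s) (B - A / t ^ 2) t := by
  have h := ((hasDerivAt_const t A).fun_div (hasDerivAt_id t) ht).fun_add
    ((hasDerivAt_id t).const_mul B)
  refine h.congr_deriv ?_
  simp only [id]
  ring

lemma continuousOn_inv_add_linear_deriv {A B : ℝ} {s : Set ℝ} (hs : ∀ t ∈ s, t ≠ 0) :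
    ContinuousOn (fun t : ℝ => B - A / t ^ 2) s :=
  continuousOn_const.sub (continuousOn_const.div (by fun_prop) fun t ht => pow_ne_zero 2 (hs t ht))

lemma continuousOn_eR_inv_add_linear {A B : ℝ} {s : Set ℝ} (hs : ∀ t ∈ s, t ≠ 0) :
    ContinuousOn (fun t : ℝ => eR (A / t + B * t)) s :=
  continuous_eR.comp_continuousOn ((continuousOn_const.div continuousOn_id hs).add (by fun_prop))

/-- Odd powers reduce to the first power at the stationary point, up to a small error. -/
lemma norm_integral_odd_pow_sub_le {B t₀ a b : ℝ} (hB : 0 < B) (ha : 0 < a) (hat : a < t₀)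
    (htb : t₀ < b) (j : ℕ) :
    ‖(∫ t in a..b, (t : ℂ) ^ (2 * j + 1) * eR (B * t₀ ^ 2 / t + B * t)) -
      (t₀ : ℂ) ^ (2 * j) * ∫ t in a..b, (t : ℂ) * eR (B * t₀ ^ 2 / t + B * t)‖ ≤
      j * (b ^ (2 * j + 1) / B) := by
  have hab : a ≤ b := by linarith
  have ht0 : 0 < t₀ := ha.trans hat
  have hb : 0 < b := ht0.trans htb
  have hpos : ∀ t ∈ Set.Icc a b, 0 < t := fun t ht => ha.trans_le ht.1
  have hec := continuousOn_eR_inv_add_linear (A := B * t₀ ^ 2) (B := B) (s := Set.Icc a b)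
    fun t ht => (hpos t ht).ne'
  have hfin : ∀ n : ℕ, IntervalIntegrable
      (fun t : ℝ => (t : ℂ) ^ n * eR (B * t₀ ^ 2 / t + B * t)) MeasureTheory.volume a b := fun n =>
    ((by fun_prop : ContinuousOn (fun t : ℝ => (t : ℂ) ^ n) _).mul
      hec).intervalIntegrable_of_Icc hab
  have hstep : ∀ j : ℕ,
      ‖(∫ t in a..b, (t : ℂ) ^ (2 * (j + 1) + 1) * eR (B * t₀ ^ 2 / t + B * t)) -
      (t₀ : ℂ) ^ 2 * ∫ t in a..b, (t : ℂ) ^ (2 * j + 1) * eR (B * t₀ ^ 2 / t + B * t)‖ ≤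
      b ^ (2 * j + 3) / B := by
    intro j
    have key := norm_integral_mul_eR_le (p := b ^ (2 * j + 3) / B) (q := 1) hab
      (P := fun t => t ^ (2 * j + 3) / B) (P' := fun t => (2 * j + 3 : ℕ) * t ^ (2 * j + 2) / B)
      (Q := fun _ => 1) (Q' := fun _ => 0)
      (Φ := fun t => B * t₀ ^ 2 / t + B * t) (Φ' := fun t => B - B * t₀ ^ 2 / t ^ 2)
      (fun t _ => (hasDerivAt_pow (2 * j + 3) t).div_const B)
      (fun t _ => hasDerivAt_const t 1)
      (fun t ht => hasDerivAt_inv_add_linear (hpos t ht).ne')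
      (by fun_prop) continuousOn_const
      (continuousOn_inv_add_linear_deriv fun t ht => (hpos t ht).ne')
      (fun t ht => by
        have := hpos t ht
        positivity)
      (Or.inl fun _ _ => le_rfl)
      (fun t ht => by
        have h0 := hpos t ht
        rw [abs_of_nonneg (by positivity)]
        have := ht.2
        gcongr)
      (fun t _ => by simp)
    rw [mul_one] at key
    refine le_of_eq_of_le ?_ key
    rw [← intervalIntegral.integral_const_mul, ← intervalIntegral.integral_sub (hfin _)
      ((hfin _).const_mul _)]
    congr 1
    refine intervalIntegral.integral_congr fun t ht => ?_
    rw [Set.uIcc_of_le hab] at ht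
    have h0 := hpos t ht
    have : t ^ (2 * j + 3) / B * 1 * (B - B * t₀ ^ 2 / t ^ 2) =
        t ^ (2 * j + 3) - t₀ ^ 2 * t ^ (2 * j + 1) := by
      field_simp
      ring
    simp only [this]
    push_cast
    ring
  induction j with
  | zero => simp
  | succ j ih =>
    set I : ℕ → ℂ := fun j => ∫ t in a..b, (t : ℂ) ^ (2 * j + 1) * eR (B * t₀ ^ 2 / t + B * t)
      with hI
    set I₀ : ℂ := ∫ t in a..b, (t : ℂ) * eR (B * t₀ ^ 2 / t + B * t) with hI0
    have hs := hstep j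
    change ‖I (j + 1) - (t₀ : ℂ) ^ 2 * I j‖ ≤ _ at hs
    change ‖I (j + 1) - _‖ ≤ _
    change ‖I j - _‖ ≤ _ at ih
    have h1 : I (j + 1) - (t₀ : ℂ) ^ (2 * (j + 1)) * I₀ = (I (j + 1) - (t₀ : ℂ) ^ 2 * I j) +
        (t₀ : ℂ) ^ 2 * (I j - (t₀ : ℂ) ^ (2 * j) * I₀) := by ring
    rw [h1]
    refine (norm_add_le _ _).trans ?_
    rw [norm_mul, norm_pow, Complex.norm_real, Real.norm_of_nonneg ht0.le]
    have h2 : t₀ ^ 2 * ‖I j - (t₀ : ℂ) ^ (2 * j) * I₀‖ ≤ b ^ 2 * (j * (b ^ (2 * j + 1) / B)) := by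
      gcongr
    have h3 : b ^ 2 * (j * (b ^ (2 * j + 1) / B)) = j * (b ^ (2 * j + 3) / B) := by ring
    push_cast
    rw [show 2 * (j + 1) + 1 = 2 * j + 3 by ring]
    linarith

lemma one_div_sub_inv_le {q K : ℝ} (hq : 1 < q) (hK : q ^ 4 = K) :
    1 / (q - 1 / q) ≤ 2 * q ^ 3 / (K - 1) := by
  have hq0 : 0 < q := by linarith
  have h4 : (1 : ℝ) < q ^ 4 := one_lt_pow₀ hq (by norm_num)
  have h2 : (1 : ℝ) < q ^ 2 := one_lt_pow₀ hq (by norm_num)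
  have : 1 / (q - 1 / q) = q * (q ^ 2 + 1) / (K - 1) := by
    rw [← hK, div_eq_div_iff (by
      have : 1 / q < 1 := by rw [div_lt_one hq0]; exact hq
      linarith) (by linarith)]
    field_simp
    ring
  rw [this]
  have hK1 : 0 < K - 1 := by rw [← hK]; linarith
  have h3 : q * (q ^ 2 + 1) ≤ 2 * q ^ 3 := by nlinarith
  gcongr

lemma one_div_inv_sub_le {p K : ℝ} (hp : 0 < p) (hp1 : p < 1) (hK : p ^ 4 = K) :
    1 / (1 / p - p) ≤ 2 / (1 - K) := by
  have h4 : p ^ 4 < 1 := pow_lt_one₀ hp.le hp1 (by norm_num)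
  have h2 : p ^ 2 < 1 := pow_lt_one₀ hp.le hp1 (by norm_num)
  have : 1 / (1 / p - p) = p * (1 + p ^ 2) / (1 - K) := by
    rw [← hK, div_eq_div_iff (by
      have : 1 < 1 / p := by rw [lt_div_iff₀ hp]; linarith
      linarith) (by linarith)]
    field_simp
    ring
  rw [this]
  have hK1 : 0 < 1 - K := by rw [← hK]; linarith
  gcongr
  nlinarith

/-- Stationary phase for `∫ tⁿ e(ηb²/t + Bt) dt` with odd `n`, the edges of the interval being the
points where the phase has slope `B - β` and `B - η`. -/
lemma norm_integral_odd_pow_sub_stationary_le {B β η t₀ a b : ℝ} (hB : 0 < B) (hη : 0 < η)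
    (ha : 0 < a) (hat : a < t₀) (htb : t₀ < b) (hηb : η * b ^ 2 = B * t₀ ^ 2)
    (hβa : β * a ^ 2 = B * t₀ ^ 2) (j : ℕ) :
    ‖(∫ t in a..b, (t : ℂ) ^ (2 * j + 1) * eR (η * b ^ 2 / t + B * t)) -
      ((t₀ ^ (2 * j + 2) : ℝ) : ℂ) *
        (eR (2 * (B * t₀) + 1 / 8) / (Real.sqrt (2 * (B * t₀)) : ℝ))‖ ≤
      b ^ (2 * j + 1) * ((j + 3) / B + 2 / (β - B) +
        2 * min (Real.sqrt (b / η)) (1 / (B - η))) := by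
  have ht : 0 < t₀ := ha.trans hat
  have hb : 0 < b := ht.trans htb
  have hβB : B < β := by
    have h1 : B * a ^ 2 < β * a ^ 2 := by
      rw [hβa]; gcongr
    exact lt_of_mul_lt_mul_right h1 (by positivity)
  have hηB : η < B := by
    have h1 : η * b ^ 2 < B * b ^ 2 := by
      rw [hηb]; gcongr
    exact lt_of_mul_lt_mul_right h1 (by positivity)
  have hβ : 0 < β := hB.trans hβB
  set p := Real.sqrt (a / t₀) with hp
  set q := Real.sqrt (b / t₀) with hq
  set c := B * t₀ with hc
  have hc0 : 0 < c := by positivity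
  set S := Real.sqrt c with hS
  have hS0 : 0 < S := Real.sqrt_pos.mpr hc0
  have hSS : S * S = c := Real.mul_self_sqrt hc0.le
  have hp0 : 0 < p := Real.sqrt_pos.mpr (by positivity)
  have hp1 : p < 1 := by
    rw [hp, Real.sqrt_lt' one_pos, one_pow, div_lt_one ht]; exact hat
  have hq1 : 1 < q := by
    rw [hq, Real.lt_sqrt zero_le_one, one_pow, one_lt_div ht]; exact htb
  have hp4 : p ^ 4 = B / β := by
    have : p ^ 2 = a / t₀ := Real.sq_sqrt (by positivity)
    rw [show p ^ 4 = (p ^ 2) ^ 2 by ring, this, div_pow, div_eq_div_iff (by positivity)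
      (by positivity)]
    linarith
  have hq2 : q ^ 2 = b / t₀ := Real.sq_sqrt (by positivity)
  have hq4 : q ^ 4 = B / η := by
    rw [show q ^ 4 = (q ^ 2) ^ 2 by ring, hq2, div_pow, div_eq_div_iff (by positivity)
      (by positivity)]
    linarith
  have h1 := norm_integral_odd_pow_sub_le hB ha hat htb j
  have h2 := norm_integral_id_sub_le hB ha hat htb
  rw [← hηb, ← hp, ← hq, ← hc, ← hS] at h2
  rw [← hηb] at h1
  have htn : t₀ ^ (2 * j + 1) ≤ b ^ (2 * j + 1) := by gcongr
  set I := ∫ t in a..b, (t : ℂ) * eR (η * b ^ 2 / t + B * t) with hI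
  set In := ∫ t in a..b, (t : ℂ) ^ (2 * j + 1) * eR (η * b ^ 2 / t + B * t) with hIn
  set M := (eR (2 * c + 1 / 8) / (Real.sqrt (2 * c) : ℝ)) with hM
  have hsplit : In - ((t₀ ^ (2 * j + 2) : ℝ) : ℂ) * M =
      (In - (t₀ : ℂ) ^ (2 * j) * I) + (t₀ : ℂ) ^ (2 * j) * (I - t₀ ^ 2 * M) := by
    push_cast; ring
  have hfirst : t₀ ^ (2 * j) * (t₀ ^ 2 * ((b / t₀) / c)) ≤ b ^ (2 * j + 1) / B := by
    have : t₀ ^ (2 * j) * (t₀ ^ 2 * ((b / t₀) / c)) = t₀ ^ (2 * j) * b / B := by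
      rw [hc]; field_simp
    rw [this, pow_succ]
    gcongr
  have hthird : t₀ ^ (2 * j) * (t₀ ^ 2 * (1 / S * (1 / (S * (1 / p - p))))) ≤
      b ^ (2 * j + 1) * (2 / B + 2 / (β - B)) := by
    have e1 : t₀ ^ (2 * j) * (t₀ ^ 2 * (1 / S * (1 / (S * (1 / p - p))))) =
        t₀ ^ (2 * j + 1) * (1 / B * (1 / (1 / p - p))) := by
      have : 1 / S * (1 / (S * (1 / p - p))) = 1 / c * (1 / (1 / p - p)) := by
        rw [← hSS]; simp only [one_div, mul_inv]; ring
      rw [this, hc]; field_simp; rw [pow_succ t₀]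
    have e2 : 1 / B * (2 / (1 - B / β)) = 2 / B + 2 / (β - B) := by
      have : β - B ≠ 0 := by linarith
      field_simp
      ring
    rw [e1, ← e2]
    have h3 := one_div_inv_sub_le hp0 hp1 hp4
    have : 0 ≤ 1 / (1 / p - p) := by
      have : 1 < 1 / p := by rw [lt_div_iff₀ hp0]; linarith
      apply one_div_nonneg.mpr; linarith
    gcongr
  have hsec1 : t₀ ^ (2 * j) * (t₀ ^ 2 * (1 / S * (1 / (S * (q - 1 / q))))) ≤
      b ^ (2 * j + 1) * (2 * (1 / (B - η))) := by
    have e1 : t₀ ^ (2 * j) * (t₀ ^ 2 * (1 / S * (1 / (S * (q - 1 / q))))) =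
        t₀ ^ (2 * j + 1) * (1 / B * (1 / (q - 1 / q))) := by
      have : 1 / S * (1 / (S * (q - 1 / q))) = 1 / c * (1 / (q - 1 / q)) := by
        rw [← hSS]; simp only [one_div, mul_inv]; ring
      rw [this, hc]; field_simp; rw [pow_succ t₀]
    have h3 := one_div_sub_inv_le hq1 hq4
    have hB' : B = q ^ 4 * η := by rw [hq4]; field_simp
    have h4 : 1 / B * (1 / (q - 1 / q)) ≤ 2 * (1 / (B - η)) := by
      have hBη : 0 < B - η := by linarith
      calc 1 / B * (1 / (q - 1 / q)) ≤ 1 / B * (2 * q ^ 3 / (B / η - 1)) := by gcongr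
        _ = (2 * (1 / (B - η))) * (q ^ 3 * η / B) := by
          have : B / η - 1 = (B - η) / η := by field_simp
          rw [this]; field_simp
        _ ≤ (2 * (1 / (B - η))) * 1 := by
          gcongr
          rw [div_le_one hB]
          refine le_of_le_of_eq ?_ hB'.symm
          gcongr
          · linarith
          · norm_num
        _ = _ := mul_one _
    rw [e1]
    have : 0 ≤ 1 / (q - 1 / q) := by
      have : 1 / q < 1 := by rw [div_lt_one (by linarith)]; exact hq1
      apply one_div_nonneg.mpr; linarith
    gcongr
  have hsec2 : t₀ ^ (2 * j) * (t₀ ^ 2 * (1 / S * 2)) ≤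
      b ^ (2 * j + 1) * (2 * Real.sqrt (b / η)) := by
    have e1 : t₀ * (1 / S) = Real.sqrt (t₀ / B) := by
      rw [eq_comm, Real.sqrt_eq_iff_mul_self_eq (by positivity) (by positivity)]
      have : t₀ * (1 / S) * (t₀ * (1 / S)) = t₀ ^ 2 / (S * S) := by field_simp
      rw [this, hSS, hc]; field_simp
    have e2 : t₀ / B ≤ b / η := by gcongr
    have e3 : t₀ ^ (2 * j) * (t₀ ^ 2 * (1 / S * 2)) =
        t₀ ^ (2 * j + 1) * (2 * (t₀ * (1 / S))) := by ring
    rw [e3, e1]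
    gcongr
  have hmin : t₀ ^ (2 * j) * (t₀ ^ 2 * (1 / S * min 2 (1 / (S * (q - 1 / q))))) ≤
      b ^ (2 * j + 1) * (2 * min (Real.sqrt (b / η)) (1 / (B - η))) := by
    rcases le_total (Real.sqrt (b / η)) (1 / (B - η)) with h | h
    · rw [min_eq_left h]
      refine le_trans ?_ hsec2
      gcongr
      exact min_le_left _ _
    · rw [min_eq_right h]
      refine le_trans ?_ hsec1
      gcongr
      exact min_le_right _ _
  have hthird' : t₀ ^ (2 * j) * (t₀ ^ 2 * (1 / S * min 2 (1 / (S * (1 / p - p))))) ≤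
      b ^ (2 * j + 1) * (2 / B + 2 / (β - B)) := by
    refine le_trans ?_ hthird
    gcongr
    exact min_le_right _ _
  rw [hsplit]
  refine (norm_add_le _ _).trans ?_
  rw [norm_mul, norm_pow, Complex.norm_real, Real.norm_of_nonneg ht.le]
  have h2' := mul_le_mul_of_nonneg_left h2 (pow_nonneg ht.le (2 * j))
  calc _ ≤ _ := add_le_add h1 h2'
    _ = j * (b ^ (2 * j + 1) / B) + t₀ ^ (2 * j) * (t₀ ^ 2 * ((b / t₀) / c)) +
        t₀ ^ (2 * j) * (t₀ ^ 2 * (1 / S * min 2 (1 / (S * (q - 1 / q))))) +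
        t₀ ^ (2 * j) * (t₀ ^ 2 * (1 / S * min 2 (1 / (S * (1 / p - p))))) := by ring
    _ ≤ _ := add_le_add (add_le_add (add_le_add le_rfl hfirst) hmin) hthird'
    _ = _ := by ring

/-- The Abel means of the Fourier series of the sawtooth function. -/
noncomputable def abelSaw (r t : ℝ) : ℝ := -(1 / Real.pi) * (1 - (r : ℂ) * eR t).arg

lemma norm_real_mul_eR (r t : ℝ) : ‖(r : ℂ) * eR t‖ = |r| := by
  rw [norm_mul, norm_eR, mul_one, Complex.norm_real, Real.norm_eq_abs]

lemma eR_natCast_mul (n : ℕ) (t : ℝ) : eR (n * t) = eR t ^ n := by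
  rw [eR, eR, ← Complex.exp_nat_mul]
  congr 1
  push_cast
  ring

lemma hasSum_abelSaw {r : ℝ} (hr0 : 0 ≤ r) (hr1 : r < 1) (t : ℝ) :
    HasSum (fun n : ℕ => r ^ n * (Real.sin (2 * Real.pi * (n * t)) / (Real.pi * n)))
      (abelSaw r t) := by
  have h := Complex.hasSum_im (Complex.hasSum_taylorSeries_neg_log (z := (r : ℂ) * eR t)
    (by rw [norm_real_mul_eR, abs_of_nonneg hr0]; exact hr1))
  have h2 := h.mul_left (1 / Real.pi)
  rw [Complex.neg_im, Complex.log_im] at h2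
  have e : abelSaw r t = 1 / Real.pi * -(1 - (r : ℂ) * eR t).arg := by
    unfold abelSaw; ring
  rw [e]
  refine Eq.subst (motive := fun f => HasSum f _) (funext fun n => ?_) h2
  rw [mul_pow, ← eR_natCast_mul]
  have : (r : ℂ) ^ n * eR (n * t) / n = ((r ^ n / n : ℝ) : ℂ) * eR (n * t) := by
    push_cast; ring
  rw [this, Complex.im_ofReal_mul, eR_im]
  simp only [div_eq_mul_inv, mul_inv]
  ring

lemma abs_abelSaw_le (r t : ℝ) : |abelSaw r t| ≤ 1 := by
  rw [abelSaw, abs_mul, abs_neg, abs_of_pos (by positivity), one_div, inv_mul_le_iff₀ Real.pi_pos,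
    mul_one]
  exact Complex.abs_arg_le_pi _

lemma eR_fract (t : ℝ) : eR (Int.fract t) = eR t := by
  have h : eR t = eR (Int.fract t) * eR (⌊t⌋ : ℤ) := by
    rw [← eR_add, Int.fract_add_floor]
  rw [h]
  have : eR ((⌊t⌋ : ℤ) : ℝ) = 1 := by
    rw [eR, Complex.exp_eq_one_iff]
    exact ⟨⌊t⌋, by push_cast; ring⟩
  rw [this, mul_one]

lemma one_sub_eR_eq (u : ℝ) : 1 - eR u = ((2 * Real.sin (Real.pi * u) : ℝ) : ℂ) *
    (Complex.cos ((Real.pi * u - Real.pi / 2 : ℝ) : ℂ) +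
      Complex.sin ((Real.pi * u - Real.pi / 2 : ℝ) : ℂ) * Complex.I) := by
  have e1 : eR u =
      (Real.cos (2 * (Real.pi * u)) : ℂ) + Real.sin (2 * (Real.pi * u)) * Complex.I := by
    rw [eR, Complex.exp_mul_I]
    push_cast
    ring_nf
  rw [← Complex.ofReal_cos, ← Complex.ofReal_sin, Real.cos_sub_pi_div_two, Real.sin_sub_pi_div_two,
    e1, Real.cos_two_mul', Real.sin_two_mul]
  have := Real.sin_sq_add_cos_sq (Real.pi * u)
  generalize Real.sin (Real.pi * u) = s at *
  generalize Real.cos (Real.pi * u) = c at *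
  apply Complex.ext
  · simp only [Complex.sub_re, Complex.one_re, Complex.add_re, Complex.ofReal_re, Complex.mul_re,
      Complex.I_re, mul_zero, Complex.ofReal_im, Complex.I_im, mul_one, Complex.add_im,
      Complex.mul_im, zero_mul, sub_zero, add_zero, sub_self]
    linarith
  · simp only [Complex.sub_im, Complex.one_im, Complex.add_re, Complex.ofReal_re, Complex.mul_re,
      Complex.I_re, mul_zero, Complex.ofReal_im, Complex.I_im, mul_one, Complex.add_im,
      Complex.mul_im, zero_mul, add_zero, sub_self, zero_add]
    ring

lemma arg_one_sub_eR {t : ℝ} (ht : Int.fract t ≠ 0) :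
    (1 - eR t).arg = Real.pi * Int.fract t - Real.pi / 2 := by
  have h0 : 0 < Int.fract t := lt_of_le_of_ne (Int.fract_nonneg t) (Ne.symm ht)
  have h1 := Int.fract_lt_one t
  have hpi := Real.pi_pos
  rw [← eR_fract, one_sub_eR_eq, Complex.arg_mul_cos_add_sin_mul_I]
  · have := Real.sin_pos_of_pos_of_lt_pi (x := Real.pi * Int.fract t) (by positivity) (by nlinarith)
    positivity
  · constructor <;> nlinarith

lemma one_sub_eR_mem_slitPlane {t : ℝ} (ht : Int.fract t ≠ 0) : 1 - eR t ∈ Complex.slitPlane := by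
  have h0 : 0 < Int.fract t := lt_of_le_of_ne (Int.fract_nonneg t) (Ne.symm ht)
  have h1 := Int.fract_lt_one t
  have hpi := Real.pi_pos
  rw [Complex.mem_slitPlane_iff_arg, arg_one_sub_eR ht]
  refine ⟨by nlinarith, ?_⟩
  have hs := Real.sin_pos_of_pos_of_lt_pi (x := Real.pi * Int.fract t) (by positivity)
    (by nlinarith)
  intro h
  have h2 : ‖1 - eR t‖ = 0 := by rw [h, norm_zero]
  rw [← eR_fract, one_sub_eR_eq, norm_mul, Complex.norm_real, Complex.norm_cos_add_sin_mul_I,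
    mul_one, norm_eq_zero] at h2
  linarith

lemma tendsto_abelSaw {t : ℝ} (ht : Int.fract t ≠ 0) :
    Filter.Tendsto (fun r : ℝ => abelSaw r t) (nhdsWithin 1 (Set.Iio 1))
      (nhds (1 / 2 - Int.fract t)) := by
  have h1 : ContinuousAt (fun r : ℝ => abelSaw r t) 1 := by
    refine continuousAt_const.mul (ContinuousAt.comp (g := Complex.arg)
      (f := fun r : ℝ => 1 - (r : ℂ) * eR t) ?_ (by fun_prop))
    apply Complex.continuousAt_arg
    simpa using one_sub_eR_mem_slitPlane ht
  have h2 : abelSaw 1 t = 1 / 2 - Int.fract t := by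
    rw [abelSaw, Complex.ofReal_one, one_mul, arg_one_sub_eR ht]
    field_simp
    ring
  rw [← h2]
  exact h1.tendsto.mono_left nhdsWithin_le_nhds

lemma continuous_abelSaw {r : ℝ} (hr0 : 0 ≤ r) (hr1 : r < 1) : Continuous (abelSaw r) := by
  refine continuous_const.mul (continuous_iff_continuousAt.mpr fun t => ?_)
  refine ContinuousAt.comp (g := Complex.arg) (f := fun t : ℝ => 1 - (r : ℂ) * eR t) ?_
    (continuous_const.sub (continuous_const.mul continuous_eR)).continuousAt
  apply Complex.continuousAt_arg
  rw [sub_eq_add_neg]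
  apply Complex.mem_slitPlane_of_norm_lt_one
  rw [norm_neg, norm_real_mul_eR, abs_of_nonneg hr0]
  exact hr1

/-- Fourier expansion of the integral of a continuous function against the sawtooth function. -/
lemma integral_mul_sawtooth_eq {a b : ℝ} (hab : a ≤ b) {f : ℝ → ℂ}
    (hf : ContinuousOn f (Set.Icc a b))
    (hs : Summable fun n : ℕ =>
      ∫ t in a..b, f t * ((Real.sin (2 * Real.pi * (n * t)) / (Real.pi * n) : ℝ) : ℂ)) :
    ∫ t in a..b, f t * ((Int.fract t - 1 / 2 : ℝ) : ℂ) =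
      -∑' n : ℕ, ∫ t in a..b,
        f t * ((Real.sin (2 * Real.pi * (n * t)) / (Real.pi * n) : ℝ) : ℂ) := by
  set s : ℕ → ℂ := fun n =>
    ∫ t in a..b, f t * ((Real.sin (2 * Real.pi * (n * t)) / (Real.pi * n) : ℝ) : ℂ) with hsdef
  have hfi : IntervalIntegrable f MeasureTheory.volume a b := hf.intervalIntegrable_of_Icc hab
  have hmeas : MeasureTheory.AEStronglyMeasurable f
      (MeasureTheory.volume.restrict (Set.uIoc a b)) := hfi.def'.aestronglyMeasurable
  have key : ∀ r : ℝ, 0 ≤ r → r < 1 →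
      ∫ t in a..b, f t * (abelSaw r t : ℂ) = ∑' n, s n * (r : ℂ) ^ n := by
    intro r hr0 hr1
    have := intervalIntegral.hasSum_integral_of_dominated_convergence (a := a) (b := b)
      (μ := MeasureTheory.volume)
      (F := fun (n : ℕ) t => f t *
        ((r ^ n * (Real.sin (2 * Real.pi * (n * t)) / (Real.pi * n)) : ℝ) : ℂ))
      (f := fun t => f t * (abelSaw r t : ℂ)) (fun n t => ‖f t‖ * r ^ n)
      (fun n => hmeas.mul (Continuous.aestronglyMeasurable (by fun_prop)))
      (fun n => Filter.Eventually.of_forall fun t _ => by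
        rw [norm_mul, Complex.norm_real, Real.norm_eq_abs, abs_mul,
          abs_of_nonneg (pow_nonneg hr0 n)]
        refine mul_le_mul_of_nonneg_left ?_ (norm_nonneg _)
        refine mul_le_of_le_one_right (pow_nonneg hr0 n) ?_
        rw [abs_div, abs_of_nonneg (show 0 ≤ Real.pi * n by positivity)]
        rcases Nat.eq_zero_or_pos n with h | h
        · simp [h]
        · have h1 : (1 : ℝ) ≤ n := by exact_mod_cast h
          have h3 := Real.pi_gt_three
          rw [div_le_one (by positivity)]
          exact (Real.abs_sin_le_one _).trans (by nlinarith))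
      (Filter.Eventually.of_forall fun t _ =>
        (summable_geometric_of_lt_one hr0 hr1).mul_left _)
      (by
        simp_rw [tsum_mul_left]
        exact hfi.norm.mul_const _)
      (Filter.Eventually.of_forall fun t _ => by
        have h := (hasSum_abelSaw hr0 hr1 t)
        have h2 := (Complex.hasSum_ofReal.mpr h).mul_left (f t)
        exact h2)
    rw [← this.tsum_eq]
    refine tsum_congr fun n => ?_
    rw [hsdef]
    simp only
    rw [← intervalIntegral.integral_mul_const]
    refine intervalIntegral.integral_congr fun t _ => ?_
    push_cast
    ring
  have hlim1 : Filter.Tendsto (fun r : ℝ => ∫ t in a..b, f t * (abelSaw r t : ℂ))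
      (nhdsWithin 1 (Set.Iio 1)) (nhds (∫ t in a..b, f t * ((1 / 2 - Int.fract t : ℝ) : ℂ))) := by
    have hev : ∀ᶠ r : ℝ in nhdsWithin 1 (Set.Iio 1), 0 ≤ r ∧ r < 1 := by
      filter_upwards [self_mem_nhdsWithin,
        nhdsWithin_le_nhds (Ioi_mem_nhds (zero_lt_one (α := ℝ)))] with r h1 h2
      exact ⟨le_of_lt h2, h1⟩
    refine intervalIntegral.tendsto_integral_filter_of_dominated_convergence (fun t => ‖f t‖)
      ?_ ?_ hfi.norm ?_
    · filter_upwards [hev] with r hr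
      exact hmeas.mul ((Complex.continuous_ofReal.comp
        (continuous_abelSaw hr.1 hr.2)).aestronglyMeasurable)
    · refine Filter.Eventually.of_forall fun r => Filter.Eventually.of_forall fun t _ => ?_
      rw [norm_mul, Complex.norm_real, Real.norm_eq_abs]
      exact mul_le_of_le_one_right (norm_nonneg _) (abs_abelSaw_le r t)
    · have hc : (Set.range ((↑) : ℤ → ℝ)).Countable := Set.countable_range _
      filter_upwards [hc.ae_notMem MeasureTheory.volume] with t ht _
      refine Filter.Tendsto.const_mul _ ?_
      refine (Complex.continuous_ofReal.tendsto _).comp (tendsto_abelSaw fun h => ht ?_)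
      exact ⟨⌊t⌋, by rw [Int.fract] at h; linarith⟩
  have hlim2 : Filter.Tendsto (fun r : ℝ => ∑' n, s n * (r : ℂ) ^ n)
      (nhdsWithin 1 (Set.Iio 1)) (nhds (∑' n, s n)) := by
    have := Complex.tendsto_tsum_powerSeries_nhdsWithin_lt hs.hasSum.tendsto_sum_nat
    rwa [Filter.tendsto_map'_iff] at this
  have heq : ∫ t in a..b, f t * ((1 / 2 - Int.fract t : ℝ) : ℂ) = ∑' n, s n := by
    refine tendsto_nhds_unique (hlim1.congr' ?_) hlim2
    filter_upwards [self_mem_nhdsWithin,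
      nhdsWithin_le_nhds (Ioi_mem_nhds (zero_lt_one (α := ℝ)))] with r h1 h2
    exact key r (le_of_lt h2) h1
  rw [← heq, ← intervalIntegral.integral_neg]
  refine intervalIntegral.integral_congr fun t _ => ?_
  push_cast
  ring

/-- First order Euler–Maclaurin summation. -/
lemma sum_Ioc_eq_integral_add {a b : ℝ} (ha : 0 ≤ a) (hab : a ≤ b) {f f' : ℝ → ℂ}
    (hf : ∀ t ∈ Set.Icc a b, HasDerivAt f (f' t) t) (hf' : ContinuousOn f' (Set.Icc a b)) :
    ∑ k ∈ Ioc ⌊a⌋₊ ⌊b⌋₊, f k = (∫ t in a..b, f t) +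
      (∫ t in a..b, f' t * ((Int.fract t - 1 / 2 : ℝ) : ℂ)) -
      f b * ((Int.fract b - 1 / 2 : ℝ) : ℂ) + f a * ((Int.fract a - 1 / 2 : ℝ) : ℂ) := by
  have hder : ∀ t ∈ Set.Icc a b, deriv f t = f' t := fun t ht => (hf t ht).deriv
  have hfc : ContinuousOn f (Set.Icc a b) := fun t ht => (hf t ht).continuousAt.continuousWithinAt
  have h := sum_mul_eq_sub_sub_integral_mul (𝕜 := ℂ) (fun _ => 1) (f := f) ha hab
    (fun t ht => (hf t ht).differentiableAt)
    ((hf'.integrableOn_Icc).congr_fun (fun t ht => (hder t ht).symm) measurableSet_Icc)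
  simp only [mul_one, sum_const, Nat.card_Icc, tsub_zero, nsmul_eq_mul] at h
  have hfl : ∀ t : ℝ, 0 ≤ t → (((⌊t⌋₊ + 1 : ℕ) : ℂ)) = ((t + 1 / 2 : ℝ) : ℂ) -
      ((Int.fract t - 1 / 2 : ℝ) : ℂ) := by
    intro t ht
    have : ((⌊t⌋₊ : ℕ) : ℝ) = t - Int.fract t := by
      rw [natCast_floor_eq_intCast_floor ht, Int.self_sub_fract]
    rw [← Complex.ofReal_natCast, ← Complex.ofReal_sub]
    congr 1
    push_cast
    rw [this]; ring
  have hb : 0 ≤ b := ha.trans hab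
  have hsaw : IntervalIntegrable (fun t => f' t * ((Int.fract t - 1 / 2 : ℝ) : ℂ))
      MeasureTheory.volume a b := by
    have h1 : IntervalIntegrable (fun t => ‖f' t‖) MeasureTheory.volume a b :=
      (hf'.intervalIntegrable_of_Icc hab).norm
    refine h1.mono_fun ?_ ?_
    · refine (hf'.intervalIntegrable_of_Icc hab).def'.aestronglyMeasurable.mul ?_
      exact (Complex.measurable_ofReal.comp
        (measurable_fract.sub_const _)).aestronglyMeasurable
    · refine Filter.Eventually.of_forall fun t => ?_
      simp only
      rw [norm_mul, Complex.norm_real, norm_norm, Real.norm_eq_abs]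
      refine mul_le_of_le_one_right (norm_nonneg _) ?_
      have := Int.fract_nonneg t
      have := Int.fract_lt_one t
      rw [abs_le]; constructor <;> linarith
  have hlin : IntervalIntegrable (fun t => f' t * ((t + 1 / 2 : ℝ) : ℂ))
      MeasureTheory.volume a b :=
    (hf'.mul (by fun_prop)).intervalIntegrable_of_Icc hab
  have hfin : ∫ t in Set.Ioc a b, deriv f t * ((⌊t⌋₊ + 1 : ℕ) : ℂ) =
      (∫ t in a..b, f' t * ((t + 1 / 2 : ℝ) : ℂ)) -
        ∫ t in a..b, f' t * ((Int.fract t - 1 / 2 : ℝ) : ℂ) := by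
    rw [← intervalIntegral.integral_sub hlin hsaw, intervalIntegral.integral_of_le hab]
    refine MeasureTheory.setIntegral_congr_fun measurableSet_Ioc fun t ht => ?_
    have ht' : t ∈ Set.Icc a b := ⟨ht.1.le, ht.2⟩
    rw [hder t ht', hfl t (ha.trans ht'.1)]
    ring
  have hparts : ∫ t in a..b, f' t * ((t + 1 / 2 : ℝ) : ℂ) =
      f b * ((b + 1 / 2 : ℝ) : ℂ) - f a * ((a + 1 / 2 : ℝ) : ℂ) - ∫ t in a..b, f t := by
    have := intervalIntegral.integral_deriv_mul_eq_sub (a := a) (b := b)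
      (u := f) (u' := f') (v := fun t => ((t + 1 / 2 : ℝ) : ℂ)) (v' := fun _ => 1)
      (fun t ht => hf t (by rwa [Set.uIcc_of_le hab] at ht))
      (fun t _ => by
        have := ((hasDerivAt_id t).add_const (1 / 2 : ℝ)).ofReal_comp
        simpa using this)
      (hf'.intervalIntegrable_of_Icc hab) intervalIntegrable_const
    rw [intervalIntegral.integral_add hlin
      (by simpa using hfc.intervalIntegrable_of_Icc hab)] at this
    simp only [mul_one] at this
    rw [← this]; ring
  rw [h, hfin, hparts, hfl a ha, hfl b hb]
  ring

lemma hasDerivAt_sub_div_sq (A B : ℝ) {t : ℝ} (ht : t ≠ 0) :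
    HasDerivAt (fun s : ℝ => B - A / s ^ 2) (2 * A / t ^ 3) t := by
  have := ((hasDerivAt_const t A).fun_div (hasDerivAt_pow 2 t) (by positivity)).const_sub B
  refine this.congr_deriv ?_
  field_simp
  norm_num
  ring

/-- First derivative test for `∫ tᵐ e(A/t + Bt) dt`. -/
lemma norm_integral_pow_mul_eR_le {A B a b δ : ℝ} (hA : 0 ≤ A) (ha : 0 < a) (hab : a ≤ b)
    (hδ : 0 < δ) (h : ∀ t ∈ Set.Icc a b, δ ≤ |B - A / t ^ 2|) (m : ℕ) :
    ‖∫ t in a..b, (t : ℂ) ^ m * eR (A / t + B * t)‖ ≤ b ^ m / δ := by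
  have hpos : ∀ t ∈ Set.Icc a b, 0 < t := fun t ht => ha.trans_le ht.1
  have hne : ∀ t ∈ Set.Icc a b, B - A / t ^ 2 ≠ 0 := fun t ht h0 => by
    have := h t ht
    rw [h0, abs_zero] at this
    linarith
  have hG : ∀ t ∈ Set.Icc a b, HasDerivAt (fun s : ℝ => B - A / s ^ 2) (2 * A / t ^ 3) t :=
    fun t ht => hasDerivAt_sub_div_sq A B (hpos t ht).ne'
  have hc1 : ContinuousOn (fun t : ℝ => B - A / t ^ 2) (Set.Icc a b) :=
    continuousOn_inv_add_linear_deriv fun t ht => (hpos t ht).ne'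
  have key := norm_integral_mul_eR_le hab (P := fun t => t ^ m) (P' := fun t => m * t ^ (m - 1))
    (Q := fun t => 1 / (B - A / t ^ 2))
    (Q' := fun t => -(2 * A / t ^ 3) / (B - A / t ^ 2) ^ 2)
    (Φ := fun t => A / t + B * t) (Φ' := fun t => B - A / t ^ 2) (p := b ^ m) (q := 1 / δ)
    (fun t _ => hasDerivAt_pow m t)
    (fun t ht => by
      have := (hasDerivAt_const t (1 : ℝ)).fun_div (hG t ht) (hne t ht)
      refine this.congr_deriv ?_
      ring)
    (fun t ht => hasDerivAt_inv_add_linear (hpos t ht).ne')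
    (by fun_prop)
    ((ContinuousOn.neg (continuousOn_const.div (by fun_prop)
      fun t ht => (pow_pos (hpos t ht) 3).ne')).div (hc1.pow 2)
        fun t ht => pow_ne_zero 2 (hne t ht))
    hc1
    (fun t ht => by
      have := hpos t ht
      positivity)
    (Or.inr fun t ht => by
      have := hpos t ht
      rw [neg_div]
      refine neg_nonpos.mpr ?_
      positivity)
    (fun t ht => by
      have := hpos t ht
      rw [abs_of_nonneg (by positivity)]
      have := ht.2
      gcongr)
    (fun t ht => by
      rw [abs_div, abs_one]
      exact one_div_le_one_div_of_le hδ (h t ht))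
  rw [mul_one_div] at key
  refine le_of_eq_of_le ?_ key
  congr 1
  refine intervalIntegral.integral_congr fun t ht => ?_
  rw [Set.uIcc_of_le hab] at ht
  have := hne t ht
  have e : t ^ m * (1 / (B - A / t ^ 2)) * (B - A / t ^ 2) = t ^ m := by
    rw [mul_assoc, one_div_mul_cancel this, mul_one]
  simp only [e]
  push_cast
  ring

/-- Variant of the first derivative test with the extra amplitude `ω - Φ'`. -/
lemma norm_integral_pow_mul_slope_mul_eR_le {A B a b κ ω : ℝ} (hA : 0 ≤ A) (ha : 0 < a)
    (hab : a ≤ b) (hne : ∀ t ∈ Set.Icc a b, B - A / t ^ 2 ≠ 0)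
    (h : ∀ t ∈ Set.Icc a b, |ω - (B - A / t ^ 2)| ≤ κ * |B - A / t ^ 2|) (m : ℕ) :
    ‖∫ t in a..b, ((t ^ m * (ω - (B - A / t ^ 2)) : ℝ) : ℂ) * eR (A / t + B * t)‖ ≤ b ^ m * κ := by
  have hpos : ∀ t ∈ Set.Icc a b, 0 < t := fun t ht => ha.trans_le ht.1
  have hG : ∀ t ∈ Set.Icc a b, HasDerivAt (fun s : ℝ => B - A / s ^ 2) (2 * A / t ^ 3) t :=
    fun t ht => hasDerivAt_sub_div_sq A B (hpos t ht).ne'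
  have hc1 : ContinuousOn (fun t : ℝ => B - A / t ^ 2) (Set.Icc a b) :=
    continuousOn_inv_add_linear_deriv fun t ht => (hpos t ht).ne'
  have key := norm_integral_mul_eR_le hab (P := fun t => t ^ m) (P' := fun t => m * t ^ (m - 1))
    (Q := fun t => ω / (B - A / t ^ 2) - 1)
    (Q' := fun t => -ω * ((2 * A / t ^ 3) / (B - A / t ^ 2) ^ 2))
    (Φ := fun t => A / t + B * t) (Φ' := fun t => B - A / t ^ 2) (p := b ^ m) (q := κ)
    (fun t _ => hasDerivAt_pow m t)
    (fun t ht => by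
      have := ((hasDerivAt_const t ω).fun_div (hG t ht) (hne t ht)).sub_const 1
      refine this.congr_deriv ?_
      ring)
    (fun t ht => hasDerivAt_inv_add_linear (hpos t ht).ne')
    (by fun_prop)
    (continuousOn_const.mul ((continuousOn_const.div (by fun_prop)
      fun t ht => (pow_pos (hpos t ht) 3).ne').div (hc1.pow 2)
        fun t ht => pow_ne_zero 2 (hne t ht)))
    hc1
    (fun t ht => by
      have := hpos t ht
      positivity)
    (by
      rcases le_total ω 0 with hω | hω
      · refine Or.inl fun t ht => mul_nonneg (by linarith) ?_
        have := hpos t ht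
        positivity
      · refine Or.inr fun t ht => mul_nonpos_of_nonpos_of_nonneg (by linarith) ?_
        have := hpos t ht
        positivity)
    (fun t ht => by
      have := hpos t ht
      rw [abs_of_nonneg (by positivity)]
      have := ht.2
      gcongr)
    (fun t ht => by
      have e : ω / (B - A / t ^ 2) - 1 = (ω - (B - A / t ^ 2)) / (B - A / t ^ 2) := by
        rw [sub_div _ _ (B - A / t ^ 2), div_self (hne t ht)]
      rw [e, abs_div, div_le_iff₀ (abs_pos.mpr (hne t ht))]
      exact h t ht)
  refine le_of_eq_of_le ?_ key
  congr 1
  refine intervalIntegral.integral_congr fun t ht => ?_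
  rw [Set.uIcc_of_le hab] at ht
  have := hne t ht
  have e : t ^ m * (ω / (B - A / t ^ 2) - 1) * (B - A / t ^ 2) =
      t ^ m * (ω - (B - A / t ^ 2)) := by
    rw [mul_assoc, sub_mul, div_mul_cancel₀ _ this, one_mul]
  simp only [e]

lemma sum_range_one_div_sq_le (K : ℕ) : ∑ k ∈ range K, 1 / ((k : ℝ) + 1) ^ 2 ≤ 2 := by
  have h : ∑ k ∈ range K, 1 / ((k : ℝ) + 1) ^ 2 ≤ 2 - 2 / ((K : ℝ) + 1) := by
    induction K with
    | zero => simp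
    | succ K ih =>
      rw [sum_range_succ]
      have : 1 / ((K : ℝ) + 1) ^ 2 ≤ 2 / ((K : ℝ) + 1) - 2 / (((K + 1 : ℕ) : ℝ) + 1) := by
        push_cast
        rw [div_sub_div _ _ (by positivity) (by positivity), div_le_div_iff₀ (by positivity)
          (by positivity)]
        have : (0 : ℝ) ≤ K := K.cast_nonneg
        nlinarith [mul_nonneg this this, mul_nonneg this (mul_nonneg this this)]
      linarith
  have : 0 ≤ 2 / ((K : ℝ) + 1) := by positivity
  linarith

lemma sum_range_one_div_le (N : ℕ) : ∑ k ∈ range N, 1 / ((k : ℝ) + 1) ≤ 1 + Real.log N := by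
  have h := harmonic_le_one_add_log N
  rw [harmonic] at h
  push_cast at h
  simpa [one_div] using h

lemma sum_range_sub_shift_le {f : ℕ → ℝ} (hf : ∀ n, 0 ≤ f n) (K N : ℕ) :
    ∑ k ∈ range K, (f k - f (k + N)) ≤ ∑ k ∈ range N, f k := by
  have h := sum_range_add f N K
  have h2 : ∑ k ∈ range K, f k ≤ ∑ k ∈ range (N + K), f k :=
    sum_le_sum_of_subset_of_nonneg (range_mono (by omega)) fun _ _ _ => hf _
  rw [sum_sub_distrib]
  simp_rw [add_comm _ N]
  linarith

/-- Summation of the tail bounds occurring in the truncated Poisson formula. -/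
lemma norm_tsum_le_of_decay {e : ℕ → ℂ} {N : ℕ} {D c : ℝ} (hD : 0 ≤ D) (hc : 0 ≤ c)
    (h0 : e 0 = 0)
    (h1 : ∀ i < N, ‖e (i + 1)‖ ≤ D * (c / ((i : ℝ) + 1) ^ 2 + 2 / ((i : ℝ) + 1)))
    (h2 : ∀ k : ℕ, ‖e (N + 1 + k)‖ ≤
      D * ((c + 2 * ((N : ℝ) + 1 / 2)) / (((N : ℝ) + 1 + k) * ((k : ℝ) + 1 / 2)))) :
    Summable e ∧ ‖∑' n, e n‖ ≤ D * (6 * c + 8 + 4 * Real.log N) := by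
  have hA : ∑ i ∈ range (N + 1), ‖e i‖ ≤ D * (2 * c + 2 * (1 + Real.log N)) := by
    rw [sum_range_succ', h0, norm_zero, add_zero]
    calc _ ≤ ∑ i ∈ range N, D * (c * (1 / ((i : ℝ) + 1) ^ 2) + 2 * (1 / ((i : ℝ) + 1))) := by
          refine sum_le_sum fun i hi => (h1 i (mem_range.mp hi)).trans (le_of_eq ?_)
          ring
      _ = D * (c * ∑ i ∈ range N, 1 / ((i : ℝ) + 1) ^ 2 +
            2 * ∑ i ∈ range N, 1 / ((i : ℝ) + 1)) := by
          rw [← mul_sum, sum_add_distrib, mul_sum, mul_sum]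
      _ ≤ D * (c * 2 + 2 * (1 + Real.log N)) := by
          have := sum_range_one_div_sq_le N
          have := sum_range_one_div_le N
          gcongr
      _ = _ := by ring
  have hB : ∀ K, ∑ k ∈ range K, ‖e (N + 1 + k)‖ ≤ D * (4 * c + 2 * (2 + (1 + Real.log N))) := by
    intro K
    have hterm : ∀ k : ℕ, (c + 2 * ((N : ℝ) + 1 / 2)) / (((N : ℝ) + 1 + k) * ((k : ℝ) + 1 / 2)) ≤
        (2 * c + 2) * (1 / ((k : ℝ) + 1) ^ 2) +
          2 * (1 / ((k : ℝ) + 1) - 1 / (((k + N : ℕ) : ℝ) + 1)) := by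
      intro k
      have hk : (0 : ℝ) ≤ k := k.cast_nonneg
      have hN : (0 : ℝ) ≤ N := N.cast_nonneg
      have e1 : c / (((N : ℝ) + 1 + k) * ((k : ℝ) + 1 / 2)) ≤ 2 * c * (1 / ((k : ℝ) + 1) ^ 2) := by
        rw [mul_one_div, div_le_div_iff₀ (by positivity) (by positivity)]
        have : ((k : ℝ) + 1) ^ 2 ≤ 2 * (((N : ℝ) + 1 + k) * ((k : ℝ) + 1 / 2)) := by nlinarith
        nlinarith
      have e2 : ((N : ℝ) + 1 / 2) / (((N : ℝ) + 1 + k) * ((k : ℝ) + 1 / 2)) =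
          (1 / ((k : ℝ) + 1 / 2) - 1 / ((k : ℝ) + 1)) +
            (1 / ((k : ℝ) + 1) - 1 / (((k + N : ℕ) : ℝ) + 1)) := by
        push_cast
        field_simp
        ring
      have e3 : 1 / ((k : ℝ) + 1 / 2) - 1 / ((k : ℝ) + 1) ≤ 1 / ((k : ℝ) + 1) ^ 2 := by
        rw [div_sub_div _ _ (by positivity) (by positivity), div_le_div_iff₀ (by positivity)
          (by positivity)]
        nlinarith
      rw [add_div, mul_div_assoc, e2]
      linarith
    calc _ ≤ ∑ k ∈ range K, D * ((2 * c + 2) * (1 / ((k : ℝ) + 1) ^ 2) +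
          2 * (1 / ((k : ℝ) + 1) - 1 / (((k + N : ℕ) : ℝ) + 1))) := by
          refine sum_le_sum fun k _ => (h2 k).trans ?_
          exact mul_le_mul_of_nonneg_left (hterm k) hD
      _ = D * ((2 * c + 2) * ∑ k ∈ range K, 1 / ((k : ℝ) + 1) ^ 2 +
          2 * ∑ k ∈ range K, (1 / ((k : ℝ) + 1) - 1 / (((k + N : ℕ) : ℝ) + 1))) := by
          rw [← mul_sum, sum_add_distrib, mul_sum, mul_sum]
      _ ≤ D * ((2 * c + 2) * 2 + 2 * (1 + Real.log N)) := by
          have e1 := sum_range_one_div_sq_le K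
          have e2 := (sum_range_sub_shift_le (f := fun k : ℕ => 1 / ((k : ℝ) + 1))
            (fun n => by positivity) K N).trans (sum_range_one_div_le N)
          gcongr
      _ = _ := by ring
  have hlog : 0 ≤ Real.log N := Real.log_natCast_nonneg N
  have hall : ∀ M, ∑ i ∈ range M, ‖e i‖ ≤ D * (6 * c + 8 + 4 * Real.log N) := by
    intro M
    calc _ ≤ ∑ i ∈ range (N + 1 + M), ‖e i‖ :=
          sum_le_sum_of_subset_of_nonneg (range_mono (by omega)) fun _ _ _ => norm_nonneg _
      _ ≤ D * (2 * c + 2 * (1 + Real.log N)) + D * (4 * c + 2 * (2 + (1 + Real.log N))) := by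
          rw [sum_range_add]
          exact add_le_add hA (hB M)
      _ = _ := by ring
  have hsum : Summable fun n => ‖e n‖ :=
    summable_of_sum_range_le (fun _ => norm_nonneg _) hall
  exact ⟨hsum.of_norm, (norm_tsum_le_tsum_norm hsum).trans
    (Real.tsum_le_of_sum_range_le (fun _ => norm_nonneg _) hall)⟩

/-- The derivative of `tⁿ e(A/t - ηt)`. -/
noncomputable def derivTwist (A η : ℝ) (n : ℕ) (t : ℝ) : ℂ :=
  n * (t : ℂ) ^ (n - 1) * eR (A / t + -η * t) +
    (t : ℂ) ^ n * (2 * Real.pi * Complex.I * ((-η - A / t ^ 2 : ℝ) : ℂ) * eR (A / t + -η * t))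

lemma hasDerivAt_pow_mul_eR {A η t : ℝ} (ht : t ≠ 0) (n : ℕ) :
    HasDerivAt (fun s : ℝ => (s : ℂ) ^ n * eR (A / s + -η * s)) (derivTwist A η n t) t := by
  have h1 : HasDerivAt (fun s : ℝ => (s : ℂ) ^ n) (n * (t : ℂ) ^ (n - 1)) t := by
    have := (hasDerivAt_pow n t).ofReal_comp
    simpa using this
  exact h1.mul (hasDerivAt_eR_comp (hasDerivAt_inv_add_linear ht))

lemma continuousOn_derivTwist {A η : ℝ} (n : ℕ) {s : Set ℝ} (hs : ∀ t ∈ s, t ≠ 0) :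
    ContinuousOn (derivTwist A η n) s := by
  have h1 := continuousOn_eR_inv_add_linear (A := A) (B := -η) hs
  have h2 : ContinuousOn (fun t : ℝ => ((-η - A / t ^ 2 : ℝ) : ℂ)) s :=
    Complex.continuous_ofReal.comp_continuousOn (continuousOn_inv_add_linear_deriv hs)
  exact (ContinuousOn.mul (by fun_prop) h1).add (ContinuousOn.mul (by fun_prop)
    ((continuousOn_const.mul h2).mul h1))

lemma eR_phase_mul (A η ω t : ℝ) :
    eR (A / t + -η * t) * eR (ω * t) = eR (A / t + (ω - η) * t) := by
  rw [← eR_add]; ring_nf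

lemma norm_integral_derivTwist_le {A η a b δ κ ω : ℝ} (hA : 0 ≤ A) (hη : 0 < η) (ha : 0 < a)
    (hab : a ≤ b) (hδ : 0 < δ) (h1 : ∀ t ∈ Set.Icc a b, δ ≤ |ω - η - A / t ^ 2|)
    (h2 : ∀ t ∈ Set.Icc a b, η + A / t ^ 2 ≤ κ * |ω - η - A / t ^ 2|) (n : ℕ) :
    ‖∫ t in a..b, derivTwist A η n t * eR (ω * t)‖ ≤
      n * (b ^ (n - 1) / δ) + 2 * Real.pi * (b ^ n * κ) := by
  have hpos : ∀ t ∈ Set.Icc a b, t ≠ 0 := fun t ht => (ha.trans_le ht.1).ne'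
  have k1 := norm_integral_pow_mul_eR_le hA ha hab hδ h1 (n - 1)
  have k2 := norm_integral_pow_mul_slope_mul_eR_le (ω := ω) (κ := κ) hA ha hab
    (fun t ht h0 => by
      have := h1 t ht
      rw [h0, abs_zero] at this
      linarith)
    (fun t ht => by
      rw [show ω - (ω - η - A / t ^ 2) = η + A / t ^ 2 by ring, abs_of_nonneg (by positivity)]
      exact h2 t ht) n
  have hc := continuousOn_eR_inv_add_linear (A := A) (B := ω - η) hpos
  have hcd : ContinuousOn (fun t : ℝ => ((t ^ n * (ω - (ω - η - A / t ^ 2)) : ℝ) : ℂ))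
      (Set.Icc a b) :=
    Complex.continuous_ofReal.comp_continuousOn (ContinuousOn.mul (by fun_prop)
      (continuousOn_const.sub (continuousOn_inv_add_linear_deriv hpos)))
  have i1 : IntervalIntegrable (fun t : ℝ => (t : ℂ) ^ (n - 1) * eR (A / t + (ω - η) * t))
      MeasureTheory.volume a b :=
    (ContinuousOn.mul (by fun_prop) hc).intervalIntegrable_of_Icc hab
  have i2 : IntervalIntegrable (fun t : ℝ => ((t ^ n * (ω - (ω - η - A / t ^ 2)) : ℝ) : ℂ) *
      eR (A / t + (ω - η) * t)) MeasureTheory.volume a b :=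
    (hcd.mul hc).intervalIntegrable_of_Icc hab
  have e : ∫ t in a..b, derivTwist A η n t * eR (ω * t) =
      n * (∫ t in a..b, (t : ℂ) ^ (n - 1) * eR (A / t + (ω - η) * t)) -
      2 * Real.pi * Complex.I * ∫ t in a..b, ((t ^ n * (ω - (ω - η - A / t ^ 2)) : ℝ) : ℂ) *
        eR (A / t + (ω - η) * t) := by
    rw [← intervalIntegral.integral_const_mul, ← intervalIntegral.integral_const_mul,
      ← intervalIntegral.integral_sub (i1.const_mul _) (i2.const_mul _)]
    refine intervalIntegral.integral_congr fun t _ => ?_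
    simp only [derivTwist, ← eR_phase_mul]
    push_cast
    ring
  rw [e]
  refine (norm_sub_le _ _).trans ?_
  rw [norm_mul, norm_mul, Complex.norm_natCast]
  have : ‖2 * (Real.pi : ℂ) * Complex.I‖ = 2 * Real.pi := by
    simp [abs_of_pos Real.pi_pos]
  rw [this]
  have := Real.pi_pos
  gcongr

lemma integral_derivTwist_mul_sin {A η a b : ℝ} (ha : 0 < a) (hab : a ≤ b) (n : ℕ) {ν : ℕ}
    (hν : 0 < ν) :
    ∫ t in a..b, derivTwist A η n t *
        ((Real.sin (2 * Real.pi * (ν * t)) / (Real.pi * ν) : ℝ) : ℂ) =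
      ((∫ t in a..b, derivTwist A η n t * eR (ν * t)) -
        ∫ t in a..b, derivTwist A η n t * eR (-ν * t)) / (2 * Real.pi * ν * Complex.I) := by
  have hc := continuousOn_derivTwist (A := A) (η := η) n
    (s := Set.Icc a b) fun t ht => (ha.trans_le ht.1).ne'
  have hi : ∀ ω : ℝ, IntervalIntegrable (fun t => derivTwist A η n t * eR (ω * t))
      MeasureTheory.volume a b := fun ω =>
    (hc.mul (continuous_eR.comp (by fun_prop)).continuousOn).intervalIntegrable_of_Icc hab
  rw [← intervalIntegral.integral_sub (hi _) (hi _), ← intervalIntegral.integral_div]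
  refine intervalIntegral.integral_congr fun t _ => ?_
  have hs : ((Real.sin (2 * Real.pi * (ν * t)) : ℝ) : ℂ) =
      (eR (ν * t) - eR (-ν * t)) / (2 * Complex.I) := by
    rw [Complex.ofReal_sin, Complex.sin, eR, eR, eq_div_iff (by simp)]
    push_cast
    have : Complex.I * Complex.I = -1 := Complex.I_mul_I
    ring_nf
    simp only [Complex.I_sq]
    ring_nf
  have hpi : (Real.pi : ℂ) ≠ 0 := by exact_mod_cast Real.pi_ne_zero
  have hν' : (ν : ℂ) ≠ 0 := by exact_mod_cast hν.ne'
  rw [Complex.ofReal_div, hs]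
  push_cast
  have := Complex.I_ne_zero
  field_simp

lemma integral_derivTwist_mul_eR {A η a b : ℝ} (ha : 0 < a) (hab : a ≤ b) (n : ℕ) (ω : ℝ) :
    ∫ t in a..b, derivTwist A η n t * eR (ω * t) =
      (b : ℂ) ^ n * eR (A / b + (ω - η) * b) - (a : ℂ) ^ n * eR (A / a + (ω - η) * a) -
        2 * Real.pi * ω * Complex.I * ∫ t in a..b, (t : ℂ) ^ n * eR (A / t + (ω - η) * t) := by
  have hpos : ∀ t ∈ Set.Icc a b, t ≠ 0 := fun t ht => (ha.trans_le ht.1).ne'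
  have hc := continuousOn_derivTwist (A := A) (η := η) n hpos
  have he : Continuous fun t : ℝ => eR (ω * t) := continuous_eR.comp (by fun_prop)
  have hdf : ∀ t : ℝ, HasDerivAt (fun s : ℝ => eR (ω * s))
      (2 * Real.pi * Complex.I * ω * eR (ω * t)) t := fun t => by
    have := hasDerivAt_eR_comp ((hasDerivAt_id t).const_mul ω)
    simpa using this
  have := intervalIntegral.integral_mul_deriv_eq_deriv_mul_of_hasDerivAt (a := a) (b := b)
    (u := fun t : ℝ => eR (ω * t)) (u' := fun t => 2 * Real.pi * Complex.I * ω * eR (ω * t))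
    (v := fun s : ℝ => (s : ℂ) ^ n * eR (A / s + -η * s)) (v' := derivTwist A η n)
    he.continuousOn
    (fun t ht => (hasDerivAt_pow_mul_eR
      (hpos t (by rwa [Set.uIcc_of_le hab] at ht)) n).continuousAt.continuousWithinAt)
    (fun t _ => hdf t)
    (fun t ht => by
      rw [min_eq_left hab, max_eq_right hab] at ht
      exact hasDerivAt_pow_mul_eR (hpos t ⟨ht.1.le, ht.2.le⟩) n)
    ((continuous_const.mul he).intervalIntegrable _ _)
    (hc.intervalIntegrable_of_Icc hab)
  rw [← intervalIntegral.integral_const_mul]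
  simp_rw [← eR_phase_mul]
  rw [intervalIntegral.integral_congr (g := fun t => eR (ω * t) * derivTwist A η n t)
    (fun t _ => mul_comm _ _), this]
  congr 1
  · ring
  · refine intervalIntegral.integral_congr fun t _ => ?_
    ring

/-- Truncated Poisson summation: the sum of `mⁿ e(ηb²/m - ηm)` over `(a, b]` is approximated by
the integrals whose twisted phase can be stationary. -/
lemma norm_sum_sub_sum_integral_le {η a b : ℝ} {N : ℕ} (hη : 0 < η) (ha : 0 < a) (hb : 1 ≤ b)
    (hN : 2 * η ≤ N) (hab : η * b ^ 2 = ((N : ℝ) + 1 / 2 - η) * a ^ 2) (n : ℕ) :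
    ‖∑ m ∈ Ioc ⌊a⌋₊ ⌊b⌋₊, (m : ℂ) ^ n * eR (η * b ^ 2 / m + -η * m) -
      ∑ ν ∈ range (N + 1), ∫ t in a..b, (t : ℂ) ^ n * eR (η * b ^ 2 / t + (ν - η) * t)‖ ≤
      b ^ n * (6 * n + 9 + 4 * Real.log N) := by
  set A := η * b ^ 2 with hA
  set ρ := (N : ℝ) + 1 / 2 with hρ
  have hb0 : 0 < b := by linarith
  have hA0 : 0 < A := by positivity
  have hle : a ≤ b := by
    have h1 : η * a ^ 2 ≤ η * b ^ 2 := by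
      have : 0 < a ^ 2 := by positivity
      rw [← hA, hab]
      nlinarith
    have := le_of_mul_le_mul_left h1 hη
    exact (sq_le_sq₀ ha.le hb0.le).mp this
  have hN0 : (0 : ℝ) < N := by linarith
  have hlow : ∀ t ∈ Set.Icc a b, 0 ≤ A / t ^ 2 := fun t _ => by positivity
  have hup : ∀ t ∈ Set.Icc a b, A / t ^ 2 ≤ ρ - η := fun t ht => by
    rw [hab, mul_div_assoc]
    refine mul_le_of_le_one_right (by linarith) ?_
    have h0 : 0 < t := ha.trans_le ht.1
    rw [div_le_one (by positivity)]
    have := ht.1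
    gcongr
  have hbn : b ^ (n - 1) ≤ b ^ n := pow_le_pow_right₀ hb (by omega)
  set f : ℝ → ℂ := fun t => (t : ℂ) ^ n * eR (A / t + -η * t) with hf
  have hpos : ∀ t ∈ Set.Icc a b, t ≠ 0 := fun t ht => (ha.trans_le ht.1).ne'
  have hc := continuousOn_derivTwist (A := A) (η := η) n hpos
  set X : ℝ → ℂ := fun ω => ∫ t in a..b, derivTwist A η n t * eR (ω * t) with hX
  set I : ℝ → ℂ := fun ω => ∫ t in a..b, (t : ℂ) ^ n * eR (A / t + (ω - η) * t) with hI
  set d : ℕ → ℂ := fun ν => ∫ t in a..b, derivTwist A η n t *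
        ((Real.sin (2 * Real.pi * (ν * t)) / (Real.pi * ν) : ℝ) : ℂ) with hd
  set ind : ℕ → ℂ := fun ν => if ν ∈ Ioc 0 N then I ν else 0 with hind
  set e : ℕ → ℂ := fun ν => -d ν - ind ν with he
  have hpi := Real.pi_gt_three
  have hd0 : d 0 = 0 := by simp [hd]
  have he0 : e 0 = 0 := by simp [he, hd0, hind]
  have hdν : ∀ ν : ℕ, 0 < ν → d ν = (X ν - X (-ν)) / (2 * Real.pi * ν * Complex.I) :=
    fun ν hν => integral_derivTwist_mul_sin ha hle n hν
  have hbnd : ∀ ω t : ℝ, t ∈ Set.Icc a b → ‖(t : ℂ) ^ n * eR (A / t + (ω - η) * t)‖ ≤ b ^ n := by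
    intro ω t ht
    have h0 : 0 < t := ha.trans_le ht.1
    rw [norm_mul, norm_eR, mul_one, norm_pow, Complex.norm_real, Real.norm_of_nonneg h0.le]
    have := ht.2
    gcongr
  have hnormden : ∀ ν : ℕ, ‖2 * (Real.pi : ℂ) * ν * Complex.I‖ = 2 * Real.pi * ν := fun ν => by
    simp [abs_of_pos Real.pi_pos]
  have hbn0 : 0 < b ^ n := by positivity
  have h1 : ∀ i < N, ‖e (i + 1)‖ ≤ b ^ n * (n / ((i : ℝ) + 1) ^ 2 + 2 / ((i : ℝ) + 1)) := by
    intro i hi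
    set ν := i + 1 with hν
    have hν0 : (0 : ℝ) < ν := by positivity
    have hν0' : (ν : ℂ) ≠ 0 := by exact_mod_cast hν0.ne'
    have hXm : ‖X (-ν)‖ ≤ n * (b ^ (n - 1) / ν) + 2 * Real.pi * (b ^ n * 1) := by
      refine norm_integral_derivTwist_le hA0.le hη ha hle hν0 (fun t ht => ?_) (fun t ht => ?_) n
      · have := hlow t ht
        rw [abs_of_neg (by linarith)]; linarith
      · have := hlow t ht
        rw [abs_of_neg (by linarith)]; linarith
    have hXp : X ν = (b : ℂ) ^ n * eR (A / b + (ν - η) * b) -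
        (a : ℂ) ^ n * eR (A / a + (ν - η) * a) - 2 * Real.pi * (ν : ℝ) * Complex.I * I ν :=
      integral_derivTwist_mul_eR (A := A) (η := η) ha hle n ν
    have hee : e ν = (X (-ν) - ((b : ℂ) ^ n * eR (A / b + (ν - η) * b) -
        (a : ℂ) ^ n * eR (A / a + (ν - η) * a))) / (2 * Real.pi * ν * Complex.I) := by
      have hpi0 : (Real.pi : ℂ) ≠ 0 := by exact_mod_cast Real.pi_ne_zero
      have hI0 := Complex.I_ne_zero
      simp only [he, hind]
      rw [if_pos (by simp [hν]; omega), hdν ν (by omega), hXp, eq_div_iff (mul_ne_zero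
        (mul_ne_zero (mul_ne_zero two_ne_zero hpi0) hν0') hI0)]
      rw [Complex.ofReal_natCast]
      field_simp
      ring
    rw [hee, norm_div, hnormden, div_le_iff₀ (by positivity)]
    have hb1 := hbnd ν b ⟨hle, le_rfl⟩
    have ha1 := hbnd ν a ⟨le_rfl, hle⟩
    have hi1 : (i : ℝ) + 1 = ν := by simp [hν]
    rw [hi1]
    calc _ ≤ ‖X (-ν)‖ + (b ^ n + b ^ n) :=
          (norm_sub_le _ _).trans (add_le_add le_rfl ((norm_sub_le _ _).trans (add_le_add hb1 ha1)))
      _ ≤ n * (b ^ n / ν) + 2 * Real.pi * (b ^ n * 1) + (b ^ n + b ^ n) := by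
          gcongr
          exact hXm.trans (by gcongr)
      _ = b ^ n * (n / ν + 2 * Real.pi + 2) := by ring
      _ ≤ b ^ n * (n / ν * (2 * Real.pi) + 4 * Real.pi) := by
          have : (n : ℝ) / ν ≤ n / ν * (2 * Real.pi) :=
            le_mul_of_one_le_right (by positivity) (by linarith)
          gcongr ?_ * ?_
          linarith
      _ = _ := by field_simp; ring
  have h2 : ∀ k : ℕ, ‖e (N + 1 + k)‖ ≤
      b ^ n * ((n + 2 * ρ) / (((N : ℝ) + 1 + k) * ((k : ℝ) + 1 / 2))) := by
    intro k
    set ν := N + 1 + k with hν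
    have hνr : (N : ℝ) + 1 + k = ν := by simp [hν]
    have hδ : (k : ℝ) + 1 / 2 = ν - ρ := by rw [← hνr, hρ]; ring
    have hδ0 : (0 : ℝ) < ν - ρ := by rw [← hδ]; positivity
    have hν0 : (0 : ℝ) < ν := by rw [← hνr]; positivity
    have hXm : ∀ ω : ℝ, ω = ν ∨ ω = -ν →
        ‖X ω‖ ≤ n * (b ^ (n - 1) / (ν - ρ)) + 2 * Real.pi * (b ^ n * (ρ / (ν - ρ))) := by
      intro ω hω
      have hkey : ∀ t ∈ Set.Icc a b, ν - ρ ≤ |ω - η - A / t ^ 2| := by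
        intro t ht
        have h3 := hlow t ht
        have h4 := hup t ht
        rcases hω with rfl | rfl
        · rw [abs_of_nonneg (by linarith)]; linarith
        · rw [abs_of_neg (by linarith)]; linarith
      refine norm_integral_derivTwist_le hA0.le hη ha hle hδ0 hkey (fun t ht => ?_) n
      have h3 := hkey t ht
      have h4 := hup t ht
      have hρ0 : 0 < ρ := by positivity
      calc η + A / t ^ 2 ≤ ρ := by linarith
        _ = ρ / (ν - ρ) * (ν - ρ) := by field_simp
        _ ≤ _ := by gcongr
    have hee : e ν = (X (-ν) - X ν) / (2 * Real.pi * ν * Complex.I) := by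
      simp only [he, hind]
      rw [if_neg (by simp [hν]; omega), hdν ν (by omega)]
      ring
    rw [hνr, hδ, hee, norm_div, hnormden, div_le_iff₀ (by positivity)]
    have h3 := hXm ν (Or.inl rfl)
    have h4 := hXm (-ν) (Or.inr rfl)
    have hbn' : n * (b ^ (n - 1) / (ν - ρ)) ≤ n * (b ^ n / (ν - ρ)) := by gcongr
    calc _ ≤ ‖X (-ν)‖ + ‖X ν‖ := norm_sub_le _ _
      _ ≤ 2 * (n * (b ^ n / (ν - ρ)) + 2 * Real.pi * (b ^ n * (ρ / (ν - ρ)))) := by linarith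
      _ = b ^ n / (ν - ρ) * (2 * n + 4 * Real.pi * ρ) := by ring
      _ ≤ b ^ n / (ν - ρ) * (2 * Real.pi * n + 4 * Real.pi * ρ) := by
          have : (n : ℝ) ≤ Real.pi * n := le_mul_of_one_le_left (by positivity) (by linarith)
          gcongr ?_ * ?_
          linarith
      _ = _ := by field_simp; ring
  obtain ⟨hes, heb⟩ := norm_tsum_le_of_decay hbn0.le (Nat.cast_nonneg n) he0 h1 h2
  have hinds : HasSum ind (∑ ν ∈ Ioc 0 N, I ν) := by
    have h3 : HasSum ind (∑ ν ∈ Ioc 0 N, ind ν) :=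
      hasSum_sum_of_ne_finset_zero fun ν hν => if_neg hν
    rwa [sum_congr rfl fun ν hν => if_pos hν] at h3
  have hds : HasSum d (-(∑' ν, e ν) - ∑ ν ∈ Ioc 0 N, I ν) := by
    have h3 : (fun ν => -e ν - ind ν) = d := by
      funext ν
      simp [he]
    exact h3 ▸ hes.hasSum.neg.sub hinds
  have hEM := sum_Ioc_eq_integral_add ha.le hle (f := f)
    (fun t ht => hasDerivAt_pow_mul_eR (hpos t ht) n) hc
  rw [integral_mul_sawtooth_eq hle hc hds.summable, hds.tsum_eq] at hEM
  have hI0 : (∫ t in a..b, f t) = I 0 := by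
    simp [hI, hf]
  have hsplit : ∑ ν ∈ range (N + 1), I ν = I 0 + ∑ ν ∈ Ioc 0 N, I ν := by
    have h3 : range (N + 1) = insert 0 (Ioc 0 N) := by
      ext x
      simp only [mem_range, mem_insert, mem_Ioc]
      omega
    rw [h3, sum_insert (by simp), Nat.cast_zero]
  have hfr : ∀ t : ℝ, ‖((Int.fract t - 1 / 2 : ℝ) : ℂ)‖ ≤ 1 / 2 := by
    intro t
    rw [Complex.norm_real, Real.norm_eq_abs, abs_le]
    have := Int.fract_nonneg t
    have := Int.fract_lt_one t
    constructor <;> linarith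
  have hfb : ‖f b‖ ≤ b ^ n := by simpa [hf] using hbnd 0 b ⟨hle, le_rfl⟩
  have hfa : ‖f a‖ ≤ b ^ n := by simpa [hf] using hbnd 0 a ⟨le_rfl, hle⟩
  have hfinal : ∑ m ∈ Ioc ⌊a⌋₊ ⌊b⌋₊, (m : ℂ) ^ n * eR (A / m + -η * m) -
      ∑ ν ∈ range (N + 1), I ν = (∑' ν, e ν) - f b * ((Int.fract b - 1 / 2 : ℝ) : ℂ) +
        f a * ((Int.fract a - 1 / 2 : ℝ) : ℂ) := by
    have : ∑ m ∈ Ioc ⌊a⌋₊ ⌊b⌋₊, (m : ℂ) ^ n * eR (A / m + -η * m) =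
        ∑ k ∈ Ioc ⌊a⌋₊ ⌊b⌋₊, f k := by
      refine sum_congr rfl fun k _ => ?_
      simp [hf]
    rw [this, hEM, hsplit, hI0]
    ring
  change ‖_ - ∑ ν ∈ range (N + 1), I ν‖ ≤ _
  rw [hfinal]
  calc _ ≤ b ^ n * (6 * n + 8 + 4 * Real.log N) + b ^ n * (1 / 2) + b ^ n * (1 / 2) := by
        refine (norm_add_le _ _).trans (add_le_add ((norm_sub_le _ _).trans
          (add_le_add heb ?_)) ?_)
        · rw [norm_mul]
          exact mul_le_mul hfb (hfr b) (norm_nonneg _) hbn0.le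
        · rw [norm_mul]
          exact mul_le_mul hfa (hfr a) (norm_nonneg _) hbn0.le
    _ = _ := by ring

/-- The contribution of an endpoint that is nearly stationary. -/
lemma norm_integral_le_sqrt {η a b ν : ℝ} (hη : 0 < η) (ha : 0 < a) (hab : a ≤ b)
    (hν : ν ≤ 2 * η) (n : ℕ) :
    ‖∫ t in a..b, (t : ℂ) ^ n * eR (η * b ^ 2 / t + (ν - η) * t)‖ ≤
      b ^ n * (2 * Real.sqrt (b / η)) := by
  have hb : 0 < b := ha.trans_le hab
  set δ := Real.sqrt (b / η) with hδ
  have hδ0 : 0 < δ := Real.sqrt_pos.mpr (by positivity)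
  have hδ2 : δ * δ = b / η := Real.mul_self_sqrt (by positivity)
  have htriv : ∀ c, a ≤ c → c ≤ b →
      ‖∫ t in c..b, (t : ℂ) ^ n * eR (η * b ^ 2 / t + (ν - η) * t)‖ ≤ b ^ n * (b - c) := by
    intro c hc hcb
    have := intervalIntegral.norm_integral_le_of_norm_le_const (a := c) (b := b) (C := b ^ n)
      (f := fun t : ℝ => (t : ℂ) ^ n * eR (η * b ^ 2 / t + (ν - η) * t)) (fun t ht => by
        rw [Set.uIoc_of_le hcb] at ht
        have h0 : 0 < t := by linarith [ht.1]
        rw [norm_mul, norm_eR, mul_one, norm_pow, Complex.norm_real, Real.norm_of_nonneg h0.le]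
        have := ht.2
        gcongr)
    rwa [abs_of_nonneg (by linarith)] at this
  rcases le_total a (b - δ) with h | h
  · have hc := continuousOn_eR_inv_add_linear (A := η * b ^ 2) (B := ν - η) (s := Set.Icc a b)
      fun t ht => (ha.trans_le ht.1).ne'
    have hi : ContinuousOn (fun t : ℝ => (t : ℂ) ^ n * eR (η * b ^ 2 / t + (ν - η) * t))
      (Set.Icc a b) := ContinuousOn.mul (by fun_prop) hc
    have hc0 : 0 < b - δ := by linarith
    rw [← intervalIntegral.integral_add_adjacent_intervals (b := b - δ)
      ((hi.mono (Set.Icc_subset_Icc_right (by linarith))).intervalIntegrable_of_Icc h)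
      ((hi.mono (Set.Icc_subset_Icc_left h)).intervalIntegrable_of_Icc (by linarith))]
    have h1 : ‖∫ t in a..(b - δ), (t : ℂ) ^ n * eR (η * b ^ 2 / t + (ν - η) * t)‖ ≤
        (b - δ) ^ n / (2 * η * δ / b) := by
      refine norm_integral_pow_mul_eR_le (by positivity) ha h (by positivity) (fun t ht => ?_) n
      have h0 : 0 < t := ha.trans_le ht.1
      have h2 : 2 * η * δ / b ≤ η * b ^ 2 / t ^ 2 - η := by
        have h3 : η * b ^ 2 / (b - δ) ^ 2 ≤ η * b ^ 2 / t ^ 2 := by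
          have := ht.2
          gcongr
        refine le_trans ?_ (sub_le_sub_right h3 _)
        rw [div_sub' (by positivity), div_le_div_iff₀ (by positivity) (by positivity)]
        have : 2 * δ * (b - δ) ^ 2 ≤ (b ^ 2 - (b - δ) ^ 2) * b := by
          nlinarith [sq_nonneg δ, mul_pos hδ0 hδ0, mul_pos hδ0 hb, mul_pos (mul_pos hδ0 hδ0) hc0]
        nlinarith
      have h4 : 0 < 2 * η * δ / b := by positivity
      rw [abs_of_neg (by linarith)]
      linarith
    have h2 := htriv (b - δ) h (by linarith)
    have h3 : (b - δ) ^ n / (2 * η * δ / b) ≤ b ^ n * δ := by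
      have e : (b - δ) ^ n / (2 * η * δ / b) = (b - δ) ^ n * (δ / 2) := by
        have : b = δ * δ * η := by rw [hδ2]; field_simp
        rw [div_div_eq_mul_div, mul_div_assoc]
        congr 1
        rw [div_eq_div_iff (by positivity) (by positivity)]
        linarith
      rw [e]
      gcongr
      · linarith
      · linarith
    refine (norm_add_le _ _).trans ?_
    have : b - (b - δ) = δ := by ring
    rw [this] at h2
    linarith
  · refine (htriv a le_rfl hab).trans ?_
    gcongr
    linarith

lemma sum_Ioc_one_div_le {L N : ℕ} {f : ℕ → ℝ} {c : ℝ} (hc : 0 ≤ c)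
    (h : ∀ r ∈ Ioc L N, f r ≤ c / r) : ∑ r ∈ Ioc L N, f r ≤ c * (1 + Real.log N) := by
  calc _ ≤ ∑ r ∈ Ioc L N, c / r := sum_le_sum h
    _ ≤ ∑ r ∈ Ioc 0 N, c / r :=
      sum_le_sum_of_subset_of_nonneg (Ioc_subset_Ioc_left (Nat.zero_le _))
        fun _ _ _ => by positivity
    _ = c * ∑ k ∈ range N, 1 / ((k : ℝ) + 1) := by
      rw [mul_sum]
      refine sum_bij' (fun r _ => r - 1) (fun k _ => k + 1) ?_ ?_ ?_ ?_ ?_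
      · intro r hr; simp at hr ⊢; omega
      · intro r hr; simp at hr ⊢; omega
      · intro r hr; simp at hr; omega
      · intro r hr; simp
      · intro r hr
        simp only [mem_Ioc] at hr
        rw [Nat.cast_sub (by omega)]
        simp [div_eq_mul_inv]
    _ ≤ _ := by
      have := sum_range_one_div_le N
      gcongr

lemma sum_Ioc_one_div_sub_le {L N : ℕ} {f : ℕ → ℝ} {c : ℝ} (hc : 0 ≤ c)
    (h : ∀ r ∈ Ioc L N, f r ≤ c / ((N : ℝ) + 1 - r)) :
    ∑ r ∈ Ioc L N, f r ≤ c * (1 + Real.log N) := by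
  calc _ ≤ ∑ r ∈ Ioc L N, c / ((N : ℝ) + 1 - r) := sum_le_sum h
    _ ≤ ∑ r ∈ Ioc 0 N, c / ((N : ℝ) + 1 - r) :=
      sum_le_sum_of_subset_of_nonneg (Ioc_subset_Ioc_left (Nat.zero_le _)) fun r hr _ => by
        have : (r : ℝ) ≤ N := by exact_mod_cast (mem_Ioc.mp hr).2
        have : 0 < (N : ℝ) + 1 - r := by linarith
        positivity
    _ = c * ∑ k ∈ range N, 1 / ((k : ℝ) + 1) := by
      rw [mul_sum]
      refine sum_bij' (fun r _ => N - r) (fun k _ => N - k) ?_ ?_ ?_ ?_ ?_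
      · intro r hr; simp at hr ⊢; omega
      · intro r hr; simp at hr ⊢; omega
      · intro r hr; simp at hr; omega
      · intro r hr; simp at hr; omega
      · intro r hr
        simp only [mem_Ioc] at hr
        rw [Nat.cast_sub (by omega), mul_one_div]
        congr 1
        ring
    _ ≤ _ := by
      have := sum_range_one_div_le N
      gcongr

lemma sum_Ioc_sub_le {M N : ℕ} (hMN : M ≤ N) (hN : 1 ≤ N) :
    ∑ r ∈ Ioc M N, 1 / ((r : ℝ) - M) ≤ 1 + Real.log N := by
  have e : ∑ r ∈ Ioc M N, 1 / ((r : ℝ) - M) = ∑ k ∈ range (N - M), 1 / ((k : ℝ) + 1) := by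
    refine sum_bij' (fun r _ => r - M - 1) (fun k _ => k + M + 1) ?_ ?_ ?_ ?_ ?_
    · intro r hr; simp at hr ⊢; omega
    · intro r hr; simp at hr ⊢; omega
    · intro r hr; simp at hr; omega
    · intro r hr; omega
    · intro r hr
      simp only [mem_Ioc] at hr
      rw [Nat.cast_sub (by omega), Nat.cast_sub (by omega)]
      simp
  rw [e]
  refine (sum_range_one_div_le _).trans ?_
  rcases Nat.eq_zero_or_pos (N - M) with h | h
  · rw [h]
    have : 0 ≤ Real.log N := Real.log_nonneg (by exact_mod_cast hN)
    simpa using this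
  · have : ((N - M : ℕ) : ℝ) ≤ N := by exact_mod_cast Nat.sub_le _ _
    have h' : (0 : ℝ) < (N - M : ℕ) := by exact_mod_cast h
    gcongr

/-- The non-stationary integrals below the critical frequency. -/
lemma sum_norm_integral_low_le {η a b : ℝ} {L : ℕ} (hη : 0 < η) (ha : 0 < a) (hab : a ≤ b)
    (hL : (L : ℝ) < 2 * η) (n : ℕ) :
    ∑ ν ∈ range L, ‖∫ t in a..b, (t : ℂ) ^ n * eR (η * b ^ 2 / t + ((ν : ℝ) - η) * t)‖ ≤
      b ^ n * (1 + Real.log L) := by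
  have hb : 0 < b := ha.trans_le hab
  calc _ ≤ ∑ ν ∈ range L, b ^ n * (1 / (((L - 1 - ν : ℕ) : ℝ) + 1)) := by
        refine sum_le_sum fun ν hν => ?_
        rw [mem_range] at hν
        have hc : ((L - 1 - ν : ℕ) : ℝ) + 1 = L - ν := by
          rw [Nat.cast_sub (by omega), Nat.cast_sub (by omega)]; push_cast; ring
        have hνL : (ν : ℝ) < L := by exact_mod_cast hν
        rw [hc, mul_one_div]
        refine norm_integral_pow_mul_eR_le (by positivity) ha hab (by linarith) (fun t ht => ?_) n
        have h0 : 0 < t := ha.trans_le ht.1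
        have h3 : η ≤ η * b ^ 2 / t ^ 2 := by
          rw [le_div_iff₀ (by positivity)]
          have := ht.2
          gcongr
        rw [abs_of_neg (by linarith)]
        linarith
    _ = b ^ n * ∑ k ∈ range L, 1 / ((k : ℝ) + 1) := by
        rw [← mul_sum, sum_range_reflect (fun k : ℕ => 1 / ((k : ℝ) + 1)) L]
    _ ≤ _ := by
        have := sum_range_one_div_le L
        gcongr

/-- The critical frequency below `2η`. -/
lemma norm_integral_critical_le {η a b : ℝ} {L : ℕ} (hη : 0 < η) (ha : 0 < a) (hab : a ≤ b)
    (hL : (L : ℝ) < 2 * η) (n : ℕ) :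
    ‖∫ t in a..b, (t : ℂ) ^ n * eR (η * b ^ 2 / t + ((L : ℝ) - η) * t)‖ ≤
      b ^ n * (2 * min (Real.sqrt (b / η)) (1 / (2 * η - L))) := by
  have hb : 0 < b := ha.trans_le hab
  rcases le_total (Real.sqrt (b / η)) (1 / (2 * η - L)) with h | h
  · rw [min_eq_left h]
    exact norm_integral_le_sqrt hη ha hab hL.le n
  · rw [min_eq_right h]
    have h1 : ‖∫ t in a..b, (t : ℂ) ^ n * eR (η * b ^ 2 / t + ((L : ℝ) - η) * t)‖ ≤
        b ^ n / (2 * η - L) := by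
      refine norm_integral_pow_mul_eR_le (by positivity) ha hab (by linarith) (fun t ht => ?_) n
      have h0 : 0 < t := ha.trans_le ht.1
      have h3 : η ≤ η * b ^ 2 / t ^ 2 := by
        rw [le_div_iff₀ (by positivity)]
        have := ht.2
        gcongr
      rw [abs_of_neg (by linarith)]
      linarith
    refine h1.trans ?_
    rw [div_eq_mul_one_div]
    have : 0 < 1 / (2 * η - L) := by
      apply one_div_pos.mpr; linarith
    gcongr
    linarith

/-- The stationary point attached to the frequency `r`. -/
noncomputable def statPt (η b r : ℝ) : ℝ := b * Real.sqrt (η / (r - η))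

/-- The main term attached to the frequency `r`. -/
noncomputable def statTerm (η b : ℝ) (j : ℕ) (r : ℝ) : ℂ :=
  ((statPt η b r ^ (2 * j + 2) : ℝ) : ℂ) *
    (eR (2 * ((r - η) * statPt η b r) + 1 / 8) /
      (Real.sqrt (2 * ((r - η) * statPt η b r)) : ℝ))

lemma sq_statPt {η b r : ℝ} (hη : 0 < η) (hr : η < r) :
    (r - η) * statPt η b r ^ 2 = η * b ^ 2 := by
  have : 0 < r - η := by linarith
  rw [statPt, mul_pow, Real.sq_sqrt (by positivity)]
  field_simp

lemma statPt_pos {η b r : ℝ} (hη : 0 < η) (hb : 0 < b) (hr : η < r) : 0 < statPt η b r := by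
  have : 0 < r - η := by linarith
  exact mul_pos hb (Real.sqrt_pos.mpr (by positivity))

lemma statPt_lt {η b r s : ℝ} (hη : 0 < η) (hb : 0 < b) (hr : η < r) (hrs : r < s) :
    statPt η b s < statPt η b r := by
  have : 0 < r - η := by linarith
  have : 0 < s - η := by linarith
  unfold statPt
  gcongr

lemma statPt_two_mul {η b : ℝ} (hη : 0 < η) : statPt η b (2 * η) = b := by
  rw [statPt, two_mul, add_sub_cancel_right, div_self hη.ne']
  simp

lemma sum_norm_integral_stationary_le {η b : ℝ} {L N : ℕ} (hη : 0 < η) (hb : 1 ≤ b)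
    (hL : (L : ℝ) < 2 * η) (hL' : 2 * η < L + 1) (hN : 2 * η ≤ N) (j : ℕ) :
    ∑ r ∈ Ioc L N, ‖(∫ t in (statPt η b (N + 1 / 2))..b,
      (t : ℂ) ^ (2 * j + 1) * eR (η * b ^ 2 / t + ((r : ℝ) - η) * t)) - statTerm η b j r‖ ≤
      b ^ (2 * j + 1) * ((2 * (j + 3) + 6) * (1 + Real.log N) +
        2 * min (Real.sqrt (b / η)) (1 / (L + 1 - 2 * η))) := by
  have hb0 : 0 < b := by linarith
  have hLN : L + 1 ≤ N := by
    have : (L : ℝ) < N := by linarith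
    exact_mod_cast this
  set E : ℕ → ℝ := fun r => 2 * min (Real.sqrt (b / η)) (1 / (r - 2 * η)) with hE
  have hterm : ∀ r ∈ Ioc L N, ‖(∫ t in (statPt η b (N + 1 / 2))..b,
      (t : ℂ) ^ (2 * j + 1) * eR (η * b ^ 2 / t + ((r : ℝ) - η) * t)) - statTerm η b j r‖ ≤
      b ^ (2 * j + 1) * ((j + 3) / (r - η) + 2 / ((N + 1 / 2 : ℝ) - r) + E r) := by
    intro r hr
    rw [mem_Ioc] at hr
    have hrN : (r : ℝ) ≤ N := by exact_mod_cast hr.2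
    have hrL : (L : ℝ) + 1 ≤ r := by exact_mod_cast hr.1
    have := norm_integral_odd_pow_sub_stationary_le (B := r - η) (β := N + 1 / 2 - η) (η := η)
      (t₀ := statPt η b r) (a := statPt η b (N + 1 / 2)) (b := b) (by linarith) hη
      (statPt_pos hη hb0 (by linarith)) (statPt_lt hη hb0 (by linarith) (by linarith))
      (by conv_rhs => rw [← statPt_two_mul (b := b) hη]
          exact statPt_lt hη hb0 (by linarith) (by linarith))
      (sq_statPt hη (by linarith)).symm
      (by rw [sq_statPt hη (by linarith), sq_statPt hη (by linarith)]) j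
    refine this.trans (le_of_eq ?_)
    rw [hE]
    have e1 : (N + 1 / 2 - η - (r - η) : ℝ) = N + 1 / 2 - r := by ring
    have e2 : (r - η - η : ℝ) = r - 2 * η := by ring
    rw [e1, e2]
  refine (sum_le_sum hterm).trans ?_
  rw [← mul_sum, sum_add_distrib, sum_add_distrib]
  have s1 : ∑ r ∈ Ioc L N, ((j : ℝ) + 3) / (r - η) ≤ 2 * (j + 3) * (1 + Real.log N) := by
    refine sum_Ioc_one_div_le (by positivity) fun r hr => ?_
    rw [mem_Ioc] at hr
    have hrL : (L : ℝ) + 1 ≤ r := by exact_mod_cast hr.1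
    rw [div_le_div_iff₀ (by linarith) (by linarith)]
    have : (0 : ℝ) < j + 3 := by positivity
    nlinarith
  have s2 : ∑ r ∈ Ioc L N, 2 / ((N + 1 / 2 : ℝ) - r) ≤ 4 * (1 + Real.log N) := by
    refine sum_Ioc_one_div_sub_le (by positivity) fun r hr => ?_
    rw [mem_Ioc] at hr
    have hrN : (r : ℝ) ≤ N := by exact_mod_cast hr.2
    rw [div_le_div_iff₀ (by linarith) (by linarith)]
    linarith
  have s3 : ∑ r ∈ Ioc L N, E r ≤ 2 * (1 + Real.log N) +
      2 * min (Real.sqrt (b / η)) (1 / (L + 1 - 2 * η)) := by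
    have e : Ioc L N = insert (L + 1) (Ioc (L + 1) N) := by
      ext r; simp only [mem_Ioc, mem_insert]; omega
    rw [e, sum_insert (by simp)]
    have h1 : ∑ r ∈ Ioc (L + 1) N, E r ≤
        ∑ r ∈ Ioc (L + 1) N, 2 * (1 / ((r : ℝ) - (L + 1 : ℕ))) := by
      refine sum_le_sum fun r hr => ?_
      rw [mem_Ioc] at hr
      have hrL : (L : ℝ) + 1 + 1 ≤ r := by exact_mod_cast hr.1
      rw [hE]
      push_cast
      refine mul_le_mul_of_nonneg_left ((min_le_right _ _).trans ?_) zero_le_two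
      apply one_div_le_one_div_of_le <;> linarith
    replace h1 : ∑ r ∈ Ioc (L + 1) N, E r ≤ 2 * ∑ r ∈ Ioc (L + 1) N, 1 / ((r : ℝ) - (L + 1 : ℕ)) :=
      h1.trans_eq (mul_sum _ _ _).symm
    have h2 := sum_Ioc_sub_le hLN (by omega)
    have h3 : E (L + 1) = 2 * min (Real.sqrt (b / η)) (1 / (L + 1 - 2 * η)) := by
      rw [hE]; push_cast; rfl
    rw [h3]
    linarith
  refine mul_le_mul_of_nonneg_left ?_ (by positivity)
  linarith

theorem norm_sum_sub_main_le {η b : ℝ} {L N : ℕ} (hη : 0 < η) (hb : 1 ≤ b)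
    (hL : (L : ℝ) < 2 * η) (hL' : 2 * η < L + 1) (hN : 2 * η ≤ N) (j : ℕ) :
    ‖∑ m ∈ Ioc 0 ⌊b⌋₊, (m : ℂ) ^ (2 * j + 1) * eR (η * b ^ 2 / m + -η * m) -
      ∑ r ∈ Ioc L N, statTerm η b j r‖ ≤
      b ^ (2 * j + 1) * ((14 * j + 40) * (1 + Real.log N) + η * b ^ 2 / (N + 1 / 2 - η) +
        2 * (min (Real.sqrt (b / η)) (1 / (2 * η - L)) +
          min (Real.sqrt (b / η)) (1 / (L + 1 - 2 * η)))) := by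
  have hb0 : 0 < b := by linarith
  have hLN : L + 1 ≤ N := by
    have : (L : ℝ) < N := by linarith
    exact_mod_cast this
  have hlog : 0 ≤ Real.log N := Real.log_nonneg (by exact_mod_cast (by omega : 1 ≤ N))
  set a := statPt η b (N + 1 / 2) with ha_def
  have ha : 0 < a := statPt_pos hη hb0 (by linarith)
  have hab : a < b := by
    conv_rhs => rw [← statPt_two_mul (b := b) hη]
    exact statPt_lt hη hb0 (by linarith) (by linarith)
  have ha2 : (N + 1 / 2 - η) * a ^ 2 = η * b ^ 2 := sq_statPt hη (by linarith)
  set f : ℕ → ℂ := fun m => (m : ℂ) ^ (2 * j + 1) * eR (η * b ^ 2 / m + -η * m) with hf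
  set I : ℕ → ℂ := fun ν =>
    ∫ t in a..b, (t : ℂ) ^ (2 * j + 1) * eR (η * b ^ 2 / t + ((ν : ℝ) - η) * t) with hI
  have h1 : ‖∑ m ∈ Ioc ⌊a⌋₊ ⌊b⌋₊, f m - ∑ ν ∈ range (N + 1), I ν‖ ≤
      b ^ (2 * j + 1) * (6 * (2 * j + 1 : ℕ) + 9 + 4 * Real.log N) :=
    norm_sum_sub_sum_integral_le hη ha hb hN ha2.symm (2 * j + 1)
  have h2 : ‖∑ m ∈ Ioc 0 ⌊a⌋₊, f m‖ ≤ b ^ (2 * j + 1) * (η * b ^ 2 / (N + 1 / 2 - η)) := by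
    have hd : η * b ^ 2 / (N + 1 / 2 - η) = a ^ 2 := by
      rw [← ha2, mul_div_cancel_left₀]
      linarith
    rw [hd]
    calc _ ≤ ∑ m ∈ Ioc 0 ⌊a⌋₊, a ^ (2 * j + 1) := by
          refine norm_sum_le_of_le _ fun m hm => ?_
          rw [mem_Ioc] at hm
          rw [hf]
          simp only [norm_mul, norm_eR, mul_one, norm_pow, Complex.norm_natCast]
          have : (m : ℝ) ≤ a := (Nat.le_floor_iff ha.le).mp hm.2
          gcongr
      _ = ⌊a⌋₊ * a ^ (2 * j + 1) := by simp
      _ ≤ a * a ^ (2 * j + 1) := by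
          gcongr
          exact Nat.floor_le ha.le
      _ = a ^ (2 * j) * a ^ 2 := by ring
      _ ≤ b ^ (2 * j) * a ^ 2 := by gcongr
      _ ≤ _ := by
          gcongr
          · omega
  have h3 : ‖∑ ν ∈ range L, I ν‖ ≤ b ^ (2 * j + 1) * (1 + Real.log N) := by
    refine (norm_sum_le _ _).trans
      ((sum_norm_integral_low_le hη ha hab.le hL (2 * j + 1)).trans ?_)
    rcases Nat.eq_zero_or_pos L with h | h
    · rw [h]
      simp only [CharP.cast_eq_zero, Real.log_zero]
      gcongr
    · have : (0 : ℝ) < L := by exact_mod_cast h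
      have : (L : ℝ) ≤ N := by exact_mod_cast (by omega : L ≤ N)
      gcongr
  have h4 := norm_integral_critical_le hη ha hab.le hL (2 * j + 1)
  have h5 := (norm_sum_le _ _).trans (sum_norm_integral_stationary_le hη hb hL hL' hN j)
  rw [sum_sub_distrib] at h5
  have hsplit : ∑ ν ∈ range (N + 1), I ν = ∑ ν ∈ range L, I ν + I L + ∑ r ∈ Ioc L N, I r := by
    rw [← sum_range_succ, ← sum_range_add_sum_Ico (f := I) (by omega : L + 1 ≤ N + 1)]
    congr 2
    ext r
    simp only [mem_Ico, mem_Ioc]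
    omega
  have hsplit' : ∑ m ∈ Ioc 0 ⌊b⌋₊, f m = ∑ m ∈ Ioc 0 ⌊a⌋₊, f m + ∑ m ∈ Ioc ⌊a⌋₊ ⌊b⌋₊, f m :=
    (sum_Ioc_consecutive f (Nat.zero_le _) (Nat.floor_mono hab.le)).symm
  have key : ∑ m ∈ Ioc 0 ⌊b⌋₊, f m - ∑ r ∈ Ioc L N, statTerm η b j r =
      ∑ m ∈ Ioc 0 ⌊a⌋₊, f m + (∑ m ∈ Ioc ⌊a⌋₊ ⌊b⌋₊, f m - ∑ ν ∈ range (N + 1), I ν) +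
      ∑ ν ∈ range L, I ν + I L +
      (∑ r ∈ Ioc L N, I r - ∑ r ∈ Ioc L N, statTerm η b j r) := by
    rw [hsplit, hsplit']; ring
  rw [key]
  refine (norm_add_le _ _).trans ((add_le_add (norm_add_le _ _) le_rfl).trans
    ((add_le_add (add_le_add (norm_add_le _ _) le_rfl) le_rfl).trans
    ((add_le_add (add_le_add (add_le_add (norm_add_le _ _) le_rfl) le_rfl) le_rfl).trans ?_)))
  have h6 : b ^ (2 * j + 1) * (6 * (2 * j + 1 : ℕ) + 9 + 4 * Real.log N) ≤
      b ^ (2 * j + 1) * ((12 * j + 15) * (1 + Real.log N)) := by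
    have : (0 : ℝ) ≤ j * Real.log N := by positivity
    gcongr
    push_cast
    linarith
  have h7 : 0 ≤ b ^ (2 * j + 1) * (1 + Real.log N) := by positivity
  linarith

lemma ofReal_mul_eR_im (c y : ℝ) : ((c : ℂ) * eR y).im = c * Real.sin (2 * Real.pi * y) := by
  rw [Complex.im_ofReal_mul, eR_im]

lemma sub_pow_eq_sum (x θ t : ℝ) (k : ℕ) : (x - θ * t ^ 2) ^ k =
    ∑ j ∈ range (k + 1), (k.choose j * (-θ) ^ j * x ^ (k - j)) * t ^ (2 * j) := by
  rw [sub_eq_neg_add, add_pow]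
  refine sum_congr rfl fun j _ => ?_
  rw [pow_mul, ← neg_mul, mul_pow]
  ring

lemma statPt_eq {θ x h r : ℝ} (hθ : 0 < θ) (hx : 0 < x) (hh : 0 < h) (hr : θ * h < r) :
    statPt (θ * h / 2) (Real.sqrt (x / θ)) r = Real.sqrt (x * h / (2 * r - θ * h)) := by
  have h0 : 0 < θ * h := by positivity
  have : 0 < r - θ * h / 2 := by linarith
  have : 0 < 2 * r - θ * h := by linarith
  rw [statPt, ← Real.sqrt_mul (by positivity)]
  congr 1
  field_simp

lemma two_mul_sub_mul_statPt {θ x h r : ℝ} (hθ : 0 < θ) (hx : 0 < x) (hh : 0 < h)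
    (hr : θ * h < r) :
    2 * ((r - θ * h / 2) * statPt (θ * h / 2) (Real.sqrt (x / θ)) r) =
      Real.sqrt (x * h * (2 * r - θ * h)) := by
  have h0 : 0 < θ * h := by positivity
  have hD : 0 < 2 * r - θ * h := by linarith
  rw [statPt_eq hθ hx hh hr]
  have : x * h * (2 * r - θ * h) = (2 * r - θ * h) ^ 2 * (x * h / (2 * r - θ * h)) := by
    field_simp
  rw [this, Real.sqrt_mul (by positivity), Real.sqrt_sq hD.le]
  ring

/-- The amplitude of a stationary-phase main term. -/
lemma amplitude_eq {θ x h D : ℝ} (hx : 0 < x) (hh : 0 < h) (hD : 0 < D) (k : ℕ) :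
    x * h / D * (x - θ * (x * h / D)) ^ k / Real.sqrt (Real.sqrt (x * h * D)) =
      x ^ ((k : ℝ) + 3 / 4) * (h * (h ^ (-(1 : ℝ) / 4) * D ^ (-(5 : ℝ) / 4) *
        (1 - θ * h / D) ^ k)) := by
  have e1 : x - θ * (x * h / D) = x * (1 - θ * h / D) := by field_simp
  have e2 : Real.sqrt (Real.sqrt (x * h * D)) = x ^ (1 / 4 : ℝ) * h ^ (1 / 4 : ℝ) *
      D ^ (1 / 4 : ℝ) := by
    rw [Real.sqrt_eq_rpow, Real.sqrt_eq_rpow, ← Real.rpow_mul (by positivity),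
      Real.mul_rpow (by positivity) hD.le, Real.mul_rpow hx.le hh.le]
    norm_num
  have e3 : x ^ ((k : ℝ) + 3 / 4) = x ^ k * x / x ^ (1 / 4 : ℝ) := by
    have : (k : ℝ) + 3 / 4 = k + 1 - 1 / 4 := by ring
    rw [this, Real.rpow_sub hx, Real.rpow_add hx, Real.rpow_one, Real.rpow_natCast]
  have e4 : h ^ (-(1 : ℝ) / 4) = 1 / h ^ (1 / 4 : ℝ) := by
    rw [neg_div, Real.rpow_neg hh.le, inv_eq_one_div]
  have e5 : D ^ (-(5 : ℝ) / 4) = 1 / (D * D ^ (1 / 4 : ℝ)) := by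
    have : -(5 : ℝ) / 4 = -(1 + 1 / 4) := by norm_num
    rw [this, Real.rpow_neg hD.le, Real.rpow_add hD, Real.rpow_one, inv_eq_one_div]
  have hx4 : 0 < x ^ (1 / 4 : ℝ) := by positivity
  have hh4 : 0 < h ^ (1 / 4 : ℝ) := by positivity
  have hD4 : 0 < D ^ (1 / 4 : ℝ) := by positivity
  rw [e1, e2, e3, e4, e5, mul_pow]
  field_simp

lemma sum_coeff_statTerm_im {θ x h r : ℝ} (hθ : 0 < θ) (hx : 0 < x) (hh : 0 < h)
    (hr : θ * h < r) (k : ℕ) :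
    (∑ j ∈ range (k + 1), ((k.choose j * (-θ) ^ j * x ^ (k - j) : ℝ) : ℂ) *
      statTerm (θ * h / 2) (Real.sqrt (x / θ)) j r).im =
    x ^ ((k : ℝ) + 3 / 4) * (h * (h ^ (-(1 : ℝ) / 4) * (2 * r - θ * h) ^ (-(5 : ℝ) / 4) *
        (1 - θ * h / (2 * r - θ * h)) ^ k)) *
      Real.cos (2 * Real.pi * Real.sqrt (x * h * (2 * r - θ * h)) - Real.pi / 4) := by
  have h0 : 0 < θ * h := by positivity
  have hD : 0 < 2 * r - θ * h := by linarith
  have ht := statPt_eq hθ hx hh hr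
  have hy := two_mul_sub_mul_statPt hθ hx hh hr
  have hterm : ∀ j, ((k.choose j * (-θ) ^ j * x ^ (k - j) : ℝ) : ℂ) *
      statTerm (θ * h / 2) (Real.sqrt (x / θ)) j r =
      ((k.choose j * (-θ) ^ j * x ^ (k - j) * Real.sqrt (x * h / (2 * r - θ * h)) ^ (2 * j) *
        (Real.sqrt (x * h / (2 * r - θ * h)) ^ 2 /
          Real.sqrt (Real.sqrt (x * h * (2 * r - θ * h)))) : ℝ) : ℂ) *
      eR (Real.sqrt (x * h * (2 * r - θ * h)) + 1 / 8) := by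
    intro j
    rw [statTerm, hy, ht]
    push_cast
    ring
  rw [sum_congr rfl fun j _ => hterm j, ← sum_mul, ← Complex.ofReal_sum, ofReal_mul_eR_im,
    ← sum_mul, ← sub_pow_eq_sum, Real.sq_sqrt (by positivity), ← amplitude_eq hx hh hD]
  have hs : Real.sin (2 * Real.pi * (Real.sqrt (x * h * (2 * r - θ * h)) + 1 / 8)) =
      Real.cos (2 * Real.pi * Real.sqrt (x * h * (2 * r - θ * h)) - Real.pi / 4) := by
    rw [← Real.cos_sub_pi_div_two]
    rw [← Real.cos_neg]
    rw [← Real.cos_neg]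
    congr 1
    ring
  rw [hs]
  ring

theorem abs_inner_sum_sub_le {θ x h : ℝ} {L N : ℕ} (hθ : 0 < θ) (hx : θ ≤ x) (hh : 0 < h)
    (hL : (L : ℝ) < θ * h) (hL' : θ * h < L + 1) (hN : θ * h ≤ N) (k : ℕ) :
    |∑ m ∈ Icc 1 ⌊Real.sqrt (x / θ)⌋₊, (m : ℝ) * (x - θ * m ^ 2) ^ k *
        Real.sin (2 * Real.pi * h * (x / (2 * m) - θ * m / 2)) -
      ∑ r ∈ Ioc L N, x ^ ((k : ℝ) + 3 / 4) * (h * (h ^ (-(1 : ℝ) / 4) *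
        (2 * r - θ * h) ^ (-(5 : ℝ) / 4) * (1 - θ * h / (2 * r - θ * h)) ^ k)) *
        Real.cos (2 * Real.pi * Real.sqrt (x * h * (2 * r - θ * h)) - Real.pi / 4)| ≤
      2 ^ k * x ^ k * Real.sqrt (x / θ) * ((14 * k + 40) * (1 + Real.log N) +
        h * x / 2 / (N + 1 / 2 - θ * h / 2) +
        2 * (min (Real.sqrt (Real.sqrt (x / θ) / (θ * h / 2))) (1 / (θ * h - L)) +
          min (Real.sqrt (Real.sqrt (x / θ) / (θ * h / 2))) (1 / (L + 1 - θ * h)))) := by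
  have hx0 : 0 < x := hθ.trans_le hx
  set b := Real.sqrt (x / θ) with hb_def
  set η := θ * h / 2 with hη_def
  have h2η : θ * h = 2 * η := by rw [hη_def]; ring
  have hη : 0 < η := by positivity
  have hb : 1 ≤ b := by
    rw [hb_def, Real.one_le_sqrt]; rwa [one_le_div hθ]
  have hb2 : b ^ 2 = x / θ := Real.sq_sqrt (by positivity)
  have hηb : η * b ^ 2 = h * x / 2 := by rw [hb2, hη_def]; field_simp
  have hN0 : (1 : ℝ) ≤ N := by
    have : (L : ℝ) < N := by linarith
    have : L + 1 ≤ N := by exact_mod_cast this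
    exact_mod_cast (by omega : 1 ≤ N)
  have hlog := Real.log_nonneg hN0
  set c : ℕ → ℝ := fun j => k.choose j * (-θ) ^ j * x ^ (k - j) with hc
  set E := h * x / 2 / (N + 1 / 2 - η) +
        2 * (min (Real.sqrt (b / η)) (1 / (2 * η - L)) +
          min (Real.sqrt (b / η)) (1 / (L + 1 - 2 * η))) with hE
  have hmain : ∀ j ∈ range (k + 1), ‖(c j : ℂ) * (∑ m ∈ Ioc 0 ⌊b⌋₊, (m : ℂ) ^ (2 * j + 1) *
      eR (η * b ^ 2 / m + -η * m) - ∑ r ∈ Ioc L N, statTerm η b j r)‖ ≤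
      k.choose j * (x ^ k * b * ((14 * k + 40) * (1 + Real.log N) + E)) := by
    intro j hj
    have hjk : j ≤ k := by simpa [Nat.lt_succ_iff] using hj
    have := norm_sum_sub_main_le (L := L) hη hb (by linarith) (by linarith)
      (by linarith : 2 * η ≤ N) j
    rw [hηb, add_assoc, ← hE] at this
    rw [norm_mul, Complex.norm_real, Real.norm_eq_abs, hc]
    have e1 : |(k.choose j : ℝ) * (-θ) ^ j * x ^ (k - j)| = k.choose j * (θ ^ j * x ^ (k - j)) := by
      rw [abs_mul, abs_mul, abs_pow, abs_pow, abs_neg, abs_of_pos hθ, abs_of_pos hx0, Nat.abs_cast]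
      ring
    have e2 : θ ^ j * x ^ (k - j) * b ^ (2 * j + 1) = x ^ k * b := by
      rw [pow_succ, pow_mul, hb2, div_pow, ← Nat.sub_add_cancel hjk, pow_add,
        Nat.sub_add_cancel hjk]
      field_simp
    rw [e1, ← e2]
    simp only [mul_assoc]
    refine mul_le_mul_of_nonneg_left ?_ (by positivity)
    refine mul_le_mul_of_nonneg_left ?_ (by positivity)
    refine mul_le_mul_of_nonneg_left ?_ (by positivity)
    rw [hηb] at *
    refine this.trans ?_
    refine mul_le_mul_of_nonneg_left ?_ (by positivity)
    have : (j : ℝ) ≤ k := by exact_mod_cast hjk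
    gcongr
  have hsum := norm_sum_le_of_le _ hmain
  rw [← sum_mul, ← Nat.cast_sum, Nat.sum_range_choose] at hsum
  have him := (Complex.abs_im_le_norm _).trans hsum
  have hfirst : (∑ j ∈ range (k + 1), (c j : ℂ) * ∑ m ∈ Ioc 0 ⌊b⌋₊, (m : ℂ) ^ (2 * j + 1) *
      eR (η * b ^ 2 / m + -η * m)).im = ∑ m ∈ Icc 1 ⌊b⌋₊, (m : ℝ) * (x - θ * m ^ 2) ^ k *
        Real.sin (2 * Real.pi * h * (x / (2 * m) - θ * m / 2)) := by
    simp_rw [mul_sum]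
    rw [sum_comm, Complex.im_sum]
    refine sum_congr rfl fun m hm => ?_
    have : ∑ j ∈ range (k + 1), (c j : ℂ) * ((m : ℂ) ^ (2 * j + 1) *
        eR (η * b ^ 2 / m + -η * m)) =
        ((m * ∑ j ∈ range (k + 1), c j * (m : ℝ) ^ (2 * j) : ℝ) : ℂ) *
          eR (η * b ^ 2 / m + -η * m) := by
      push_cast
      rw [mul_sum, sum_mul]
      refine sum_congr rfl fun j _ => ?_
      ring
    rw [this, ofReal_mul_eR_im, ← sub_pow_eq_sum, hηb, hη_def]
    congr 2
    ring
  have hsecond : (∑ j ∈ range (k + 1), (c j : ℂ) * ∑ r ∈ Ioc L N, statTerm η b j r).im =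
      ∑ r ∈ Ioc L N, x ^ ((k : ℝ) + 3 / 4) * (h * (h ^ (-(1 : ℝ) / 4) *
        (2 * r - θ * h) ^ (-(5 : ℝ) / 4) * (1 - θ * h / (2 * r - θ * h)) ^ k)) *
        Real.cos (2 * Real.pi * Real.sqrt (x * h * (2 * r - θ * h)) - Real.pi / 4) := by
    simp_rw [mul_sum]
    rw [sum_comm, Complex.im_sum]
    refine sum_congr rfl fun r hr => ?_
    rw [mem_Ioc] at hr
    have : (L : ℝ) + 1 ≤ r := by exact_mod_cast hr.1
    exact sum_coeff_statTerm_im hθ hx0 hh (by linarith) k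
  simp_rw [mul_sub] at him
  rw [sum_sub_distrib, Complex.sub_im, hfirst, hsecond] at him
  refine him.trans (le_of_eq ?_)
  rw [hE, h2η]
  push_cast
  ring

lemma min_sqrt_one_div_le {θ g c T x h d : ℝ} (hθ : 0 < θ) (hg : 0 < g) (hc : 0 < c)
    (hT : 1 ≤ T) (hx : x ≤ 2 * T) (hh : 1 ≤ h) (hd : c * h ^ (-g) ≤ d) :
    min (Real.sqrt (Real.sqrt (x / θ) / (θ * h / 2))) (1 / d) ≤
      (Real.sqrt (2 * Real.sqrt (2 / θ) / θ) + 1 / c) * T ^ (g / (4 * g + 2)) := by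
  have hT0 : 0 < T := by linarith
  have hh0 : 0 < h := by linarith
  have hP : 0 < T ^ (g / (4 * g + 2)) := by positivity
  rcases le_total h (T ^ (1 / (4 * g + 2))) with hY | hY
  · refine (min_le_right _ _).trans ?_
    have h1 : h ^ g ≤ T ^ (g / (4 * g + 2)) := by
      calc h ^ g ≤ (T ^ (1 / (4 * g + 2))) ^ g := Real.rpow_le_rpow hh0.le hY hg.le
        _ = _ := by rw [← Real.rpow_mul hT0.le]; congr 1; ring
    have h2 : 1 / d ≤ 1 / c * h ^ g := by
      refine (one_div_le_one_div_of_le (by positivity) hd).trans_eq ?_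
      rw [Real.rpow_neg hh0.le]
      field_simp
    have h3 : 1 / c * h ^ g ≤ 1 / c * T ^ (g / (4 * g + 2)) := by gcongr
    have h4 : 0 ≤ Real.sqrt (2 * Real.sqrt (2 / θ) / θ) * T ^ (g / (4 * g + 2)) := by positivity
    linarith
  · refine (min_le_left _ _).trans ?_
    set Y := T ^ (1 / (4 * g + 2)) with hYdef
    have hY0 : 0 < Y := by positivity
    have h1 : Real.sqrt (Real.sqrt (x / θ) / (θ * h / 2)) ≤
        Real.sqrt (2 * Real.sqrt (2 / θ) / θ * (Real.sqrt T / Y)) := by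
      apply Real.sqrt_le_sqrt
      calc _ ≤ Real.sqrt (2 * T / θ) / (θ * Y / 2) := by gcongr
        _ = _ := by
          rw [show 2 * T / θ = 2 / θ * T by ring, Real.sqrt_mul (by positivity)]
          field_simp
    have h2 : Real.sqrt (Real.sqrt T / Y) = T ^ (g / (4 * g + 2)) := by
      rw [Real.sqrt_eq_rpow, Real.sqrt_eq_rpow, hYdef, ← Real.rpow_sub hT0,
        ← Real.rpow_mul hT0.le]
      congr 1
      field_simp
      ring
    rw [Real.sqrt_mul (by positivity), h2] at h1
    have : 0 ≤ 1 / c * T ^ (g / (4 * g + 2)) := by positivity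
    linarith

lemma exists_le_abs_mul_sub {θ γ : ℝ} (htype : IsApproxType θ γ) {ε : ℝ} (hε : 0 < ε) :
    ∃ c : ℝ, 0 < c ∧ ∀ p : ℤ, ∀ h : ℕ, 0 < h → c * (h : ℝ) ^ (-(γ + ε)) ≤ |θ * h - p| := by
  obtain ⟨c, hc, H⟩ := htype.2 ε hε
  refine ⟨c, hc, fun p h hh => ?_⟩
  have hh0 : (0 : ℝ) < h := by exact_mod_cast hh
  have h1 := H p h hh
  have h2 : θ * h - p = (θ - p / h) * h := by field_simp
  rw [h2, abs_mul, Nat.abs_cast]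
  calc _ = c * (h : ℝ) ^ (-γ - 1 - ε) * h := by
        rw [show -(γ + ε) = (-γ - 1 - ε) + 1 by ring, Real.rpow_add hh0, Real.rpow_one]
        ring
    _ ≤ _ := by gcongr

lemma exponent_le {γ ε : ℝ} (hγ : 1 ≤ γ) (hε : 0 < ε) :
    (γ + ε) / (4 * (γ + ε) + 2) ≤ γ / (4 * γ + 2) + ε := by
  have h1 : 0 < 4 * γ + 2 := by linarith
  have h2 : 0 < 4 * (γ + ε) + 2 := by linarith
  rw [div_add' _ _ _ h1.ne', div_le_div_iff₀ h2 h1]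
  nlinarith [mul_pos hε h1, mul_pos (mul_pos hε h1) h1, mul_pos (mul_pos hε h1) hε]

lemma two_pow_Jdef_bounds {T : ℝ} (hT : 3 ≤ T) :
    T / (2 * Real.log T) ≤ (2 : ℝ) ^ (2 * Jdef T + 1) ∧ (2 : ℝ) ^ (2 * Jdef T + 1) ≤ 2 * T := by
  have hT0 : 0 < T := by linarith
  have hlog : 1 ≤ Real.log T := by
    rw [Real.le_log_iff_exp_le hT0]
    linarith [Real.exp_one_lt_d9]
  have hl2 : 0 < Real.log 2 := Real.log_pos (by norm_num)
  have hlT : Real.log T ≤ T := (Real.log_le_sub_one_of_pos hT0).trans (by linarith)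
  set y := (Real.log T - Real.log (Real.log T)) / (2 * Real.log 2) with hy
  have hy0 : 0 ≤ y := by
    refine div_nonneg ?_ (by positivity)
    have := Real.log_le_log (by linarith) hlT
    linarith
  have hye : y * (2 * Real.log 2) = Real.log (T / Real.log T) := by
    rw [hy, Real.log_div hT0.ne' (by linarith)]
    field_simp
  have h1 : (Jdef T : ℝ) ≤ y := Nat.floor_le hy0
  have h2 : y < Jdef T + 1 := Nat.lt_floor_add_one y
  have hq : 0 < T / Real.log T := by positivity
  constructor
  · have h3 : T / Real.log T ≤ (2 : ℝ) ^ (2 * Jdef T + 2) := by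
      rw [← Real.log_le_log_iff hq (by positivity), ← hye, Real.log_pow]
      push_cast
      nlinarith
    rw [pow_succ] at h3
    rw [div_le_iff₀ (by linarith)] at h3 ⊢
    nlinarith
  · have h3 : (2 : ℝ) ^ (2 * Jdef T) ≤ T / Real.log T := by
      rw [← Real.log_le_log_iff (by positivity) hq, ← hye, Real.log_pow]
      push_cast
      nlinarith
    have h4 : T / Real.log T ≤ T := div_le_self hT0.le hlog
    rw [pow_succ]
    linarith

/-- The difference between the `h`-th summands of `R1` and `R11`, up to normalisation. -/
noncomputable def innerDiff (k : ℕ) (θ T x : ℝ) (h : ℕ) : ℝ :=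
  ∑ m ∈ Icc 1 ⌊Real.sqrt (x / θ)⌋₊, (m : ℝ) * (x - θ * m ^ 2) ^ k *
      Real.sin (2 * Real.pi * h * (x / (2 * m) - θ * m / 2)) -
    ∑ r ∈ Ioc ⌊θ * h⌋₊ ⌊θ * h * (2 ^ (2 * Jdef T + 1) + 1 / 2)⌋₊,
      x ^ ((k : ℝ) + 3 / 4) * (h * ((h : ℝ) ^ (-(1 : ℝ) / 4) *
        (2 * (r : ℝ) - θ * h) ^ (-(5 : ℝ) / 4) * (1 - θ * h / (2 * (r : ℝ) - θ * h)) ^ k)) *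
        Real.cos (2 * Real.pi * Real.sqrt (x * h * (2 * (r : ℝ) - θ * h)) - Real.pi / 4)

lemma abs_innerDiff_le {θ c g T x : ℝ} {h : ℕ} (k : ℕ) (hθ : 0 < θ) (hirr : Irrational θ)
    (hg : 0 < g) (hc : 0 < c) (hd : ∀ p : ℤ, c * (h : ℝ) ^ (-g) ≤ |θ * h - p|) (hT : 3 ≤ T)
    (hTθ : 4 * θ ≤ T) (hP : 1 / 2 + 1 / θ ≤ T / (2 * Real.log T)) (hx : x ∈ Set.Icc T (2 * T))
    (hh : 1 ≤ h) (hhT : (h : ℝ) ≤ T ^ 2) :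
    |innerDiff k θ T x h| ≤ 2 ^ k * x ^ k * Real.sqrt (x / θ) *
      ((14 * k + 40) * (1 + 4 * Real.log T) + 4 * Real.log T / θ +
        4 * ((Real.sqrt (2 * Real.sqrt (2 / θ) / θ) + 1 / c) * T ^ (g / (4 * g + 2)))) := by
  have hT0 : 0 < T := by linarith
  have hx0 : 0 < x := hT0.trans_le hx.1
  have hh1 : (1 : ℝ) ≤ h := by exact_mod_cast hh
  have hlog : 0 < Real.log T := Real.log_pos (by linarith)
  obtain ⟨hP1, hP2⟩ := two_pow_Jdef_bounds hT
  set P : ℝ := 2 ^ (2 * Jdef T + 1) with hPdef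
  have hθh : 0 < θ * h := by positivity
  have hPθ : 1 / 2 + 1 / θ ≤ P := hP.trans hP1
  have hP0 : 0 < P := by positivity
  have hPh : θ * h * (1 / 2) + 1 ≤ θ * h * P := by
    have h1 : θ * h * (1 / 2 + 1 / θ) ≤ θ * h * P := by gcongr
    have h2 : θ * h * (1 / 2 + 1 / θ) = θ * h * (1 / 2) + h := by field_simp
    linarith
  set L := ⌊θ * h⌋₊ with hLdef
  set N := ⌊θ * h * (P + 1 / 2)⌋₊ with hNdef
  have hirr' : Irrational (θ * h) := hirr.mul_natCast (by omega)
  have hL : (L : ℝ) < θ * h :=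
    lt_of_le_of_ne (Nat.floor_le hθh.le) (hirr'.ne_nat L).symm
  have hL' : θ * h < L + 1 := Nat.lt_floor_add_one _
  have hN1 : θ * h * (P + 1 / 2) < N + 1 := Nat.lt_floor_add_one _
  have hN2 : (N : ℝ) ≤ θ * h * (P + 1 / 2) := Nat.floor_le (by positivity)
  have hNθ : θ * h ≤ N := by linarith
  have hmain := abs_inner_sum_sub_le (k := k) (N := N) hθ (by linarith [hx.1] : θ ≤ x)
    (by linarith : (0 : ℝ) < h) hL hL' hNθ
  refine hmain.trans ?_
  have hNpos : (0 : ℝ) < N := hθh.trans_le hNθ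
  have hlogN : Real.log N ≤ 4 * Real.log T := by
    have : (N : ℝ) ≤ T ^ 4 := by
      calc (N : ℝ) ≤ θ * h * (P + 1 / 2) := hN2
        _ ≤ θ * T ^ 2 * (4 * T) := by gcongr; linarith
        _ = (4 * θ) * T ^ 3 := by ring
        _ ≤ T * T ^ 3 := by gcongr
        _ = T ^ 4 := by ring
    calc _ ≤ Real.log (T ^ 4) := Real.log_le_log hNpos this
      _ = _ := by rw [Real.log_pow]; norm_num
  have hmid : (h : ℝ) * x / 2 / (N + 1 / 2 - θ * h / 2) ≤ 4 * Real.log T / θ := by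
    calc _ ≤ (h : ℝ) * (2 * T) / 2 / (θ * h * (T / (2 * Real.log T)) / 2) := by
          have hden : θ * h * (T / (2 * Real.log T)) / 2 ≤ N + 1 / 2 - θ * h / 2 := by
            have : θ * h * (T / (2 * Real.log T)) ≤ θ * h * P := by gcongr
            linarith
          have := hx.2
          gcongr
      _ = _ := by field_simp; norm_num
  have hd1 : c * (h : ℝ) ^ (-g) ≤ θ * h - L := by
    have := hd L
    rwa [Int.cast_natCast, abs_of_pos (by linarith)] at this
  have hd2 : c * (h : ℝ) ^ (-g) ≤ L + 1 - θ * h := by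
    have := hd (L + 1 : ℕ)
    rw [Int.cast_natCast, abs_of_neg (by push_cast; linarith)] at this
    push_cast at this
    linarith
  have hm1 := min_sqrt_one_div_le hθ hg hc (by linarith : 1 ≤ T) hx.2 hh1 hd1
  have hm2 := min_sqrt_one_div_le hθ hg hc (by linarith : 1 ≤ T) hx.2 hh1 hd2
  refine mul_le_mul_of_nonneg_left ?_ (by positivity)
  have : (14 * (k : ℝ) + 40) * (1 + Real.log N) ≤ (14 * k + 40) * (1 + 4 * Real.log T) := by
    gcongr
  linarith

lemma R1_sub_R11_eq {l : ℕ} (hl : 1 ≤ l) (θ T x H : ℝ) :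
    R1 l θ x H - R11 l θ T x H = ((2 : ℝ) ^ ((2 : ℤ) - l) / ((l - 1).factorial * Real.pi)) *
      ∑ h ∈ Icc 1 ⌊H⌋₊, ((-1 : ℝ) ^ (l * h) / h) * innerDiff (l - 1) θ T x h := by
  rw [R1, R11, mul_assoc _ (x ^ _) _, ← mul_sub, mul_sum, ← sum_sub_distrib]
  congr 1
  refine sum_congr rfl fun h hh => ?_
  have hh0 : (h : ℝ) ≠ 0 := by
    have := (mem_Icc.mp hh).1
    exact_mod_cast (by omega : h ≠ 0)
  have hexp : ((l - 1 : ℕ) : ℝ) + 3 / 4 = (l : ℝ) - 1 / 4 := by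
    rw [Nat.cast_sub hl]; push_cast; ring
  rw [innerDiff, mul_sub, hexp]
  congr 1
  rw [mul_sum, mul_sum]
  refine sum_congr rfl fun r _ => ?_
  rw [uCoef]
  field_simp

lemma abs_R1_sub_R11_le {l : ℕ} (hl : 1 ≤ l) {θ T x M : ℝ} (hT : 1 ≤ T) (hM : 0 ≤ M)
    (h : ∀ h : ℕ, 1 ≤ h → (h : ℝ) ≤ T ^ 2 → |innerDiff (l - 1) θ T x h| ≤ M) :
    |R1 l θ x (T ^ 2) - R11 l θ T x (T ^ 2)| ≤
      (2 : ℝ) ^ ((2 : ℤ) - l) / ((l - 1).factorial * Real.pi) *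
        (M * (1 + 2 * Real.log T)) := by
  rw [R1_sub_R11_eq hl, abs_mul, abs_of_nonneg (by positivity)]
  refine mul_le_mul_of_nonneg_left ?_ (by positivity)
  have hT2 : 1 ≤ T ^ 2 := one_le_pow₀ hT
  have hfl : (⌊T ^ 2⌋₊ : ℝ) ≤ T ^ 2 := Nat.floor_le (by positivity)
  have hfl1 : 1 ≤ ⌊T ^ 2⌋₊ := by rwa [Nat.one_le_floor_iff]
  calc _ ≤ ∑ h ∈ Ioc 0 ⌊T ^ 2⌋₊, |(-1 : ℝ) ^ (l * h) / h * innerDiff (l - 1) θ T x h| :=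
        abs_sum_le_sum_abs _ _
    _ ≤ M * (1 + Real.log ⌊T ^ 2⌋₊) := by
        refine sum_Ioc_one_div_le hM fun n hn => ?_
        rw [mem_Ioc] at hn
        have hnT : (n : ℝ) ≤ T ^ 2 := (Nat.cast_le.mpr hn.2).trans hfl
        have hn0 : (0 : ℝ) < n := by exact_mod_cast hn.1
        rw [abs_mul, abs_div, abs_pow, abs_neg, abs_one, one_pow, Nat.abs_cast,
          div_mul_eq_mul_div, one_mul]
        have := h n hn.1 hnT
        gcongr
    _ ≤ M * (1 + Real.log (T ^ 2)) := by
        have : (0 : ℝ) < ⌊T ^ 2⌋₊ := by exact_mod_cast hfl1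
        gcongr
    _ = _ := by rw [Real.log_pow]; norm_num

lemma le_div_two_mul_log {A T : ℝ} (hA : 0 ≤ A) (hT : 3 ≤ T) (h : 16 * A ^ 2 ≤ T) :
    A ≤ T / (2 * Real.log T) := by
  have hT0 : 0 < T := by linarith
  have hlog : 0 < Real.log T := Real.log_pos (by linarith)
  have hs : 0 < Real.sqrt T := Real.sqrt_pos.mpr hT0
  have h1 : Real.log T ≤ 2 * Real.sqrt T := by
    have := Real.log_le_sub_one_of_pos hs
    rw [Real.log_sqrt hT0.le] at this
    linarith
  have h2 : 4 * A ≤ Real.sqrt T := Real.le_sqrt_of_sq_le (by linarith)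
  rw [le_div_iff₀ (by positivity)]
  calc A * (2 * Real.log T) ≤ A * (2 * (2 * Real.sqrt T)) := by gcongr
    _ = 4 * A * Real.sqrt T := by ring
    _ ≤ Real.sqrt T * Real.sqrt T := by gcongr
    _ = T := Real.mul_self_sqrt hT0.le

lemma pow_mul_sqrt_le {θ T x : ℝ} (hθ : 0 < θ) (hT : 0 < T) (hx : x ∈ Set.Icc T (2 * T)) (k : ℕ) :
    x ^ k * Real.sqrt (x / θ) ≤ 2 ^ k * Real.sqrt (2 / θ) * T ^ ((k : ℝ) + 1 / 2) := by
  have hx0 : 0 < x := hT.trans_le hx.1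
  have hx2 := hx.2
  calc _ ≤ (2 * T) ^ k * Real.sqrt (2 * T / θ) := by gcongr
    _ = _ := by
      rw [show 2 * T / θ = 2 / θ * T by ring, Real.sqrt_mul (by positivity), mul_pow,
        Real.rpow_add hT, Real.rpow_natCast, Real.sqrt_eq_rpow T]
      ring

end Voronoi

/-- Voronoï-type formula (5.9): for `l ≥ 1` and irrational `θ > 0` of finite approximation
type `γ ≥ 1`, for every `ε > 0` there are `C > 0` and `T₀ ≥ 3` such that for all `T ≥ T₀`,
with `H = T²` and `J = ⌊(log T − log log T)/(2 log 2)⌋`, for every `x ∈ [T, 2T]`: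
`|R₁(x,H) − R₁₁(x,H)| ≤ C·T^{l − 1/2 + γ/(4γ+2) + ε}`. -/
theorem voronoi_formula (l : ℕ) (hl : 1 ≤ l) (θ γ : ℝ) (hθ : 0 < θ)
    (hirr : Irrational θ) (htype : IsApproxType θ γ) (ε : ℝ) (hε : 0 < ε) :
    ∃ C : ℝ, 0 < C ∧ ∃ T₀ : ℝ, 3 ≤ T₀ ∧ ∀ T : ℝ, T₀ ≤ T →
      ∀ x ∈ Set.Icc T (2 * T),
        |R1 l θ x (T ^ 2) - R11 l θ T x (T ^ 2)| ≤
          C * T ^ ((l : ℝ) - 1 / 2 + γ / (4 * γ + 2) + ε) := by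
  have hγ := htype.1
  obtain ⟨δ, hδ, hδε⟩ : ∃ δ : ℝ, 0 < δ ∧ ε = δ + δ := ⟨ε / 2, by linarith, by ring⟩
  obtain ⟨c, hc, hd⟩ := Voronoi.exists_le_abs_mul_sub htype hδ
  obtain ⟨k, rfl⟩ : ∃ k, l = k + 1 := ⟨l - 1, by omega⟩
  set K := Real.sqrt (2 * Real.sqrt (2 / θ) / θ) + 1 / c with hK
  set c₀ := (2 : ℝ) ^ ((2 : ℤ) - (k + 1 : ℕ)) / ((k + 1 - 1).factorial * Real.pi) with hc₀
  set c₁ := (14 * (k : ℝ) + 40) * (1 + 4 / δ) + 4 / δ / θ + 4 * K with hc₁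
  set κ := γ / (4 * γ + 2) with hκ
  have hκ0 : 0 < κ := by positivity
  have hc₀pos : 0 < c₀ := by
    have := Real.pi_pos
    positivity
  refine ⟨c₀ * (2 ^ k * (2 ^ k * Real.sqrt (2 / θ)) * c₁ * (1 + 2 / δ)), by positivity,
    max 3 (max (4 * θ) (16 * (1 / 2 + 1 / θ) ^ 2)), le_max_left _ _, fun T hT x hx => ?_⟩
  simp only [max_le_iff] at hT
  obtain ⟨hT3, hTθ, hTA⟩ := hT
  have hT0 : 0 < T := by linarith
  have hT1 : 1 ≤ T := by linarith
  have hx0 : 0 < x := hT0.trans_le hx.1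
  have hlogδ : Real.log T ≤ T ^ δ / δ := Real.log_le_rpow_div hT0.le hδ
  have hTκ1 : T ^ δ ≤ T ^ (κ + δ) := Real.rpow_le_rpow_of_exponent_le hT1 (by linarith)
  have hTδ1 : 1 ≤ T ^ δ := Real.one_le_rpow hT1 hδ.le
  have hbracket : (14 * (k : ℝ) + 40) * (1 + 4 * Real.log T) + 4 * Real.log T / θ +
      4 * (K * T ^ ((γ + δ) / (4 * (γ + δ) + 2))) ≤ c₁ * T ^ (κ + δ) := by
    have h1 : Real.log T ≤ T ^ (κ + δ) / δ := hlogδ.trans (by gcongr)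
    have h2 : T ^ ((γ + δ) / (4 * (γ + δ) + 2)) ≤ T ^ (κ + δ) :=
      Real.rpow_le_rpow_of_exponent_le hT1 (Voronoi.exponent_le hγ hδ)
    calc _ ≤ (14 * (k : ℝ) + 40) * (T ^ (κ + δ) + 4 * (T ^ (κ + δ) / δ)) +
          4 * (T ^ (κ + δ) / δ) / θ + 4 * (K * T ^ (κ + δ)) := by
          gcongr
          exact hTδ1.trans hTκ1
      _ = _ := by rw [hc₁]; ring
  have hinner : ∀ h : ℕ, 1 ≤ h → (h : ℝ) ≤ T ^ 2 → |Voronoi.innerDiff (k + 1 - 1) θ T x h| ≤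
      2 ^ k * (2 ^ k * Real.sqrt (2 / θ) * T ^ ((k : ℝ) + 1 / 2)) * (c₁ * T ^ (κ + δ)) := by
    intro h hh hhT
    refine (Voronoi.abs_innerDiff_le k hθ hirr (by linarith) hc (fun p => hd p h hh) hT3 hTθ
      (Voronoi.le_div_two_mul_log (by positivity) hT3 hTA) hx hh hhT).trans ?_
    rw [mul_assoc (2 ^ k) (x ^ k)]
    have := Voronoi.pow_mul_sqrt_le hθ hT0 hx k
    have hlog : 0 ≤ Real.log T := Real.log_nonneg hT1
    have hγδ : 0 < γ + δ := by linarith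
    refine mul_le_mul ?_ hbracket (by positivity) (by positivity)
    gcongr
  refine (Voronoi.abs_R1_sub_R11_le hl hT1 (by positivity) hinner).trans ?_
  rw [mul_assoc c₀]
  refine mul_le_mul_of_nonneg_left ?_ hc₀pos.le
  have hlast : 1 + 2 * Real.log T ≤ (1 + 2 / δ) * T ^ δ := by
    calc _ ≤ T ^ δ + 2 * (T ^ δ / δ) := by gcongr
      _ = _ := by ring
  have hexp : T ^ (((k + 1 : ℕ) : ℝ) - 1 / 2 + κ + ε) =
      T ^ ((k : ℝ) + 1 / 2) * T ^ (κ + δ) * T ^ δ := by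
    rw [← Real.rpow_add hT0, ← Real.rpow_add hT0, hδε]
    congr 1
    push_cast
    ring
  rw [hexp]
  calc _ ≤ 2 ^ k * (2 ^ k * Real.sqrt (2 / θ) * T ^ ((k : ℝ) + 1 / 2)) * (c₁ * T ^ (κ + δ)) *
        ((1 + 2 / δ) * T ^ δ) := by gcongr
    _ = _ := by ring
end

section
/- (Estimate (5.15), the S₃ integral) Fix an integer l ≥ 1 and an irrational θ > 0. There exist C > 0 and T₀ ≥ 3 (depending on l, θ) such that for all T ≥ T₀, setting H = T² and J = ⌊(log T − log log T)/(2 log 2)⌋ and S₃(x) = (2^{3−2l}·x^{2l−1/2}/(π²·((l−1)!)²)) · Σ u(h₁,r₁)·u(h₂,r₂)·sin(2π√x·(√(h₁(2r₁ − θh₁)) + √(h₂(2r₂ − θh₂)))), where the sum runs over positive integers h₁, h₂, r₁, r₂ with 1 ≤ hⱼ ≤ H and θhⱼ < rⱼ ≤ θhⱼ(2^{2J+1} + 1/2) for j = 1, 2, one has |∫_T^{2T} S₃(x) dx| ≤ C·T^{2l}·log² T. -/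
open Finset

open MeasureTheory in
/-- The first-derivative (integration by parts) bound for `∫ x^{k-1/2} sin(c√x) dx`. -/
lemma abs_integral_rpow_mul_sin_sqrt_le (k : ℕ) {a b c : ℝ} (ha : 0 < a) (hab : a ≤ b)
    (hc : 0 < c) :
    IntervalIntegrable (fun x : ℝ => x ^ ((k : ℝ) - 1 / 2) * Real.sin (c * √x)) volume a b ∧
      |∫ x in a..b, x ^ ((k : ℝ) - 1 / 2) * Real.sin (c * √x)| ≤ 4 / c * b ^ k := by
  have hpos : ∀ x ∈ Set.uIcc a b, 0 < x := fun x hx => by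
    rw [Set.uIcc_of_le hab] at hx
    exact ha.trans_le hx.1
  have hb : 0 < b := ha.trans_le hab
  have hint : IntervalIntegrable (fun x : ℝ => x ^ ((k : ℝ) - 1 / 2) * Real.sin (c * √x))
      volume a b := by
    apply ContinuousOn.intervalIntegrable
    refine ContinuousOn.mul (fun x hx => ?_) (by fun_prop)
    exact (Real.continuousAt_rpow_const x _ (Or.inl (hpos x hx).ne')).continuousWithinAt
  refine ⟨hint, ?_⟩
  have hint2 : IntervalIntegrable
      (fun x : ℝ => (k * x ^ (k - 1)) * Real.cos (c * √x)) volume a b := by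
    apply Continuous.intervalIntegrable
    fun_prop
  have hderiv : ∀ x ∈ Set.uIcc a b,
      HasDerivAt (fun y : ℝ => -(2 / c) * (y ^ k * Real.cos (c * √y)))
        (x ^ ((k : ℝ) - 1 / 2) * Real.sin (c * √x)
          - 2 / c * ((k * x ^ (k - 1)) * Real.cos (c * √x))) x := by
    intro x hx
    have hx0 := hpos x hx
    have hs : 0 < √x := Real.sqrt_pos.2 hx0
    have h1 := ((Real.hasDerivAt_sqrt hx0.ne').const_mul c).cos
    have h2 := ((hasDerivAt_pow k x).mul h1).const_mul (-(2 / c))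
    refine h2.congr_deriv ?_
    rw [Real.rpow_sub hx0, Real.rpow_natCast, ← Real.sqrt_eq_rpow]
    field_simp
    ring
  have hFTC := intervalIntegral.integral_eq_sub_of_hasDerivAt hderiv
    (hint.sub (hint2.const_mul (2 / c)))
  rw [intervalIntegral.integral_sub hint (hint2.const_mul _),
    intervalIntegral.integral_const_mul] at hFTC
  have hpow : ∫ x in a..b, (k : ℝ) * x ^ (k - 1) = b ^ k - a ^ k :=
    intervalIntegral.integral_eq_sub_of_hasDerivAt (fun x _ => hasDerivAt_pow k x)
      (Continuous.intervalIntegrable (by fun_prop) _ _)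
  have hcos : |∫ x in a..b, (k * x ^ (k - 1)) * Real.cos (c * √x)| ≤ b ^ k - a ^ k := by
    rw [← hpow, ← Real.norm_eq_abs]
    refine intervalIntegral.norm_integral_le_of_norm_le hab ?_
      (Continuous.intervalIntegrable (by fun_prop) _ _)
    refine Filter.Eventually.of_forall fun x hx => ?_
    have hx0 : 0 < x := ha.trans hx.1
    rw [norm_mul, Real.norm_eq_abs, Real.norm_eq_abs,
      abs_of_nonneg (by positivity : (0 : ℝ) ≤ k * x ^ (k - 1))]
    exact mul_le_of_le_one_right (by positivity) (Real.abs_cos_le_one _)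
  have hA : |b ^ k * Real.cos (c * √b)| ≤ b ^ k := by
    rw [abs_mul, abs_of_pos (pow_pos hb k)]
    exact mul_le_of_le_one_right (by positivity) (Real.abs_cos_le_one _)
  have hB : |a ^ k * Real.cos (c * √a)| ≤ a ^ k := by
    rw [abs_mul, abs_of_pos (pow_pos ha k)]
    exact mul_le_of_le_one_right (by positivity) (Real.abs_cos_le_one _)
  have heq : ∫ x in a..b, x ^ ((k : ℝ) - 1 / 2) * Real.sin (c * √x) =
      2 / c * ((∫ x in a..b, (k * x ^ (k - 1)) * Real.cos (c * √x))
        - b ^ k * Real.cos (c * √b) + a ^ k * Real.cos (c * √a)) := by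
    linear_combination hFTC
  rw [heq, abs_mul, abs_of_pos (by positivity : 0 < 2 / c),
    show 4 / c * b ^ k = 2 / c * (2 * b ^ k) by ring]
  refine mul_le_mul_of_nonneg_left ?_ (by positivity)
  rw [abs_le] at *
  constructor <;> linarith [hcos.1, hcos.2, hA.1, hA.2, hB.1, hB.2]

open MeasureTheory in
lemma intervalIntegrable_and_abs_integral_sum_le {ι : Type*} (s : Finset ι) {f : ι → ℝ → ℝ}
    {B : ι → ℝ} {a b : ℝ}
    (h : ∀ i ∈ s, IntervalIntegrable (f i) volume a b ∧ |∫ x in a..b, f i x| ≤ B i) :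
    IntervalIntegrable (fun x => ∑ i ∈ s, f i x) volume a b ∧
      |∫ x in a..b, ∑ i ∈ s, f i x| ≤ ∑ i ∈ s, B i := by
  constructor
  · have := IntervalIntegrable.sum s (fun i hi => (h i hi).1)
    refine this.congr ?_
    exact fun x _ => Finset.sum_apply x s f
  · rw [intervalIntegral.integral_finsetSum fun i hi => (h i hi).1]
    exact (Finset.abs_sum_le_sum_abs _ _).trans (Finset.sum_le_sum fun i hi => (h i hi).2)

lemma inv_mul_sqrt_le_sub {x : ℝ} (hx : 1 ≤ x) :
    1 / (x * √x) ≤ 6 * (1 / √x - 1 / √(x + 1)) := by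
  have h0 : 0 < √x := Real.sqrt_pos.2 (by linarith)
  have h1 : 0 < √(x + 1) := Real.sqrt_pos.2 (by linarith)
  have e0 : √x ^ 2 = x := Real.sq_sqrt (by linarith)
  have e1 : √(x + 1) ^ 2 = x + 1 := Real.sq_sqrt (by linarith)
  have h2 : √(x + 1) ≤ 2 * √x := by
    rw [Real.sqrt_le_left (by positivity), mul_pow, e0]
    linarith
  have key : 1 / √x - 1 / √(x + 1) = 1 / (√x * √(x + 1) * (√x + √(x + 1))) := by
    field_simp
    linear_combination e1 - e0
  rw [key, mul_one_div, div_le_div_iff₀ (by positivity) (by positivity)]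
  have h3 : √(x + 1) * (√x + √(x + 1)) ≤ 2 * √x * (3 * √x) :=
    mul_le_mul h2 (by linarith) (by positivity) (by positivity)
  calc 1 * (√x * √(x + 1) * (√x + √(x + 1))) = √x * (√(x + 1) * (√x + √(x + 1))) := by ring
    _ ≤ √x * (2 * √x * (3 * √x)) := mul_le_mul_of_nonneg_left h3 h0.le
    _ = 6 * (√x ^ 2 * √x) := by ring
    _ = 6 * (x * √x) := by rw [e0]

lemma sum_Ioc_inv_mul_sqrt_le (N M : ℕ) :
    ∑ r ∈ Finset.Ioc N M, 1 / ((r : ℝ) * √r) ≤ 6 / √((N : ℝ) + 1) := by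
  rcases le_total M N with h | h
  · rw [Finset.Ioc_eq_empty_of_le h, Finset.sum_empty]
    positivity
  · suffices ∑ r ∈ Finset.Ioc N M, 1 / ((r : ℝ) * √r) ≤
        6 * (1 / √((N : ℝ) + 1) - 1 / √((M : ℝ) + 1)) by
      have h1 : 0 ≤ 1 / √((M : ℝ) + 1) := by positivity
      have h2 : 6 / √((N : ℝ) + 1) = 6 * (1 / √((N : ℝ) + 1)) := by ring
      linarith
    induction M, h using Nat.le_induction with
    | base => simp
    | succ M hM ih =>
      rw [← Finset.insert_Ioc_right_eq_Ioc_add_one hM, Finset.sum_insert (by simp)]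
      have := inv_mul_sqrt_le_sub (x := ((M + 1 : ℕ) : ℝ)) (by simp)
      push_cast at this ⊢
      linarith

lemma abs_uCoef_le (l : ℕ) {θ : ℝ} (hθ : 0 < θ) {h r : ℕ} (hh : 1 ≤ h) (hr : θ * h < r) :
    |uCoef l θ h r| ≤ 1 / √h * (1 / ((r : ℝ) * √r)) * √(√((h : ℝ) * (2 * r - θ * h))) := by
  have hh0 : (0 : ℝ) < h := by exact_mod_cast hh
  have ht : 0 < θ * h := mul_pos hθ hh0
  have hr0 : (0 : ℝ) < r := ht.trans hr
  unfold uCoef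
  set n : ℝ := 2 * (r : ℝ) - θ * h with hn
  have hrn : (r : ℝ) < n := by rw [hn]; linarith
  have hn0 : 0 < n := hr0.trans hrn
  have hq0 : 0 ≤ θ * h / n := by positivity
  have hq1 : θ * h / n ≤ 1 := (div_le_one hn0).2 (by linarith)
  have hp : (1 - θ * h / n) ^ (l - 1) ≤ 1 := pow_le_one₀ (by linarith) (by linarith)
  have hp0 : 0 ≤ (1 - θ * h / n) ^ (l - 1) := pow_nonneg (by linarith) _
  rw [abs_mul, abs_mul, abs_mul, abs_pow, abs_neg, abs_one, one_pow, one_mul, abs_of_nonneg hp0,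
    abs_of_pos (Real.rpow_pos_of_pos hh0 _), abs_of_pos (Real.rpow_pos_of_pos hn0 _)]
  have hroot : √(√((h : ℝ) * n)) = (h : ℝ) ^ ((1 : ℝ) / 4) * n ^ ((1 : ℝ) / 4) := by
    rw [Real.sqrt_eq_rpow, Real.sqrt_eq_rpow, ← Real.rpow_mul (by positivity),
      ← Real.mul_rpow hh0.le hn0.le]
    norm_num
  have hhroot : 1 / √(h : ℝ) = (h : ℝ) ^ (-(1 : ℝ) / 2) := by
    rw [Real.sqrt_eq_rpow, one_div, ← Real.rpow_neg hh0.le]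
    norm_num
  have hrroot : ∀ y : ℝ, 0 < y → 1 / (y * √y) = y ^ (-(3 : ℝ) / 2) := by
    intro y hy
    rw [Real.sqrt_eq_rpow, ← Real.rpow_one_add' hy.le (by norm_num), one_div,
      ← Real.rpow_neg hy.le]
    norm_num
  have hmono : n ^ (-(3 : ℝ) / 2) ≤ (r : ℝ) ^ (-(3 : ℝ) / 2) :=
    Real.rpow_le_rpow_of_nonpos hr0 hrn.le (by norm_num)
  rw [hroot, hhroot, hrroot _ hr0]
  calc (h : ℝ) ^ (-(1 : ℝ) / 4) * n ^ (-(5 : ℝ) / 4) * (1 - θ * h / n) ^ (l - 1)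
      ≤ (h : ℝ) ^ (-(1 : ℝ) / 4) * n ^ (-(5 : ℝ) / 4) :=
        mul_le_of_le_one_right (by positivity) hp
    _ = (h : ℝ) ^ (-(1 : ℝ) / 2) * n ^ (-(3 : ℝ) / 2) *
          ((h : ℝ) ^ ((1 : ℝ) / 4) * n ^ ((1 : ℝ) / 4)) := by
        rw [mul_mul_mul_comm, ← Real.rpow_add hh0, ← Real.rpow_add hn0]
        norm_num
    _ ≤ _ := by gcongr

lemma sum_Ioc_weight_le {θ : ℝ} (hθ : 0 < θ) {h : ℕ} (hh : 1 ≤ h) (M : ℕ) :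
    ∑ r ∈ Finset.Ioc ⌊θ * h⌋₊ M, 1 / √(h : ℝ) * (1 / ((r : ℝ) * √r)) ≤
      6 / √θ * (1 / (h : ℝ)) := by
  have hh0 : (0 : ℝ) < h := by exact_mod_cast hh
  rw [← Finset.mul_sum]
  have h1 : 6 / √((⌊θ * h⌋₊ : ℝ) + 1) ≤ 6 / √(θ * h) := by
    gcongr
    exact (Nat.lt_floor_add_one _).le
  calc 1 / √(h : ℝ) * ∑ r ∈ Finset.Ioc ⌊θ * h⌋₊ M, 1 / ((r : ℝ) * √r)
      ≤ 1 / √(h : ℝ) * (6 / √(θ * h)) := by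
        gcongr
        exact (sum_Ioc_inv_mul_sqrt_le _ _).trans h1
    _ = 6 / √θ * (1 / (√(h : ℝ) * √h)) := by
        rw [Real.sqrt_mul hθ.le]
        field_simp
    _ = _ := by rw [Real.mul_self_sqrt hh0.le]

lemma sum_Icc_floor_sq_inv_le {T : ℝ} (hT : 3 ≤ T) :
    ∑ h ∈ Finset.Icc 1 ⌊(T ^ 2 : ℝ)⌋₊, 1 / (h : ℝ) ≤ 3 * Real.log T := by
  have h1 := harmonic_le_one_add_log ⌊(T ^ 2 : ℝ)⌋₊
  rw [harmonic_eq_sum_Icc] at h1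
  push_cast at h1
  have hN : 1 ≤ ⌊(T ^ 2 : ℝ)⌋₊ := Nat.le_floor (by push_cast; nlinarith)
  have h2 : Real.log (⌊(T ^ 2 : ℝ)⌋₊ : ℝ) ≤ 2 * Real.log T := by
    rw [show 2 * Real.log T = Real.log (T ^ 2) by rw [Real.log_pow]; norm_num]
    exact Real.log_le_log (by exact_mod_cast hN) (Nat.floor_le (by positivity))
  have h3 : 1 ≤ Real.log T := by
    rw [Real.le_log_iff_exp_le (by linarith)]
    linarith [Real.exp_one_lt_d9]
  simp only [one_div]
  linarith

/-- Estimate (5.15), the `S₃` integral: for `l ≥ 1` and irrational `θ > 0` there are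
`C > 0` and `T₀ ≥ 3` such that for all `T ≥ T₀`, with `H = T²`,
`J = ⌊(log T − log log T)/(2 log 2)⌋` and
`S₃(x) = (2^{3−2l}·x^{2l−1/2}/(π²·((l−1)!)²)) · Σ u(h₁,r₁)·u(h₂,r₂)·
sin(2π√x·(√(h₁(2r₁ − θh₁)) + √(h₂(2r₂ − θh₂))))` (sum over `1 ≤ hⱼ ≤ H`,
`θhⱼ < rⱼ ≤ θhⱼ(2^{2J+1} + 1/2)`), one has `|∫_T^{2T} S₃(x) dx| ≤ C·T^{2l}·log² T`. -/
theorem S3_integral (l : ℕ) (hl : 1 ≤ l) (θ : ℝ) (hθ : 0 < θ) (hirr : Irrational θ) :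
    ∃ C : ℝ, 0 < C ∧ ∃ T₀ : ℝ, 3 ≤ T₀ ∧ ∀ T : ℝ, T₀ ≤ T →
      |∫ x in T..(2 * T),
          ((2 : ℝ) ^ ((3 : ℤ) - 2 * l) * x ^ (2 * (l : ℝ) - 1 / 2) /
              (Real.pi ^ 2 * ((l - 1).factorial : ℝ) ^ 2)) *
            ∑ h₁ ∈ Finset.Icc 1 ⌊(T ^ 2 : ℝ)⌋₊,
              ∑ r₁ ∈ Finset.Ioc ⌊θ * h₁⌋₊ ⌊θ * h₁ * (2 ^ (2 * Jdef T + 1) + 1 / 2)⌋₊,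
                ∑ h₂ ∈ Finset.Icc 1 ⌊(T ^ 2 : ℝ)⌋₊,
                  ∑ r₂ ∈ Finset.Ioc ⌊θ * h₂⌋₊ ⌊θ * h₂ * (2 ^ (2 * Jdef T + 1) + 1 / 2)⌋₊,
                    uCoef l θ h₁ r₁ * uCoef l θ h₂ r₂ *
                      Real.sin (2 * Real.pi * Real.sqrt x *
                        (Real.sqrt ((h₁ : ℝ) * (2 * r₁ - θ * h₁)) +
                          Real.sqrt ((h₂ : ℝ) * (2 * r₂ - θ * h₂))))| ≤
        C * T ^ (2 * l) * Real.log T ^ 2 := by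
  have hK : (0 : ℝ) < 2 ^ ((3 : ℤ) - 2 * l) / (Real.pi ^ 2 * ((l - 1).factorial : ℝ) ^ 2) := by
    positivity
  set K : ℝ := 2 ^ ((3 : ℤ) - 2 * l) / (Real.pi ^ 2 * ((l - 1).factorial : ℝ) ^ 2) with hKdef
  refine ⟨K * 2 ^ (2 * l) * (6 / √θ * 3) ^ 2, by positivity, 3, le_rfl, fun T hT => ?_⟩
  have hT0 : 0 < T := by linarith
  set w : ℕ → ℕ → ℝ := fun h r => 1 / √(h : ℝ) * (1 / ((r : ℝ) * √r)) with hw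
  set M : ℕ → ℕ := fun h => ⌊θ * h * (2 ^ (2 * Jdef T + 1) + 1 / 2)⌋₊ with hM
  set W : ℝ := ∑ h ∈ Finset.Icc 1 ⌊(T ^ 2 : ℝ)⌋₊, ∑ r ∈ Finset.Ioc ⌊θ * h⌋₊ (M h), w h r with hWdef
  have hW0 : 0 ≤ W := by positivity
  have hW : W ≤ 6 / √θ * 3 * Real.log T := by
    calc W ≤ ∑ h ∈ Finset.Icc 1 ⌊(T ^ 2 : ℝ)⌋₊, 6 / √θ * (1 / (h : ℝ)) :=
          Finset.sum_le_sum fun h hh => sum_Ioc_weight_le hθ (Finset.mem_Icc.1 hh).1 _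
      _ ≤ 6 / √θ * (3 * Real.log T) := by
          rw [← Finset.mul_sum]
          exact mul_le_mul_of_nonneg_left (sum_Icc_floor_sq_inv_le hT) (by positivity)
      _ = _ := by ring
  have hlt : ∀ {h r : ℕ}, r ∈ Finset.Ioc ⌊θ * h⌋₊ (M h) → θ * h < r := fun {h r} hr =>
    (Nat.floor_lt (by positivity)).1 (Finset.mem_Ioc.1 hr).1
  have hterm : ∀ h₁ ∈ Finset.Icc 1 ⌊(T ^ 2 : ℝ)⌋₊, ∀ r₁ ∈ Finset.Ioc ⌊θ * h₁⌋₊ (M h₁),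
      ∀ h₂ ∈ Finset.Icc 1 ⌊(T ^ 2 : ℝ)⌋₊, ∀ r₂ ∈ Finset.Ioc ⌊θ * h₂⌋₊ (M h₂),
      IntervalIntegrable (fun x : ℝ => ((2 : ℝ) ^ ((3 : ℤ) - 2 * l) * x ^ (2 * (l : ℝ) - 1 / 2) /
              (Real.pi ^ 2 * ((l - 1).factorial : ℝ) ^ 2)) *
          (uCoef l θ h₁ r₁ * uCoef l θ h₂ r₂ *
            Real.sin (2 * Real.pi * √x *
              (√((h₁ : ℝ) * (2 * r₁ - θ * h₁)) + √((h₂ : ℝ) * (2 * r₂ - θ * h₂))))))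
          MeasureTheory.volume T (2 * T) ∧
      |∫ x in T..(2 * T), ((2 : ℝ) ^ ((3 : ℤ) - 2 * l) * x ^ (2 * (l : ℝ) - 1 / 2) /
              (Real.pi ^ 2 * ((l - 1).factorial : ℝ) ^ 2)) *
          (uCoef l θ h₁ r₁ * uCoef l θ h₂ r₂ *
            Real.sin (2 * Real.pi * √x *
              (√((h₁ : ℝ) * (2 * r₁ - θ * h₁)) + √((h₂ : ℝ) * (2 * r₂ - θ * h₂)))))| ≤
        K * (2 * T) ^ (2 * l) * (w h₁ r₁ * w h₂ r₂) := by
    intro h₁ hh₁ r₁ hr₁ h₂ hh₂ r₂ hr₂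
    have hu₁ := abs_uCoef_le l hθ (Finset.mem_Icc.1 hh₁).1 (hlt hr₁)
    have hu₂ := abs_uCoef_le l hθ (Finset.mem_Icc.1 hh₂).1 (hlt hr₂)
    have hspos : ∀ {h r : ℕ}, h ∈ Finset.Icc 1 ⌊(T ^ 2 : ℝ)⌋₊ → θ * h < r →
        0 < √((h : ℝ) * (2 * r - θ * h)) := by
      intro h r hh hr
      have hh0 : (0 : ℝ) < h := by exact_mod_cast (Finset.mem_Icc.1 hh).1
      have := mul_pos hθ hh0
      exact Real.sqrt_pos.2 (mul_pos hh0 (by linarith))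
    have hs₁ := hspos hh₁ (hlt hr₁)
    have hs₂ := hspos hh₂ (hlt hr₂)
    set s₁ := √((h₁ : ℝ) * (2 * r₁ - θ * h₁))
    set s₂ := √((h₂ : ℝ) * (2 * r₂ - θ * h₂))
    obtain ⟨hI, hB⟩ := abs_integral_rpow_mul_sin_sqrt_le (2 * l) hT0 (by linarith : T ≤ 2 * T)
      (by positivity : 0 < 2 * Real.pi * (s₁ + s₂))
    have hfun : (fun x : ℝ => ((2 : ℝ) ^ ((3 : ℤ) - 2 * l) * x ^ (2 * (l : ℝ) - 1 / 2) /
              (Real.pi ^ 2 * ((l - 1).factorial : ℝ) ^ 2)) *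
          (uCoef l θ h₁ r₁ * uCoef l θ h₂ r₂ * Real.sin (2 * Real.pi * √x * (s₁ + s₂)))) =
        fun x : ℝ => (K * (uCoef l θ h₁ r₁ * uCoef l θ h₂ r₂)) *
          (x ^ (((2 * l : ℕ) : ℝ) - 1 / 2) * Real.sin (2 * Real.pi * (s₁ + s₂) * √x)) := by
      funext x
      rw [hKdef, mul_right_comm (2 * Real.pi) (s₁ + s₂)]
      push_cast
      ring
    rw [hfun]
    refine ⟨hI.const_mul _, ?_⟩
    rw [intervalIntegral.integral_const_mul, abs_mul, abs_mul, abs_of_pos hK, abs_mul]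
    have hAG : √s₁ * √s₂ * (4 / (2 * Real.pi * (s₁ + s₂))) ≤ 1 := by
      rw [mul_div_assoc', div_le_one (by positivity)]
      have e₁ := Real.sq_sqrt hs₁.le
      have e₂ := Real.sq_sqrt hs₂.le
      have hpi := Real.pi_gt_three
      have hsum : 0 < s₁ + s₂ := by positivity
      nlinarith [sq_nonneg (√s₁ - √s₂), mul_pos hsum (by linarith : 0 < Real.pi - 1)]
    calc K * (|uCoef l θ h₁ r₁| * |uCoef l θ h₂ r₂|) * _
        ≤ K * ((w h₁ r₁ * √s₁) * (w h₂ r₂ * √s₂)) *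
            (4 / (2 * Real.pi * (s₁ + s₂)) * (2 * T) ^ (2 * l)) := by
          gcongr
      _ = K * (2 * T) ^ (2 * l) * (w h₁ r₁ * w h₂ r₂) *
            (√s₁ * √s₂ * (4 / (2 * Real.pi * (s₁ + s₂)))) := by ring
      _ ≤ _ := mul_le_of_le_one_right (by positivity) hAG
  have hmain := (intervalIntegrable_and_abs_integral_sum_le _ fun h₁ hh₁ =>
    intervalIntegrable_and_abs_integral_sum_le _ fun r₁ hr₁ =>
    intervalIntegrable_and_abs_integral_sum_le _ fun h₂ hh₂ =>
    intervalIntegrable_and_abs_integral_sum_le _ fun r₂ hr₂ =>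
      hterm h₁ hh₁ r₁ hr₁ h₂ hh₂ r₂ hr₂).2
  simp only [← Finset.mul_sum] at hmain
  refine hmain.trans ?_
  have hsq : ∑ h₁ ∈ Finset.Icc 1 ⌊(T ^ 2 : ℝ)⌋₊, ∑ r₁ ∈ Finset.Ioc ⌊θ * h₁⌋₊ (M h₁),
      w h₁ r₁ * W = W * W := by
    simp only [← Finset.sum_mul, ← hWdef]
  rw [hsq]
  calc K * (2 * T) ^ (2 * l) * (W * W)
      ≤ K * (2 * T) ^ (2 * l) *
          ((6 / √θ * 3 * Real.log T) * (6 / √θ * 3 * Real.log T)) :=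
        mul_le_mul_of_nonneg_left (mul_self_le_mul_self hW0 hW) (by positivity)
    _ = _ := by rw [mul_pow 2 T]; ring
end
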